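/- For every integer r ≥ 1, every σ ≥ 1, and every rectangle Ω there is a constant C > 0 depending only on r, σ and the diameter of Ω such that: for every σ-quasi-uniform rectangular partition P of Ω with mesh size h, every α : Ω → ℝ piecewise constant with respect to P with 0 < α_0 ≤ α ≤ α_1, every u : Ω → ℝ that is continuous, vanishes on ∂Ω, is C^{r+2} on each closed cell, and whose cellwise flux functions α·∂u/∂x and α·∂u/∂y extend continuously to Ω, and every finite volume solution u_P ∈ U_P^r, the L²-norm error satisfies ( ∫_Ω (u − u_P)^2 )^{1/2} ≤ C · (1 + α_1/α_0) · h^{r+1} · ‖u‖_{r+2,P}, where ‖u‖_{r+2,P} = ( Σ_{s=0}^{r+2} |u|_{s,P}^2 )^{1/2}. -/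

import Mathlib

open Polynomial MeasureTheory

noncomputable section

/-- `Leg r` is the `r`-th (formal) derivative of `(X² − 1)^r`, a nonzero scalar
multiple of the degree-`r` Legendre polynomial. -/
def Leg (r : ℕ) : Polynomial ℝ :=
  (fun p => Polynomial.derivative p)^[r] ((Polynomial.X ^ 2 - 1) ^ r)

/-- `G 1 < … < G r` are the Gauss points: the roots of `Leg r`, all in `(-1,1)`. -/
def IsGaussPoints (r : ℕ) (G : ℕ → ℝ) : Prop :=
  (∀ k, 1 ≤ k → k < r → G k < G (k + 1)) ∧
  ∀ k, 1 ≤ k → k ≤ r → G k ∈ Set.Ioo (-1 : ℝ) 1 ∧ (Leg r).IsRoot (G k)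

/-- `A k = ∫_{-1}^{1} ℓ_k` where `ℓ_k` is the Lagrange basis polynomial of degree
`≤ r - 1` at the Gauss points, i.e. `ℓ_k (G j) = δ_{jk}`. -/
def IsGaussWeights (r : ℕ) (G A : ℕ → ℝ) : Prop :=
  ∀ k, 1 ≤ k → k ≤ r → ∃ ℓ : Polynomial ℝ,
    ℓ.natDegree ≤ r - 1 ∧
    (∀ j, 1 ≤ j → j ≤ r → ℓ.eval (G j) = if j = k then 1 else 0) ∧
    A k = ∫ x in (-1 : ℝ)..1, ℓ.eval x

/-- `Lob 0 = −1 < Lob 1 < … < Lob (r−1) < Lob r = 1` are the Lobatto points: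
`±1` together with the roots of the derivative of `Leg r`. -/
def IsLobattoPoints (r : ℕ) (L : ℕ → ℝ) : Prop :=
  L 0 = -1 ∧ L r = 1 ∧ (∀ k < r, L k < L (k + 1)) ∧
  ∀ k, 1 ≤ k → k + 1 ≤ r → L k ∈ Set.Ioo (-1 : ℝ) 1 ∧
    (Polynomial.derivative (Leg r)).IsRoot (L k)

/-- Cellwise partial derivative in the first (`x`) coordinate. -/
def pdx (f : ℝ × ℝ → ℝ) (z : ℝ × ℝ) : ℝ := fderiv ℝ f z (1, 0)

/-- Cellwise partial derivative in the second (`y`) coordinate. -/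
def pdy (f : ℝ × ℝ → ℝ) (z : ℝ × ℝ) : ℝ := fderiv ℝ f z (0, 1)

/-- A rectangular partition of `Ω = [a,b] × [c,d]`:
`a = x₀ < x₁ < … < x_m = b`, `c = y₀ < y₁ < … < y_n = d`. -/
structure RectPartition (a b c d : ℝ) where
  m : ℕ
  n : ℕ
  hm : 0 < m
  hn : 0 < n
  x : ℕ → ℝ
  y : ℕ → ℝ
  hxa : x 0 = a
  hxb : x m = b
  hyc : y 0 = c
  hyd : y n = d
  hxlt : ∀ i < m, x i < x (i + 1)
  hylt : ∀ j < n, y j < y (j + 1)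

namespace RectPartition

variable {a b c d : ℝ}

/-- The domain `Ω = [a,b] × [c,d]`. -/
def dom (_P : RectPartition a b c d) : Set (ℝ × ℝ) := Set.Icc a b ×ˢ Set.Icc c d

/-- The boundary `∂Ω`. -/
def bdry (P : RectPartition a b c d) : Set (ℝ × ℝ) :=
  P.dom \ (Set.Ioo a b ×ˢ Set.Ioo c d)

variable (P : RectPartition a b c d)

/-- Side length `h_i^x = x_i − x_{i−1}`. -/
def hx (i : ℕ) : ℝ := P.x i - P.x (i - 1)

/-- Side length `h_j^y = y_j − y_{j−1}`. -/
def hy (j : ℕ) : ℝ := P.y j - P.y (j - 1)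

/-- The closed cell `τ_{i,j} = [x_{i−1}, x_i] × [y_{j−1}, y_j]`. -/
def cell (i j : ℕ) : Set (ℝ × ℝ) :=
  Set.Icc (P.x (i - 1)) (P.x i) ×ˢ Set.Icc (P.y (j - 1)) (P.y j)

/-- The open cell `(x_{i−1}, x_i) × (y_{j−1}, y_j)`. -/
def openCell (i j : ℕ) : Set (ℝ × ℝ) :=
  Set.Ioo (P.x (i - 1)) (P.x i) ×ˢ Set.Ioo (P.y (j - 1)) (P.y j)

/-- The finite set of all side lengths of the partition. -/
def sides : Finset ℝ := ((Finset.Icc 1 P.m).image P.hx) ∪ ((Finset.Icc 1 P.n).image P.hy)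

lemma sides_nonempty : P.sides.Nonempty :=
  ⟨P.hx 1, Finset.mem_union_left _
    (Finset.mem_image_of_mem _ (Finset.mem_Icc.mpr ⟨le_rfl, P.hm⟩))⟩

/-- The mesh size `h`: the largest side length. -/
def meshSize : ℝ := P.sides.max' P.sides_nonempty

/-- `σ`-quasi-uniformity: every side length is at most `σ` times any other,
i.e. `h ≤ σ · min side`. -/
def QuasiUniform (σ : ℝ) : Prop := ∀ s ∈ P.sides, ∀ t ∈ P.sides, s ≤ σ * t

variable (r : ℕ) (G : ℕ → ℝ)

/-- The Gauss point `g^x_{i,k} = (x_i + x_{i−1} + h_i^x G_k)/2` for `1 ≤ k ≤ r`,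
with the conventions `g^x_{i,r+1} = g^x_{i+1,1}` (for `i < m`) and `g^x_{m,r+1} = b`. -/
def gx (i k : ℕ) : ℝ :=
  if k = r + 1 then
    (if i = P.m then P.x P.m
     else (P.x (i + 1) + P.x i + P.hx (i + 1) * G 1) / 2)
  else (P.x i + P.x (i - 1) + P.hx i * G k) / 2

/-- The Gauss point `g^y_{j,l}`, with the analogous conventions. -/
def gy (j l : ℕ) : ℝ :=
  if l = r + 1 then
    (if j = P.n then P.y P.n
     else (P.y (j + 1) + P.y j + P.hy (j + 1) * G 1) / 2)
  else (P.y j + P.y (j - 1) + P.hy j * G l) / 2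

end RectPartition

/-- A function on `Ω` which is piecewise smooth with respect to the partition:
a global function together with, for each cell, a (smooth) extension of its
restriction to the closed cell; cellwise derivatives are derivatives of the
cell functions. -/
structure PiecewiseFun {a b c d : ℝ} (P : RectPartition a b c d) where
  toFun : ℝ × ℝ → ℝ
  cellFun : ℕ → ℕ → ℝ × ℝ → ℝ
  agree : ∀ i ∈ Finset.Icc 1 P.m, ∀ j ∈ Finset.Icc 1 P.n, ∀ z ∈ P.cell i j,
    cellFun i j z = toFun z

namespace PiecewiseFun

variable {a b c d : ℝ} {P : RectPartition a b c d}

/-- Difference of two piecewise functions. -/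
def sub (u v : PiecewiseFun P) : PiecewiseFun P where
  toFun := fun z => u.toFun z - v.toFun z
  cellFun := fun i j z => u.cellFun i j z - v.cellFun i j z
  agree := fun i hi j hj z hz => by
    simp only [u.agree i hi j hj z hz, v.agree i hi j hj z hz]

end PiecewiseFun

/-- Cellwise `∂/∂x` of a piecewise function. -/
def cellDx {a b c d : ℝ} {P : RectPartition a b c d} (v : PiecewiseFun P) :
    ℕ → ℕ → ℝ × ℝ → ℝ := fun i j => pdx (v.cellFun i j)

/-- Cellwise `∂/∂y` of a piecewise function. -/
def cellDy {a b c d : ℝ} {P : RectPartition a b c d} (v : PiecewiseFun P) :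
    ℕ → ℕ → ℝ × ℝ → ℝ := fun i j => pdy (v.cellFun i j)

/-- `v` is `C^s` on each closed cell. -/
def CellSmooth {a b c d : ℝ} (P : RectPartition a b c d) (s : ℕ)
    (u : PiecewiseFun P) : Prop :=
  ∀ i ∈ Finset.Icc 1 P.m, ∀ j ∈ Finset.Icc 1 P.n, ContDiff ℝ s (u.cellFun i j)

/-- Evaluation of a bivariate polynomial (outer variable ↦ `x`, coefficients are
polynomials in `y`). -/
def evalXY (p : Polynomial (Polynomial ℝ)) (x y : ℝ) : ℝ :=
  (p.map (Polynomial.evalRingHom y)).eval x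

/-- `f` is (globally) a polynomial of degree `≤ r` in each of the two variables. -/
def IsBiPoly (r : ℕ) (f : ℝ × ℝ → ℝ) : Prop :=
  ∃ p : Polynomial (Polynomial ℝ), p.natDegree ≤ r ∧ (∀ k, (p.coeff k).natDegree ≤ r) ∧
    ∀ x y : ℝ, f (x, y) = evalXY p x y

/-- Membership in the trial space `U_P^r`: continuous on `Ω`, vanishing on `∂Ω`,
and a bi-degree `≤ r` polynomial on each cell. -/
def IsTrialFun {a b c d : ℝ} (r : ℕ) (P : RectPartition a b c d)
    (v : PiecewiseFun P) : Prop :=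
  ContinuousOn v.toFun P.dom ∧ (∀ z ∈ P.bdry, v.toFun z = 0) ∧
  ∀ i ∈ Finset.Icc 1 P.m, ∀ j ∈ Finset.Icc 1 P.n, IsBiPoly r (v.cellFun i j)

/-- The coefficients of a test function extended by the conventions
`w_{i,0;j,l} = w_{i−1,r;j,l}` (`0` if `i = 1`) and
`w_{i,k;j,0} = w_{i,k;j−1,r}` (`0` if `j = 1`). -/
def wE (r : ℕ) (w : ℕ → ℕ → ℕ → ℕ → ℝ) (i k j l : ℕ) : ℝ :=
  if (k = 0 ∧ i = 1) ∨ (l = 0 ∧ j = 1) then 0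
  else
    w (if k = 0 then i - 1 else i) (if k = 0 then r else k)
      (if l = 0 then j - 1 else j) (if l = 0 then r else l)

/-- The jump `[w]^x_{i,k;j,l} = w_{i,k;j,l} − w_{i,k−1;j,l}`. -/
def jumpX (r : ℕ) (w : ℕ → ℕ → ℕ → ℕ → ℝ) (i k j l : ℕ) : ℝ :=
  wE r w i k j l - wE r w i (k - 1) j l

/-- The jump `[w]^y_{i,k;j,l} = w_{i,k;j,l} − w_{i,k;j,l−1}`. -/
def jumpY (r : ℕ) (w : ℕ → ℕ → ℕ → ℕ → ℝ) (i k j l : ℕ) : ℝ :=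
  wE r w i k j l - wE r w i k j (l - 1)

/-- The double jump `⌊w⌋_{i,k;j,l}`. -/
def jumpXY (r : ℕ) (w : ℕ → ℕ → ℕ → ℕ → ℝ) (i k j l : ℕ) : ℝ :=
  wE r w i k j l - wE r w i (k - 1) j l - wE r w i k j (l - 1) + wE r w i (k - 1) j (l - 1)

/-- A test function: coefficients `w_{i,k;j,l}`, `1 ≤ i ≤ m`, `1 ≤ k ≤ r`,
`1 ≤ j ≤ n`, `1 ≤ l ≤ r`, vanishing for `(i,k) = (m,r)` or `(j,l) = (n,r)`. -/
def IsTestFun {a b c d : ℝ} (r : ℕ) (P : RectPartition a b c d)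
    (w : ℕ → ℕ → ℕ → ℕ → ℝ) : Prop :=
  (∀ j ∈ Finset.Icc 1 P.n, ∀ l ∈ Finset.Icc 1 r, w P.m r j l = 0) ∧
  (∀ i ∈ Finset.Icc 1 P.m, ∀ k ∈ Finset.Icc 1 r, w i k P.n r = 0)

/-- The index set `X`: quadruples `(i,k,j,l)` with `(j,l) ≠ (n,r)`. -/
def idxX {a b c d : ℝ} (r : ℕ) (P : RectPartition a b c d) : Finset (ℕ × ℕ × ℕ × ℕ) :=
  (Finset.Icc 1 P.m ×ˢ Finset.Icc 1 r ×ˢ Finset.Icc 1 P.n ×ˢ Finset.Icc 1 r).filter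
    fun q => ¬(q.2.2.1 = P.n ∧ q.2.2.2 = r)

/-- The index set `Y`: quadruples `(i,k,j,l)` with `(i,k) ≠ (m,r)`. -/
def idxY {a b c d : ℝ} (r : ℕ) (P : RectPartition a b c d) : Finset (ℕ × ℕ × ℕ × ℕ) :=
  (Finset.Icc 1 P.m ×ˢ Finset.Icc 1 r ×ˢ Finset.Icc 1 P.n ×ˢ Finset.Icc 1 r).filter
    fun q => ¬(q.1 = P.m ∧ q.2.1 = r)

/-- The index set of interior dual volumes: `(i,k) ≠ (m,r)` and `(j,l) ≠ (n,r)`. -/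
def idxZ {a b c d : ℝ} (r : ℕ) (P : RectPartition a b c d) : Finset (ℕ × ℕ × ℕ × ℕ) :=
  (Finset.Icc 1 P.m ×ˢ Finset.Icc 1 r ×ˢ Finset.Icc 1 P.n ×ˢ Finset.Icc 1 r).filter
    fun q => ¬(q.1 = P.m ∧ q.2.1 = r) ∧ ¬(q.2.2.1 = P.n ∧ q.2.2.2 = r)

/-- The dual-mesh seminorm `|w|_{P'}`. -/
def dualSemi {a b c d : ℝ} (r : ℕ) (P : RectPartition a b c d)
    (w : ℕ → ℕ → ℕ → ℕ → ℝ) : ℝ :=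
  Real.sqrt
    ((∑ q ∈ idxX r P, (jumpX r w q.1 q.2.1 q.2.2.1 q.2.2.2) ^ 2) +
     (∑ q ∈ idxY r P, (jumpY r w q.1 q.2.1 q.2.2.1 q.2.2.2) ^ 2))

/-- The FVM bilinear form `a_P(v, w)`, with the cellwise derivatives of `v`
given by `Dxv i j` and `Dyv i j` on cell `(i,j)`.  The integrals along Gauss
lines are split at the cell interfaces `y = y_j` (resp. `x = x_i`), which only
matters for the last Gauss subinterval `l = r` (resp. `k = r`). -/
def aP {a b c d : ℝ} (r : ℕ) (G : ℕ → ℝ) (P : RectPartition a b c d)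
    (α : ℝ × ℝ → ℝ) (Dxv Dyv : ℕ → ℕ → ℝ × ℝ → ℝ) (w : ℕ → ℕ → ℕ → ℕ → ℝ) : ℝ :=
  (∑ q ∈ idxX r P,
    jumpX r w q.1 q.2.1 q.2.2.1 q.2.2.2 *
      ((∫ t in (P.gy r G q.2.2.1 q.2.2.2)..(min (P.gy r G q.2.2.1 (q.2.2.2 + 1)) (P.y q.2.2.1)),
          α (P.gx r G q.1 q.2.1, t) * Dxv q.1 q.2.2.1 (P.gx r G q.1 q.2.1, t)) +
       (∫ t in (P.y q.2.2.1)..(max (P.gy r G q.2.2.1 (q.2.2.2 + 1)) (P.y q.2.2.1)),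
          α (P.gx r G q.1 q.2.1, t) * Dxv q.1 (q.2.2.1 + 1) (P.gx r G q.1 q.2.1, t)))) +
  (∑ q ∈ idxY r P,
    jumpY r w q.1 q.2.1 q.2.2.1 q.2.2.2 *
      ((∫ t in (P.gx r G q.1 q.2.1)..(min (P.gx r G q.1 (q.2.1 + 1)) (P.x q.1)),
          α (t, P.gy r G q.2.2.1 q.2.2.2) * Dyv q.1 q.2.2.1 (t, P.gy r G q.2.2.1 q.2.2.2)) +
       (∫ t in (P.x q.1)..(max (P.gx r G q.1 (q.2.1 + 1)) (P.x q.1)),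
          α (t, P.gy r G q.2.2.1 q.2.2.2) * Dyv (q.1 + 1) q.2.2.1 (t, P.gy r G q.2.2.1 q.2.2.2))))

/-- The broken `H¹` seminorm `|v|₁` computed cellwise. -/
def semiH1 {a b c d : ℝ} (P : RectPartition a b c d) (v : PiecewiseFun P) : ℝ :=
  Real.sqrt (∑ i ∈ Finset.Icc 1 P.m, ∑ j ∈ Finset.Icc 1 P.n,
    ∫ z in P.cell i j, ((cellDx v i j z) ^ 2 + (cellDy v i j z) ^ 2))

/-- The mesh-dependent seminorm `|v|_P` (broken `H²`-type seminorm). -/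
def semiP {a b c d : ℝ} (P : RectPartition a b c d) (v : PiecewiseFun P) : ℝ :=
  Real.sqrt (∑ i ∈ Finset.Icc 1 P.m, ∑ j ∈ Finset.Icc 1 P.n,
    ((∫ z in P.cell i j, ((cellDx v i j z) ^ 2 + (cellDy v i j z) ^ 2)) +
      (P.hx i ^ 2 + P.hy j ^ 2) *
        ∫ z in P.cell i j,
          ((pdx (pdx (v.cellFun i j)) z) ^ 2 + 2 * (pdy (pdx (v.cellFun i j)) z) ^ 2 +
            (pdy (pdy (v.cellFun i j)) z) ^ 2)))

/-- The broken seminorm `|u|_{s,P}`. -/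
def brokenSemi {a b c d : ℝ} (P : RectPartition a b c d) (u : PiecewiseFun P) (s : ℕ) : ℝ :=
  Real.sqrt (∑ i ∈ Finset.Icc 1 P.m, ∑ j ∈ Finset.Icc 1 P.n, ∑ t ∈ Finset.range (s + 1),
    ∫ z in P.cell i j, (pdx^[t] (pdy^[s - t] (u.cellFun i j)) z) ^ 2)

/-- The broken norm `‖u‖_{s,P} = (Σ_{t=0}^{s} |u|_{t,P}²)^{1/2}`. -/
def brokenNorm {a b c d : ℝ} (P : RectPartition a b c d) (u : PiecewiseFun P) (s : ℕ) : ℝ :=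
  Real.sqrt (∑ t ∈ Finset.range (s + 1), (brokenSemi P u t) ^ 2)

/-- `w = Πv`: the test function determined by the double-jump constraints
`⌊Πv⌋_{i,k;j,l} = A^x_{i,k} A^y_{j,l} ∂²v/∂x∂y(g^x_{i,k}, g^y_{j,l})`. -/
def IsPiOf {a b c d : ℝ} (r : ℕ) (G A : ℕ → ℝ) (P : RectPartition a b c d)
    (v : PiecewiseFun P) (w : ℕ → ℕ → ℕ → ℕ → ℝ) : Prop :=
  IsTestFun r P w ∧
  ∀ i ∈ Finset.Icc 1 P.m, ∀ k ∈ Finset.Icc 1 r, ∀ j ∈ Finset.Icc 1 P.n, ∀ l ∈ Finset.Icc 1 r,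
    ¬(i = P.m ∧ k = r) → ¬(j = P.n ∧ l = r) →
    jumpXY r w i k j l =
      (P.hx i * A k / 2) * (P.hy j * A l / 2) *
        pdy (pdx (v.cellFun i j)) (P.gx r G i k, P.gy r G j l)

/-- `α` is piecewise constant with respect to `P`. -/
def PiecewiseConstant {a b c d : ℝ} (P : RectPartition a b c d) (α : ℝ × ℝ → ℝ) : Prop :=
  ∀ i ∈ Finset.Icc 1 P.m, ∀ j ∈ Finset.Icc 1 P.n, ∃ cst : ℝ, ∀ z ∈ P.openCell i j, α z = cst

/-- The cellwise fluxes `α ∂u/∂x`, `α ∂u/∂y` extend continuously to `Ω`. -/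
def FluxContinuous {a b c d : ℝ} (P : RectPartition a b c d) (α : ℝ × ℝ → ℝ)
    (u : PiecewiseFun P) : Prop :=
  ∃ Fx Fy : ℝ × ℝ → ℝ, ContinuousOn Fx P.dom ∧ ContinuousOn Fy P.dom ∧
    ∀ i ∈ Finset.Icc 1 P.m, ∀ j ∈ Finset.Icc 1 P.n, ∀ z ∈ P.openCell i j,
      Fx z = α z * cellDx u i j z ∧ Fy z = α z * cellDy u i j z

/-- The iterated integral of `f` over the rectangle `[x₁,x₂] × [y₁,y₂]`. -/
def rectInt (f : ℝ × ℝ → ℝ) (x₁ x₂ y₁ y₂ : ℝ) : ℝ :=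
  ∫ s in x₁..x₂, ∫ t in y₁..y₂, f (s, t)

/-- The integral over the dual volume `τ'_{i,k;j,l} = [g^x_{i,k}, g^x_{i,k+1}] ×
[g^y_{j,l}, g^y_{j,l+1}]` of a cellwise-defined integrand `F i j`, split along
the cell interfaces `x = x_i` and `y = y_j`. -/
def dualCellInt {a b c d : ℝ} (r : ℕ) (G : ℕ → ℝ) (P : RectPartition a b c d)
    (F : ℕ → ℕ → ℝ × ℝ → ℝ) (i k j l : ℕ) : ℝ :=
  rectInt (F i j) (P.gx r G i k) (min (P.gx r G i (k + 1)) (P.x i))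
    (P.gy r G j l) (min (P.gy r G j (l + 1)) (P.y j)) +
  rectInt (F (i + 1) j) (P.x i) (max (P.gx r G i (k + 1)) (P.x i))
    (P.gy r G j l) (min (P.gy r G j (l + 1)) (P.y j)) +
  rectInt (F i (j + 1)) (P.gx r G i k) (min (P.gx r G i (k + 1)) (P.x i))
    (P.y j) (max (P.gy r G j (l + 1)) (P.y j)) +
  rectInt (F (i + 1) (j + 1)) (P.x i) (max (P.gx r G i (k + 1)) (P.x i))
    (P.y j) (max (P.gy r G j (l + 1)) (P.y j))

/-- The cellwise source term `f = −α (∂²u/∂x² + ∂²u/∂y²)` (for piecewise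
constant `α`). -/
def cellSource {a b c d : ℝ} {P : RectPartition a b c d} (α : ℝ × ℝ → ℝ)
    (u : PiecewiseFun P) (i j : ℕ) (z : ℝ × ℝ) : ℝ :=
  -(α z * (pdx (pdx (u.cellFun i j)) z + pdy (pdy (u.cellFun i j)) z))

/-- The right-hand side `Σ w_{i,k;j,l} ∫_{τ'_{i,k;j,l}} f` of the FV scheme. -/
def fvRHS {a b c d : ℝ} (r : ℕ) (G : ℕ → ℝ) (P : RectPartition a b c d)
    (α : ℝ × ℝ → ℝ) (u : PiecewiseFun P) (w : ℕ → ℕ → ℕ → ℕ → ℝ) : ℝ :=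
  ∑ q ∈ idxZ r P, w q.1 q.2.1 q.2.2.1 q.2.2.2 *
    dualCellInt r G P (cellSource α u) q.1 q.2.1 q.2.2.1 q.2.2.2

/-- `uP` is a finite volume solution for the exact solution `u`. -/
def IsFVSolution {a b c d : ℝ} (r : ℕ) (G : ℕ → ℝ) (P : RectPartition a b c d)
    (α : ℝ × ℝ → ℝ) (u uP : PiecewiseFun P) : Prop :=
  IsTrialFun r P uP ∧
  ∀ w, IsTestFun r P w → aP r G P α (cellDx uP) (cellDy uP) w = fvRHS r G P α u w

/-- The Lobatto node in cell `(i,j)` with 0-based indices `0 ≤ k, l ≤ r`. -/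
def lobattoNode {a b c d : ℝ} (P : RectPartition a b c d) (L : ℕ → ℝ)
    (i j k l : ℕ) : ℝ × ℝ :=
  ((P.x (i - 1) + P.x i + P.hx i * L k) / 2, (P.y (j - 1) + P.y j + P.hy j * L l) / 2)

/-- `uI` is the Lobatto interpolant of `u` in the trial space `U_P^r`. -/
def IsLobattoInterp {a b c d : ℝ} (r : ℕ) (L : ℕ → ℝ) (P : RectPartition a b c d)
    (u : ℝ × ℝ → ℝ) (uI : PiecewiseFun P) : Prop :=
  IsTrialFun r P uI ∧
  ∀ i ∈ Finset.Icc 1 P.m, ∀ j ∈ Finset.Icc 1 P.n,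
    ∀ k ∈ Finset.Icc 0 r, ∀ l ∈ Finset.Icc 0 r,
      uI.toFun (lobattoNode P L i j k l) = u (lobattoNode P L i j k l)

/-- The piecewise oscillation `osc_P(α)`: the maximum over all cells of
`ess sup α − ess inf α`. -/
def oscP {a b c d : ℝ} (P : RectPartition a b c d) (α : ℝ × ℝ → ℝ) : ℝ :=
  (Finset.Icc 1 P.m ×ˢ Finset.Icc 1 P.n).sup'
    (Finset.Nonempty.product (Finset.nonempty_Icc.mpr P.hm) (Finset.nonempty_Icc.mpr P.hn))
    fun p => essSup α (volume.restrict (P.cell p.1 p.2)) -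
      essInf α (volume.restrict (P.cell p.1 p.2))

end

namespace FVM

/-! ### Gauss quadrature on the reference interval -/

lemma poly_intervalIntegrable (P : ℝ[X]) (a b : ℝ) :
    IntervalIntegrable (fun x => P.eval x) volume a b :=
  P.continuous.intervalIntegrable a b

lemma integral_derivative_eval (P : ℝ[X]) (a b : ℝ) :
    ∫ x in a..b, (derivative P).eval x = P.eval b - P.eval a :=
  intervalIntegral.integral_eq_sub_of_hasDerivAt (fun x _ => P.hasDerivAt x)
    (poly_intervalIntegrable _ a b)

lemma exists_antiderivative (P : ℝ[X]) (r : ℕ) (hP : P.natDegree ≤ r) :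
    ∃ Q : ℝ[X], derivative Q = P ∧ Q.natDegree ≤ r + 1 := by
  refine ⟨∑ n ∈ Finset.range (r + 1), monomial (n + 1) (P.coeff n / (n + 1)), ?_, ?_⟩
  · rw [derivative_sum]
    conv_rhs => rw [P.as_sum_range' (r + 1) (by omega)]
    refine Finset.sum_congr rfl fun n _ => ?_
    rw [derivative_monomial]
    have : (n : ℝ) + 1 ≠ 0 := by positivity
    simp [this]
  · refine natDegree_sum_le_of_forall_le _ _ fun n hn => ?_
    refine (natDegree_monomial_le _).trans ?_
    have := Finset.mem_range.mp hn
    omega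

lemma iterate_derivative_eval_endpoint (r k : ℕ) (hk : k < r) (e : ℝ) (he : e ^ 2 = 1) :
    (derivative^[k] ((X ^ 2 - 1 : ℝ[X]) ^ r)).eval e = 0 := by
  have h1 : (X - C e) ^ r ∣ (X ^ 2 - 1 : ℝ[X]) ^ r := by
    refine pow_dvd_pow_of_dvd ⟨X + C e, ?_⟩ r
    have : (C e : ℝ[X]) ^ 2 = 1 := by rw [← C_pow, he, C_1]
    linear_combination this
  have h2 : (X - C e) ∣ derivative^[k] ((X ^ 2 - 1 : ℝ[X]) ^ r) :=
    (dvd_pow_self _ (by omega)).trans (pow_sub_dvd_iterate_derivative_of_pow_dvd k h1)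
  exact dvd_iff_isRoot.mp h2

lemma integral_iterate_derivative_mul (r : ℕ) (k : ℕ) (hk : k ≤ r) (s : ℝ[X])
    (hs : s.degree < k) :
    ∫ x in (-1 : ℝ)..1, (derivative^[k] ((X ^ 2 - 1 : ℝ[X]) ^ r)).eval x * s.eval x = 0 := by
  induction k generalizing s with
  | zero =>
    have : s = 0 := by
      rw [← degree_eq_bot]
      simpa [Nat.WithBot.lt_zero_iff] using hs
    simp [this]
  | succ k ih =>
    set W := derivative^[k] ((X ^ 2 - 1 : ℝ[X]) ^ r) with hW
    have h1 := integral_derivative_eval (W * s) (-1) 1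
    rw [derivative_mul] at h1
    simp only [eval_add, eval_mul] at h1
    rw [intervalIntegral.integral_add, hW,
      iterate_derivative_eval_endpoint r k (by omega) 1 (by norm_num),
      iterate_derivative_eval_endpoint r k (by omega) (-1) (by norm_num), ← hW] at h1
    · rw [ih (by omega) (derivative s) ?_] at h1
      · rw [Function.iterate_succ_apply', ← hW]
        simpa using h1
      · by_cases h0 : s = 0
        · simp [h0]
        · refine lt_of_lt_of_le (degree_derivative_lt h0) ?_
          rw [degree_eq_natDegree h0] at hs ⊢
          exact_mod_cast Nat.lt_succ_iff.mp (by exact_mod_cast hs)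
    · simpa using poly_intervalIntegrable (derivative W * s) (-1) 1
    · simpa using poly_intervalIntegrable (W * derivative s) (-1) 1

lemma W_coeff (r : ℕ) : ((X ^ 2 - 1 : ℝ[X]) ^ r).coeff (2 * r) = 1 := by
  have hm : (X ^ 2 - 1 : ℝ[X]).Monic := by monicity!
  have hd : (X ^ 2 - 1 : ℝ[X]).natDegree = 2 := by compute_degree!
  have := (hm.pow r).coeff_natDegree
  rwa [hm.natDegree_pow, hd, mul_comm] at this

lemma W_natDegree (r : ℕ) : ((X ^ 2 - 1 : ℝ[X]) ^ r).natDegree = 2 * r := by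
  have hm : (X ^ 2 - 1 : ℝ[X]).Monic := by monicity!
  have hd : (X ^ 2 - 1 : ℝ[X]).natDegree = 2 := by compute_degree!
  rw [hm.natDegree_pow, hd, mul_comm]

lemma iterate_coeff_ne (r k : ℕ) (hk : k ≤ 2 * r) :
    (derivative^[k] ((X ^ 2 - 1 : ℝ[X]) ^ r)).coeff (2 * r - k) ≠ 0 := by
  rw [coeff_iterate_derivative, show 2 * r - k + k = 2 * r by omega, W_coeff]
  simp [Nat.descFactorial_eq_zero_iff_lt]
  omega

lemma iterate_natDegree (r k : ℕ) :
    (derivative^[k] ((X ^ 2 - 1 : ℝ[X]) ^ r)).natDegree ≤ 2 * r - k := by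
  refine (natDegree_iterate_derivative _ k).trans ?_
  rw [W_natDegree]

/-- The monic polynomial vanishing at the Gauss points. -/
noncomputable def nod (r : ℕ) (G : ℕ → ℝ) : ℝ[X] := Lagrange.nodal (Finset.Icc 1 r) G

lemma gauss_strictMono {r : ℕ} {G : ℕ → ℝ} (hG : IsGaussPoints r G) {k l : ℕ}
    (hk : 1 ≤ k) (hkl : k < l) (hl : l ≤ r) : G k < G l := by
  induction l, hkl using Nat.le_induction with
  | base => exact hG.1 k hk (by omega)
  | succ n hn ih => exact (ih (by omega)).trans (hG.1 n (by omega) (by omega))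

lemma gauss_injOn {r : ℕ} {G : ℕ → ℝ} (hG : IsGaussPoints r G) :
    Set.InjOn G (Finset.Icc 1 r : Finset ℕ) := by
  intro k hk l hl h
  simp only [Finset.coe_Icc, Set.mem_Icc] at hk hl
  rcases lt_trichotomy k l with h1 | h1 | h1
  · exact absurd h (gauss_strictMono hG hk.1 h1 hl.2).ne
  · exact h1
  · exact absurd h (gauss_strictMono hG hl.1 h1 hk.2).ne'

lemma Leg_eq (r : ℕ) : Leg r = derivative^[r] ((X ^ 2 - 1 : ℝ[X]) ^ r) := rfl

lemma exists_Leg_eq_nod {r : ℕ} {G : ℕ → ℝ} (hG : IsGaussPoints r G) :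
    ∃ lc : ℝ, lc ≠ 0 ∧ Leg r = C lc * nod r G := by
  have hc := iterate_coeff_ne r r (by omega)
  rw [← Leg_eq, show 2 * r - r = r by omega] at hc
  have hcn : (nod r G).coeff r = 1 := by
    have := (Lagrange.nodal_monic (s := Finset.Icc 1 r) (v := G)).coeff_natDegree
    simpa [Lagrange.natDegree_nodal, nod] using this
  refine ⟨(Leg r).coeff r, hc, ?_⟩
  refine eq_of_degree_sub_lt_of_eval_index_eq (s := Finset.Icc 1 r) (v := G)
    (gauss_injOn hG) ?_ ?_
  · rw [degree_lt_iff_coeff_zero]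
    intro n hn
    simp only [Nat.card_Icc, add_tsub_cancel_right] at hn
    rcases eq_or_lt_of_le hn with rfl | hn
    · simp [hcn]
    · have h1 : (Leg r).coeff n = 0 := by
        refine coeff_eq_zero_of_natDegree_lt (lt_of_le_of_lt ?_ hn)
        rw [Leg_eq]
        refine (iterate_natDegree r r).trans (by omega)
      have h2 : (nod r G).coeff n = 0 := by
        refine coeff_eq_zero_of_natDegree_lt ?_
        simpa [nod, Lagrange.natDegree_nodal] using hn
      simp [h1, h2]
  · intro k hk
    have h1 := (hG.2 k (Finset.mem_Icc.mp hk).1 (Finset.mem_Icc.mp hk).2).2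
    rw [IsRoot.def] at h1
    rw [h1, eval_mul, nod, Lagrange.eval_nodal_at_node hk, mul_zero]

lemma integral_nod_mul {r : ℕ} {G : ℕ → ℝ} (hG : IsGaussPoints r G) (s : ℝ[X])
    (hs : s.degree < r) :
    ∫ x in (-1 : ℝ)..1, (nod r G * s).eval x = 0 := by
  obtain ⟨lc, h0, h⟩ := exists_Leg_eq_nod hG
  have h1 := integral_iterate_derivative_mul r r le_rfl s hs
  rw [← Leg_eq, h] at h1
  simp only [eval_mul, eval_C, mul_assoc, intervalIntegral.integral_const_mul] at h1
  simpa [h0] using h1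

/-- The Gauss weights. -/
noncomputable def wt (r : ℕ) (G : ℕ → ℝ) (k : ℕ) : ℝ :=
  ∫ x in (-1 : ℝ)..1, (Lagrange.basis (Finset.Icc 1 r) G k).eval x

/-- The Gauss quadrature rule on `[-1,1]`. -/
noncomputable def quad (r : ℕ) (G : ℕ → ℝ) (f : ℝ → ℝ) : ℝ :=
  ∑ k ∈ Finset.Icc 1 r, wt r G k * f (G k)

lemma quad_of_degree_lt {r : ℕ} {G : ℕ → ℝ} (hG : IsGaussPoints r G) (P : ℝ[X])
    (hP : P.degree < r) :
    quad r G (fun x => P.eval x) = ∫ x in (-1 : ℝ)..1, P.eval x := by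
  have h := Lagrange.eq_interpolate (s := Finset.Icc 1 r) (v := G) (f := P) (gauss_injOn hG)
    (by simpa using hP)
  rw [Lagrange.interpolate_apply] at h
  conv_rhs => rw [h]
  simp only [eval_finsetSum, eval_mul, eval_C]
  rw [intervalIntegral.integral_finsetSum]
  · simp only [intervalIntegral.integral_const_mul]
    exact Finset.sum_congr rfl fun k _ => mul_comm _ _
  · intro k _
    exact (poly_intervalIntegrable _ _ _).const_mul _

lemma quad_exact {r : ℕ} {G : ℕ → ℝ} (hG : IsGaussPoints r G) (P : ℝ[X])
    (hP : P.natDegree < 2 * r) :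
    quad r G (fun x => P.eval x) = ∫ x in (-1 : ℝ)..1, P.eval x := by
  have hm : (nod r G).Monic := Lagrange.nodal_monic
  have hnd : (nod r G).natDegree = r := by simp [nod, Lagrange.natDegree_nodal]
  have hdiv := modByMonic_add_div P (nod r G)
  have hmod : (P %ₘ nod r G).degree < r := by
    have := degree_modByMonic_lt P hm
    rwa [degree_eq_natDegree hm.ne_zero, hnd] at this
  have hq : (P /ₘ nod r G).degree < r := by
    refine lt_of_le_of_lt degree_le_natDegree ?_
    rw [natDegree_divByMonic P hm, hnd]
    exact_mod_cast (by omega : P.natDegree - r < r)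
  have h1 : ∫ x in (-1 : ℝ)..1, P.eval x = ∫ x in (-1 : ℝ)..1, (P %ₘ nod r G).eval x := by
    conv_lhs => rw [← hdiv]
    simp only [eval_add]
    rw [intervalIntegral.integral_add (poly_intervalIntegrable _ _ _)
      (poly_intervalIntegrable _ _ _), integral_nod_mul hG _ hq, add_zero]
  rw [h1, ← quad_of_degree_lt hG _ hmod]
  refine Finset.sum_congr rfl fun k hk => ?_
  have : P.eval (G k) = (P %ₘ nod r G).eval (G k) := by
    conv_lhs => rw [← hdiv]
    rw [eval_add, eval_mul, nod, Lagrange.eval_nodal_at_node hk, zero_mul, add_zero]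
  simp only [this]

lemma quad_le {r : ℕ} {G : ℕ → ℝ} (hr : 1 ≤ r) (hG : IsGaussPoints r G) (P : ℝ[X])
    (hP : P.natDegree ≤ 2 * r) (hc : 0 ≤ P.coeff (2 * r)) :
    quad r G (fun x => P.eval x) ≤ ∫ x in (-1 : ℝ)..1, P.eval x := by
  have hm : (nod r G ^ 2).Monic := (Lagrange.nodal_monic (s := Finset.Icc 1 r) (v := G)).pow 2
  have hnd : (nod r G ^ 2).natDegree = 2 * r := by
    rw [nod, (Lagrange.nodal_monic (s := Finset.Icc 1 r) (v := G)).natDegree_pow]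
    simp [Lagrange.natDegree_nodal]
  have hcn : (nod r G ^ 2).coeff (2 * r) = 1 := by
    have := hm.coeff_natDegree
    rwa [hnd] at this
  set c := P.coeff (2 * r)
  set Q := P - C c * nod r G ^ 2 with hQ
  have hQd : Q.natDegree < 2 * r := by
    by_cases hQ0 : Q = 0
    · rw [hQ0, natDegree_zero]; omega
    refine (natDegree_lt_iff_degree_lt hQ0).mpr ?_
    rw [degree_lt_iff_coeff_zero]
    intro n hn
    rcases eq_or_lt_of_le hn with rfl | hn
    · simp [hQ, hcn, c]
    · have h1 : P.coeff n = 0 := coeff_eq_zero_of_natDegree_lt (by omega)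
      have h2 : (nod r G ^ 2).coeff n = 0 := coeff_eq_zero_of_natDegree_lt (by omega)
      simp [hQ, h1, h2]
  have hPQ : P = Q + C c * nod r G ^ 2 := by rw [hQ]; ring
  have h1 : quad r G (fun x => P.eval x) = quad r G (fun x => Q.eval x) := by
    refine Finset.sum_congr rfl fun k hk => ?_
    have : P.eval (G k) = Q.eval (G k) := by
      conv_lhs => rw [hPQ]
      rw [eval_add, eval_mul, eval_pow, nod, Lagrange.eval_nodal_at_node hk]
      simp
    simp only [this]
  have h2 : ∫ x in (-1 : ℝ)..1, P.eval x =
      (∫ x in (-1 : ℝ)..1, Q.eval x) + ∫ x in (-1 : ℝ)..1, (C c * nod r G ^ 2).eval x := by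
    conv_lhs => rw [hPQ]
    simp only [eval_add]
    rw [intervalIntegral.integral_add (poly_intervalIntegrable _ _ _)
      (poly_intervalIntegrable _ _ _)]
  rw [h1, h2, quad_exact hG Q hQd]
  have : 0 ≤ ∫ x in (-1 : ℝ)..1, (C c * nod r G ^ 2).eval x := by
    refine intervalIntegral.integral_nonneg (by norm_num) fun x _ => ?_
    simp only [eval_mul, eval_C, eval_pow]
    positivity
  linarith

lemma wt_nonneg {r : ℕ} {G : ℕ → ℝ} (hG : IsGaussPoints r G) {k : ℕ}
    (hk : k ∈ Finset.Icc 1 r) : 0 ≤ wt r G k := by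
  set l := Lagrange.basis (Finset.Icc 1 r) G k
  have hl : l.natDegree = r - 1 := by
    rw [Lagrange.natDegree_basis (gauss_injOn hG) hk]; simp
  have hk' := Finset.mem_Icc.mp hk
  have h := quad_exact hG (l * l) (by
    refine lt_of_le_of_lt natDegree_mul_le ?_
    omega)
  have h2 : quad r G (fun x => (l * l).eval x) = wt r G k := by
    unfold quad
    rw [Finset.sum_eq_single k]
    · simp only [eval_mul]
      rw [Lagrange.eval_basis_self (gauss_injOn hG) hk]; simp
    · intro j hj hjk
      simp only [eval_mul]
      rw [Lagrange.eval_basis_of_ne (Ne.symm hjk) hj]; simp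
    · exact fun h => absurd hk h
  rw [← h2, h]
  refine intervalIntegral.integral_nonneg (by norm_num) fun x _ => ?_
  rw [eval_mul]
  exact mul_self_nonneg _

/-! ### The one-dimensional dual form -/

/-- The affine map of `[-1,1]` onto `[p,q]`. -/
noncomputable def aff (p q s : ℝ) : ℝ := (p + q) / 2 + (q - p) / 2 * s

/-- The points `p < g_1 < … < g_r < q` subdividing `[p,q]`. -/
noncomputable def gam (r : ℕ) (G : ℕ → ℝ) (p q : ℝ) (l : ℕ) : ℝ :=
  if l = 0 then p else if l = r + 1 then q else aff p q (G l)

/-- The partial Gauss sums `φ(p) + ∑_{k ≤ l} A_k φ'(g_k)`. -/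
noncomputable def jop (r : ℕ) (G : ℕ → ℝ) (p q : ℝ) (l : ℕ) (φ φ' : ℝ → ℝ) : ℝ :=
  φ p + ∑ k ∈ Finset.Icc 1 l, (q - p) / 2 * wt r G k * φ' (aff p q (G k))

/-- The integral of `ε` against the step function with values `jop l φ φ'`. -/
noncomputable def bform (r : ℕ) (G : ℕ → ℝ) (p q : ℝ) (φ φ' ε : ℝ → ℝ) : ℝ :=
  ∑ l ∈ Finset.range (r + 1), jop r G p q l φ φ' *
    ∫ x in (gam r G p q l)..(gam r G p q (l + 1)), ε x

lemma aff_ref (s : ℝ) : aff (-1) 1 s = s := by unfold aff; ring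

lemma aff_neg_one (p q : ℝ) : aff p q (-1) = p := by unfold aff; ring

lemma aff_one (p q : ℝ) : aff p q 1 = q := by unfold aff; ring

lemma aff_mem_Icc {p q s : ℝ} (h : p ≤ q) (hs : s ∈ Set.Icc (-1 : ℝ) 1) :
    aff p q s ∈ Set.Icc p q := by
  unfold aff
  obtain ⟨h1, h2⟩ := hs
  constructor <;> nlinarith

lemma aff_mem_Ioo {p q s : ℝ} (h : p < q) (hs : s ∈ Set.Ioo (-1 : ℝ) 1) :
    aff p q s ∈ Set.Ioo p q := by
  unfold aff
  obtain ⟨h1, h2⟩ := hs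
  constructor <;> nlinarith

lemma gam_zero (r : ℕ) (G : ℕ → ℝ) (p q : ℝ) : gam r G p q 0 = p := by simp [gam]

lemma gam_last (r : ℕ) (G : ℕ → ℝ) (p q : ℝ) : gam r G p q (r + 1) = q := by simp [gam]

lemma gam_mid (r : ℕ) (G : ℕ → ℝ) (p q : ℝ) {l : ℕ} (h1 : 1 ≤ l) (h2 : l ≤ r) :
    gam r G p q l = aff p q (G l) := by
  rw [gam, if_neg (by omega), if_neg (by omega)]

lemma gam_eq_aff (r : ℕ) (G : ℕ → ℝ) (p q : ℝ) (l : ℕ) :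
    gam r G p q l = aff p q (gam r G (-1) 1 l) := by
  unfold gam
  split_ifs
  · rw [aff_neg_one]
  · rw [aff_one]
  · rw [aff_ref]

section
variable {r : ℕ} {G : ℕ → ℝ}

lemma gam_mem (hG : IsGaussPoints r G) {p q : ℝ} (hpq : p < q) {l : ℕ}
    (hl : l ≤ r + 1) : gam r G p q l ∈ Set.Icc p q := by
  unfold gam
  split_ifs with h1 h2
  · exact ⟨le_rfl, hpq.le⟩
  · exact ⟨hpq.le, le_rfl⟩
  · exact aff_mem_Icc hpq.le (Set.Ioo_subset_Icc_self (hG.2 l (by omega) (by omega)).1)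

lemma gam_lt (hG : IsGaussPoints r G) {p q : ℝ} (hpq : p < q) {l : ℕ}
    (hl : l ≤ r) : gam r G p q l < gam r G p q (l + 1) := by
  rcases Nat.eq_zero_or_pos l with rfl | h0
  · rw [gam_zero]
    rcases Nat.eq_zero_or_pos r with rfl | hr
    · rw [gam_last]; exact hpq
    · rw [gam_mid r G p q le_rfl hr]
      exact (aff_mem_Ioo hpq (hG.2 1 le_rfl hr).1).1
  · rw [gam_mid r G p q h0 hl]
    rcases eq_or_lt_of_le hl with rfl | h1
    · rw [gam_last]
      exact (aff_mem_Ioo hpq (hG.2 l h0 le_rfl).1).2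
    · rw [gam_mid r G p q (by omega) h1]
      have := hG.1 l h0 h1
      unfold aff
      nlinarith

/-! ### Cauchy–Schwarz on intervals -/

lemma integral_mul_sq_le {a b : ℝ} (hab : a ≤ b) {f g : ℝ → ℝ} (hf : Continuous f)
    (hg : Continuous g) :
    (∫ x in a..b, f x * g x) ^ 2 ≤ (∫ x in a..b, f x ^ 2) * ∫ x in a..b, g x ^ 2 := by
  have key : ∀ t : ℝ, 0 ≤ (∫ x in a..b, g x ^ 2) * (t * t) + (2 * ∫ x in a..b, f x * g x) * t +
      ∫ x in a..b, f x ^ 2 := by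
    intro t
    have h0 : 0 ≤ ∫ x in a..b, (f x + t * g x) ^ 2 :=
      intervalIntegral.integral_nonneg hab fun x _ => sq_nonneg _
    have h1 : ∫ x in a..b, (f x + t * g x) ^ 2 =
        (∫ x in a..b, f x ^ 2) + ((2 * t) * ∫ x in a..b, f x * g x) +
          (t * t) * ∫ x in a..b, g x ^ 2 := by
      rw [← intervalIntegral.integral_const_mul, ← intervalIntegral.integral_const_mul,
        ← intervalIntegral.integral_add, ← intervalIntegral.integral_add]
      · refine intervalIntegral.integral_congr fun x _ => ?_
        ring
      all_goals exact Continuous.intervalIntegrable (by fun_prop) _ _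
    rw [h1] at h0
    linarith
  have := discrim_le_zero key
  unfold discrim at this
  nlinarith

lemma integral_sq_le {a b : ℝ} (hab : a ≤ b) {f : ℝ → ℝ} (hf : Continuous f) :
    (∫ x in a..b, f x) ^ 2 ≤ (b - a) * ∫ x in a..b, f x ^ 2 := by
  have := integral_mul_sq_le hab hf (continuous_const (y := (1 : ℝ)))
  simp only [mul_one, one_pow, intervalIntegral.integral_const, smul_eq_mul] at this
  linarith

lemma integral_mono_subinterval {a b p q : ℝ} (h1 : a ≤ p) (h2 : p ≤ q) (h3 : q ≤ b)
    {f : ℝ → ℝ} (hf : Continuous f) (h0 : ∀ x, 0 ≤ f x) :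
    ∫ x in p..q, f x ≤ ∫ x in a..b, f x :=
  intervalIntegral.integral_mono_interval h1 h2 h3
    (Filter.Eventually.of_forall h0) (hf.intervalIntegrable _ _)

/-! ### Stability of linear functionals on polynomials -/

lemma poly_eq_zero_of_integral_sq (P : ℝ[X]) (h : ∫ x in (-1 : ℝ)..1, P.eval x ^ 2 = 0) :
    P = 0 := by
  have hc : Continuous fun x => P.eval x ^ 2 := P.continuous.pow 2
  have h1 : ∀ x ∈ Set.Icc (-1 : ℝ) 1, P.eval x = 0 := by
    by_contra hne
    push Not at hne
    obtain ⟨x, hx, hxne⟩ := hne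
    have := intervalIntegral.integral_pos (by norm_num : (-1 : ℝ) < 1) hc.continuousOn
      (fun x _ => sq_nonneg _) ⟨x, hx, by positivity⟩
    linarith
  refine eq_zero_of_infinite_isRoot P ?_
  exact (Set.Icc_infinite (by norm_num : (-1 : ℝ) < 1)).mono h1

lemma functional_bound (Λ : ℝ[X] →ₗ[ℝ] ℝ) (r : ℕ) :
    ∃ K : ℝ, 0 ≤ K ∧ ∀ P : ℝ[X], P.natDegree ≤ r →
      (Λ P) ^ 2 ≤ K * ∫ x in (-1 : ℝ)..1, P.eval x ^ 2 := by
  let V := degreeLT ℝ (r + 1)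
  let B : V →ₗ[ℝ] Module.Dual ℝ V := LinearMap.mk₂ ℝ
    (fun P Q : V => ∫ x in (-1 : ℝ)..1, (P : ℝ[X]).eval x * (Q : ℝ[X]).eval x)
    (fun P Q R => by
      rw [← intervalIntegral.integral_add]
      · simp [add_mul]
      all_goals exact Continuous.intervalIntegrable (by fun_prop) _ _)
    (fun c P Q => by simp [mul_assoc])
    (fun P Q R => by
      rw [← intervalIntegral.integral_add]
      · simp [mul_add]
      all_goals exact Continuous.intervalIntegrable (by fun_prop) _ _)
    (fun c P Q => by simp [mul_left_comm])
  have hB : ∀ P Q : V, B P Q = ∫ x in (-1 : ℝ)..1, (P : ℝ[X]).eval x * (Q : ℝ[X]).eval x :=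
    fun _ _ => rfl
  have : FiniteDimensional ℝ V := (degreeLTEquiv ℝ (r + 1)).symm.finiteDimensional
  have hinj : Function.Injective B := by
    rw [← LinearMap.ker_eq_bot, LinearMap.ker_eq_bot']
    intro P hP
    have h := hB P P
    rw [hP, LinearMap.zero_apply] at h
    apply Subtype.ext
    refine poly_eq_zero_of_integral_sq _ ?_
    simp only [sq]
    exact h.symm
  have hsurj : Function.Surjective B :=
    (LinearMap.injective_iff_surjective_of_finrank_eq_finrank
      (Subspace.dual_finrank_eq (K := ℝ) (V := V)).symm).mp hinj
  obtain ⟨Q, hQ⟩ := hsurj (Λ.comp V.subtype)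
  refine ⟨∫ x in (-1 : ℝ)..1, (Q : ℝ[X]).eval x ^ 2,
    intervalIntegral.integral_nonneg (by norm_num) fun x _ => sq_nonneg _, fun P hP => ?_⟩
  have hPV : P ∈ V := by
    rw [mem_degreeLT]
    refine lt_of_le_of_lt degree_le_natDegree ?_
    exact_mod_cast Nat.lt_succ_of_le hP
  have h1 : Λ P = ∫ x in (-1 : ℝ)..1, (Q : ℝ[X]).eval x * P.eval x := by
    have := congrArg (fun F => F ⟨P, hPV⟩) hQ
    simp only [hB] at this
    exact this.symm
  rw [h1]
  exact integral_mul_sq_le (by norm_num) (Polynomial.continuous _) (Polynomial.continuous _)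

lemma jop_ref_bound (r : ℕ) (G : ℕ → ℝ) :
    ∃ K : ℝ, 1 ≤ K ∧ ∀ l ≤ r, ∀ P : ℝ[X], P.natDegree ≤ r →
      (jop r G (-1) 1 l (fun x => P.eval x) (fun x => (derivative P).eval x)) ^ 2 ≤
        K * ∫ x in (-1 : ℝ)..1, P.eval x ^ 2 := by
  let Λ : ℕ → ℝ[X] →ₗ[ℝ] ℝ := fun l =>
    { toFun := fun P => jop r G (-1) 1 l (fun x => P.eval x) (fun x => (derivative P).eval x)
      map_add' := fun P Q => by
        simp only [jop, eval_add, derivative_add, mul_add, Finset.sum_add_distrib]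
        ring
      map_smul' := fun c P => by
        simp only [jop, eval_smul, derivative_smul, smul_eq_mul, RingHom.id_apply, mul_add,
          Finset.mul_sum]
        congr 1
        refine Finset.sum_congr rfl fun k _ => ?_
        ring }
  choose K hK0 hK using fun l => functional_bound (Λ l) r
  refine ⟨1 + ∑ l ∈ Finset.range (r + 1), K l, ?_, fun l hl P hP => ?_⟩
  · have := Finset.sum_nonneg fun l (_ : l ∈ Finset.range (r + 1)) => hK0 l
    linarith
  · refine (hK l P hP).trans ?_
    have h1 : K l ≤ ∑ l ∈ Finset.range (r + 1), K l :=
      Finset.single_le_sum (fun l _ => hK0 l) (Finset.mem_range.mpr (by omega))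
    have h2 : 0 ≤ ∫ x in (-1 : ℝ)..1, P.eval x ^ 2 :=
      intervalIntegral.integral_nonneg (by norm_num) fun x _ => sq_nonneg _
    exact mul_le_mul_of_nonneg_right (by linarith) h2

/-! ### Coercivity -/

lemma quad_ref_eq (f : ℝ → ℝ) :
    ∑ k ∈ Finset.Icc 1 r, (1 - (-1 : ℝ)) / 2 * wt r G k * f (aff (-1) 1 (G k)) = quad r G f := by
  unfold quad
  refine Finset.sum_congr rfl fun k _ => ?_
  rw [aff_ref]; ring

lemma jop_ref_last (hG : IsGaussPoints r G) (hr : 1 ≤ r) (P : ℝ[X]) (hP : P.natDegree ≤ r) :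
    jop r G (-1) 1 r (fun x => P.eval x) (fun x => (derivative P).eval x) = P.eval 1 := by
  have h := quad_exact hG (derivative P)
    (lt_of_le_of_lt (natDegree_derivative_le P) (by omega))
  rw [integral_derivative_eval] at h
  rw [jop, quad_ref_eq (fun x => (derivative P).eval x), h]
  ring

lemma jop_succ (p q : ℝ) (l : ℕ) (φ φ' : ℝ → ℝ) :
    jop r G p q (l + 1) φ φ' = jop r G p q l φ φ' +
      (q - p) / 2 * wt r G (l + 1) * φ' (aff p q (G (l + 1))) := by
  unfold jop
  rw [Finset.sum_Icc_succ_top (by omega)]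
  ring

lemma jop_zero (p q : ℝ) (φ φ' : ℝ → ℝ) : jop r G p q 0 φ φ' = φ p := by
  simp [jop]

/-- Summation by parts. -/
lemma abel_sum (r : ℕ) (a b : ℕ → ℝ) :
    ∑ l ∈ Finset.range (r + 1), a l * (b (l + 1) - b l) =
      a r * b (r + 1) - a 0 * b 0 - ∑ l ∈ Finset.Icc 1 r, (a l - a (l - 1)) * b l := by
  induction r with
  | zero => simp; ring
  | succ r ih =>
    rw [Finset.sum_range_succ, ih, Finset.sum_Icc_succ_top (by omega)]
    simp only [Nat.add_sub_cancel]
    ring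

lemma bform_ref_self (hG : IsGaussPoints r G) (hr : 1 ≤ r) (P : ℝ[X]) (hP : P.natDegree ≤ r) :
    ∫ x in (-1 : ℝ)..1, P.eval x ^ 2 ≤
      bform r G (-1) 1 (fun x => P.eval x) (fun x => (derivative P).eval x)
        (fun x => P.eval x) := by
  obtain ⟨Q, hQ, hQd⟩ := exists_antiderivative P r hP
  have hinteg : ∀ a b : ℝ, ∫ x in a..b, P.eval x = Q.eval b - Q.eval a := by
    intro a b
    rw [← hQ]; exact integral_derivative_eval Q a b
  have hprod : (∫ x in (-1 : ℝ)..1, P.eval x ^ 2) +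
      ∫ x in (-1 : ℝ)..1, (derivative P * Q).eval x =
      P.eval 1 * Q.eval 1 - P.eval (-1) * Q.eval (-1) := by
    have h := integral_derivative_eval (P * Q) (-1) 1
    rw [derivative_mul, hQ] at h
    simp only [eval_add] at h
    rw [intervalIntegral.integral_add (poly_intervalIntegrable _ _ _)
      (poly_intervalIntegrable _ _ _)] at h
    simp only [eval_mul] at h ⊢
    simp only [sq]
    linarith
  have hq : quad r G (fun x => (derivative P * Q).eval x) ≤
      ∫ x in (-1 : ℝ)..1, (derivative P * Q).eval x := by
    have hd1 : (derivative P).natDegree ≤ r - 1 :=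
      (natDegree_derivative_le P).trans (by omega)
    refine quad_le hr hG _ (natDegree_mul_le.trans (by omega)) ?_
    have : (derivative P * Q).coeff (2 * r) = (derivative P).coeff (r - 1) * Q.coeff (r + 1) := by
      have := coeff_mul_add_eq_of_natDegree_le hd1 hQd
      rwa [show r - 1 + (r + 1) = 2 * r by omega] at this
    have h2 : P.coeff r = Q.coeff (r + 1) * (r + 1) := by
      rw [← hQ, coeff_derivative]
    rw [this, coeff_derivative, Nat.sub_add_cancel hr, h2]
    have h3 : 0 ≤ ((r - 1 : ℕ) : ℝ) := Nat.cast_nonneg _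
    have h4 : 0 ≤ ((r : ℕ) : ℝ) := Nat.cast_nonneg _
    have : Q.coeff (r + 1) * (r + 1) * (((r - 1 : ℕ) : ℝ) + 1) * Q.coeff (r + 1) =
      Q.coeff (r + 1) ^ 2 * ((r + 1) * (((r - 1 : ℕ) : ℝ) + 1)) := by ring
    rw [this]
    positivity
  unfold bform
  simp only [hinteg]
  rw [abel_sum r _ (fun l => Q.eval (gam r G (-1) 1 l)), jop_ref_last hG hr P hP, jop_zero,
    gam_zero, gam_last]
  have hs : ∑ l ∈ Finset.Icc 1 r,
      (jop r G (-1) 1 l (fun x => P.eval x) (fun x => (derivative P).eval x) -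
        jop r G (-1) 1 (l - 1) (fun x => P.eval x) (fun x => (derivative P).eval x)) *
        Q.eval (gam r G (-1) 1 l) = quad r G (fun x => (derivative P * Q).eval x) := by
    refine Finset.sum_congr rfl fun l hl => ?_
    obtain ⟨h1, h2⟩ := Finset.mem_Icc.mp hl
    obtain ⟨l, rfl⟩ : ∃ l', l = l' + 1 := ⟨l - 1, by omega⟩
    rw [Nat.add_sub_cancel, jop_succ, gam_mid r G _ _ h1 h2, aff_ref]
    simp only [eval_mul]
    ring
  rw [hs]
  linarith

lemma bform_ref_le (hG : IsGaussPoints r G) (hr : 1 ≤ r) :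
    ∃ K : ℝ, 0 ≤ K ∧ ∀ P : ℝ[X], P.natDegree ≤ r → ∀ ε : ℝ → ℝ, Continuous ε →
      bform r G (-1) 1 (fun x => P.eval x) (fun x => (derivative P).eval x)
        (fun x => ε x - P.eval x) ≤
      -(1 / 2) * (∫ x in (-1 : ℝ)..1, P.eval x ^ 2) + K * ∫ x in (-1 : ℝ)..1, ε x ^ 2 := by
  obtain ⟨K, hK1, hK⟩ := jop_ref_bound r G
  refine ⟨(r + 1) ^ 2 * K, by positivity, fun P hP ε hε => ?_⟩
  have hself := bform_ref_self hG hr P hP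
  set N := ∫ x in (-1 : ℝ)..1, P.eval x ^ 2 with hN
  set E := ∫ x in (-1 : ℝ)..1, ε x ^ 2 with hE
  have hsplit : bform r G (-1) 1 (fun x => P.eval x) (fun x => (derivative P).eval x)
        (fun x => ε x - P.eval x) =
      bform r G (-1) 1 (fun x => P.eval x) (fun x => (derivative P).eval x) ε -
      bform r G (-1) 1 (fun x => P.eval x) (fun x => (derivative P).eval x)
        (fun x => P.eval x) := by
    unfold bform
    rw [← Finset.sum_sub_distrib]
    refine Finset.sum_congr rfl fun l _ => ?_
    rw [intervalIntegral.integral_sub (hε.intervalIntegrable _ _)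
      (poly_intervalIntegrable _ _ _)]
    ring
  have hbd : bform r G (-1) 1 (fun x => P.eval x) (fun x => (derivative P).eval x) ε ≤
      1 / 2 * N + (r + 1) ^ 2 * K * E := by
    have hterm : ∀ l ∈ Finset.range (r + 1),
        jop r G (-1) 1 l (fun x => P.eval x) (fun x => (derivative P).eval x) *
          (∫ x in (gam r G (-1) 1 l)..(gam r G (-1) 1 (l + 1)), ε x) ≤
        1 / (2 * (r + 1)) * N + (r + 1) * K * E := by
      intro l hl
      have hl' : l ≤ r := Nat.lt_succ_iff.mp (Finset.mem_range.mp hl)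
      have hJ := hK l hl' P hP
      set J := jop r G (-1) 1 l (fun x => P.eval x) (fun x => (derivative P).eval x)
      set I := ∫ x in (gam r G (-1) 1 l)..(gam r G (-1) 1 (l + 1)), ε x
      have hlt := gam_lt hG (by norm_num : (-1 : ℝ) < 1) hl'
      have hm1 := gam_mem hG (by norm_num : (-1 : ℝ) < 1) (show l ≤ r + 1 by omega)
      have hm2 := gam_mem hG (by norm_num : (-1 : ℝ) < 1) (show l + 1 ≤ r + 1 by omega)
      have hI : I ^ 2 ≤ 2 * E := by
        refine (integral_sq_le hlt.le hε).trans ?_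
        have h1 := integral_mono_subinterval hm1.1 hlt.le hm2.2 (hε.pow 2)
          (fun x => sq_nonneg (ε x))
        have h2 : 0 ≤ ∫ x in (gam r G (-1) 1 l)..(gam r G (-1) 1 (l + 1)), ε x ^ 2 :=
          intervalIntegral.integral_nonneg hlt.le fun x _ => sq_nonneg _
        have h3 : gam r G (-1) 1 (l + 1) - gam r G (-1) 1 l ≤ 2 := by linarith [hm1.1, hm2.2]
        exact mul_le_mul h3 h1 h2 (by norm_num)
      have hK0 : (0 : ℝ) < K * (r + 1) := by positivity
      set δ : ℝ := 1 / (K * (r + 1)) with hδ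
      have hδ0 : 0 < δ := by positivity
      have hy : J * I ≤ δ / 2 * J ^ 2 + 1 / (2 * δ) * I ^ 2 := by
        have h := sq_nonneg (δ * J - I)
        have h2 : δ / 2 * J ^ 2 + 1 / (2 * δ) * I ^ 2 - J * I = (δ * J - I) ^ 2 / (2 * δ) := by
          field_simp; ring
        have h3 : 0 ≤ (δ * J - I) ^ 2 / (2 * δ) := by positivity
        linarith
      have e1 : δ / 2 * (K * N) = 1 / (2 * (r + 1)) * N := by rw [hδ]; field_simp
      have e2 : 1 / (2 * δ) * (2 * E) = (r + 1) * K * E := by rw [hδ]; field_simp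
      have h4 : δ / 2 * J ^ 2 ≤ δ / 2 * (K * N) := mul_le_mul_of_nonneg_left hJ (by positivity)
      have h5 : 1 / (2 * δ) * I ^ 2 ≤ 1 / (2 * δ) * (2 * E) :=
        mul_le_mul_of_nonneg_left hI (by positivity)
      linarith
    refine (Finset.sum_le_sum hterm).trans (le_of_eq ?_)
    rw [Finset.sum_const, Finset.card_range, nsmul_eq_mul]
    push_cast
    field_simp
  rw [hsplit]
  linarith

/-! ### Transfer to a general interval -/

/-- The polynomial `P ∘ aff p q`. -/
noncomputable def pull (p q : ℝ) (P : ℝ[X]) : ℝ[X] :=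
  P.comp (C ((p + q) / 2) + C ((q - p) / 2) * X)

lemma eval_pull (p q : ℝ) (P : ℝ[X]) (s : ℝ) : (pull p q P).eval s = P.eval (aff p q s) := by
  simp [pull, aff]

lemma eval_derivative_pull (p q : ℝ) (P : ℝ[X]) (s : ℝ) :
    (derivative (pull p q P)).eval s = (q - p) / 2 * (derivative P).eval (aff p q s) := by
  simp [pull, aff, derivative_comp]

lemma natDegree_pull_le (p q : ℝ) (P : ℝ[X]) : (pull p q P).natDegree ≤ P.natDegree := by
  refine natDegree_comp_le.trans ?_
  have : (C ((p + q) / 2) + C ((q - p) / 2) * X : ℝ[X]).natDegree ≤ 1 := by compute_degree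
  nlinarith

lemma integral_aff (p q : ℝ) (f : ℝ → ℝ) (s t : ℝ) :
    ∫ x in (aff p q s)..(aff p q t), f x = (q - p) / 2 * ∫ x in s..t, f (aff p q x) := by
  unfold aff
  rw [intervalIntegral.mul_integral_comp_add_mul]

lemma integral_eq_aff (p q : ℝ) (f : ℝ → ℝ) :
    ∫ x in p..q, f x = (q - p) / 2 * ∫ x in (-1 : ℝ)..1, f (aff p q x) := by
  rw [← integral_aff, aff_neg_one, aff_one]

lemma continuous_aff (p q : ℝ) : Continuous (aff p q) := by unfold aff; fun_prop

lemma gauss_exact (hG : IsGaussPoints r G) (p q : ℝ) (P : ℝ[X]) (hP : P.natDegree < 2 * r) :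
    ∑ k ∈ Finset.Icc 1 r, (q - p) / 2 * wt r G k * P.eval (aff p q (G k)) =
      ∫ x in p..q, P.eval x := by
  have h := quad_exact hG (pull p q P) (lt_of_le_of_lt (natDegree_pull_le p q P) hP)
  rw [integral_eq_aff p q (fun x => P.eval x)]
  simp only [eval_pull] at h
  rw [← h, quad, Finset.mul_sum]
  exact Finset.sum_congr rfl fun k _ => by ring

lemma jop_last (hG : IsGaussPoints r G) (hr : 1 ≤ r) (p q : ℝ) (P : ℝ[X])
    (hP : P.natDegree ≤ r) :
    jop r G p q r (fun x => P.eval x) (fun x => (derivative P).eval x) = P.eval q := by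
  have h := gauss_exact hG p q (derivative P)
    (lt_of_le_of_lt (natDegree_derivative_le P) (by omega))
  rw [integral_derivative_eval] at h
  rw [jop, h]
  ring

lemma bform_eq_ref (p q : ℝ) (P : ℝ[X]) (ε : ℝ → ℝ) :
    bform r G p q (fun x => P.eval x) (fun x => (derivative P).eval x) ε =
      (q - p) / 2 * bform r G (-1) 1 (fun x => (pull p q P).eval x)
        (fun x => (derivative (pull p q P)).eval x) (fun x => ε (aff p q x)) := by
  unfold bform
  rw [Finset.mul_sum]
  refine Finset.sum_congr rfl fun l _ => ?_
  have h1 : jop r G p q l (fun x => P.eval x) (fun x => (derivative P).eval x) =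
      jop r G (-1) 1 l (fun x => (pull p q P).eval x)
        (fun x => (derivative (pull p q P)).eval x) := by
    unfold jop
    simp only [eval_pull, eval_derivative_pull, aff_neg_one, aff_ref]
    congr 1
    refine Finset.sum_congr rfl fun k _ => ?_
    ring
  rw [h1, gam_eq_aff r G p q l, gam_eq_aff r G p q (l + 1), integral_aff]
  ring

/-- Coercivity and boundedness of the one-dimensional dual form. -/
lemma bform_le (hG : IsGaussPoints r G) (hr : 1 ≤ r) :
    ∃ K : ℝ, 0 ≤ K ∧ ∀ p q : ℝ, p < q → ∀ P : ℝ[X], P.natDegree ≤ r →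
      ∀ ε : ℝ → ℝ, Continuous ε →
      bform r G p q (fun x => P.eval x) (fun x => (derivative P).eval x)
        (fun x => ε x - P.eval x) ≤
      -(1 / 2) * (∫ x in p..q, P.eval x ^ 2) + K * ∫ x in p..q, ε x ^ 2 := by
  obtain ⟨K, hK0, hK⟩ := bform_ref_le hG hr
  refine ⟨K, hK0, fun p q hpq P hP ε hε => ?_⟩
  have h := hK (pull p q P) ((natDegree_pull_le p q P).trans hP) (fun x => ε (aff p q x))
    (hε.comp (continuous_aff p q))
  simp only [eval_pull] at h
  rw [bform_eq_ref, integral_eq_aff p q (fun x => P.eval x ^ 2),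
    integral_eq_aff p q (fun x => ε x ^ 2)]
  simp only [eval_pull]
  have hη : 0 ≤ (q - p) / 2 := by linarith
  have := mul_le_mul_of_nonneg_left h hη
  refine this.trans (le_of_eq ?_)
  ring

end

/-! ### One-dimensional interpolation -/

/-- Equidistant nodes in `[-1,1]`. -/
noncomputable def node (r a : ℕ) : ℝ := -1 + 2 * a / (r + 1)

/-- The antiderivative of `Leg r` that vanishes at `±1`. -/
noncomputable def bub (r : ℕ) : ℝ[X] := derivative^[r - 1] ((X ^ 2 - 1 : ℝ[X]) ^ r)

/-- Degree `r` basis polynomials: interpolation of degree `r + 1` at the nodes followed by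
removal of the leading term with a multiple of `bub r`. -/
noncomputable def bas (r a : ℕ) : ℝ[X] :=
  Lagrange.basis (Finset.range (r + 2)) (node r) a -
    C ((Lagrange.basis (Finset.range (r + 2)) (node r) a).coeff (r + 1) / (bub r).coeff (r + 1)) *
      bub r

lemma node_injective (r : ℕ) : Function.Injective (node r) := by
  intro a b h
  unfold node at h
  have : (r : ℝ) + 1 ≠ 0 := by positivity
  field_simp at h
  exact_mod_cast (by linarith : (a : ℝ) = b)

lemma node_zero (r : ℕ) : node r 0 = -1 := by simp [node]

lemma node_last (r : ℕ) : node r (r + 1) = 1 := by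
  have : (r : ℝ) + 1 ≠ 0 := by positivity
  unfold node
  push_cast
  field_simp
  ring

lemma node_mem (r a : ℕ) (ha : a ∈ Finset.range (r + 2)) : node r a ∈ Set.Icc (-1 : ℝ) 1 := by
  have h0 : (0 : ℝ) < r + 1 := by positivity
  have h1 : (a : ℝ) ≤ r + 1 := by
    exact_mod_cast Nat.lt_succ_iff.mp (Finset.mem_range.mp ha)
  have h2 : 2 * (a : ℝ) / (r + 1) ≤ 2 := by rw [div_le_iff₀ h0]; linarith
  have h3 : 0 ≤ 2 * (a : ℝ) / (r + 1) := by positivity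
  unfold node
  constructor <;> linarith

section
variable {r : ℕ}

lemma derivative_bub (hr : 1 ≤ r) : derivative (bub r) = Leg r := by
  obtain ⟨s, rfl⟩ : ∃ s, r = s + 1 := ⟨r - 1, by omega⟩
  rw [bub, Leg_eq, Function.iterate_succ_apply']
  rfl

lemma bub_eval_one (hr : 1 ≤ r) : (bub r).eval 1 = 0 :=
  iterate_derivative_eval_endpoint r _ (by omega) 1 (by norm_num)

lemma bub_eval_neg_one (hr : 1 ≤ r) : (bub r).eval (-1) = 0 :=
  iterate_derivative_eval_endpoint r _ (by omega) (-1) (by norm_num)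

lemma bub_natDegree (hr : 1 ≤ r) : (bub r).natDegree ≤ r + 1 :=
  (iterate_natDegree r (r - 1)).trans (by omega)

lemma bub_coeff (hr : 1 ≤ r) : (bub r).coeff (r + 1) ≠ 0 := by
  have := iterate_coeff_ne r (r - 1) (by omega)
  rwa [show 2 * r - (r - 1) = r + 1 by omega] at this

lemma bas_natDegree (hr : 1 ≤ r) {a : ℕ} (ha : a ∈ Finset.range (r + 2)) :
    (bas r a).natDegree ≤ r := by
  have h1 : (Lagrange.basis (Finset.range (r + 2)) (node r) a).natDegree = r + 1 := by
    rw [Lagrange.natDegree_basis ((node_injective r).injOn) ha]; simp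
  rw [natDegree_le_iff_coeff_eq_zero]
  intro n hn
  rcases eq_or_lt_of_le (Nat.succ_le_of_lt hn) with rfl | hn
  · simp [bas, bub_coeff hr]
  · have h2 : (Lagrange.basis (Finset.range (r + 2)) (node r) a).coeff n = 0 :=
      coeff_eq_zero_of_natDegree_lt (by omega)
    have h3 : (bub r).coeff n = 0 :=
      coeff_eq_zero_of_natDegree_lt (lt_of_le_of_lt (bub_natDegree hr) hn)
    simp [bas, h2, h3]

lemma sum_bas (P : ℝ[X]) (hP : P.natDegree ≤ r + 1) :
    ∑ a ∈ Finset.range (r + 2), C (P.eval (node r a)) * bas r a =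
      P - C (P.coeff (r + 1) / (bub r).coeff (r + 1)) * bub r := by
  have h := Lagrange.eq_interpolate (s := Finset.range (r + 2)) (v := node r) (f := P)
    (node_injective r).injOn (by
      refine lt_of_le_of_lt degree_le_natDegree ?_
      rw [Finset.card_range]
      exact_mod_cast Nat.lt_succ_of_le hP)
  rw [Lagrange.interpolate_apply] at h
  have hc : P.coeff (r + 1) = ∑ a ∈ Finset.range (r + 2), P.eval (node r a) *
      (Lagrange.basis (Finset.range (r + 2)) (node r) a).coeff (r + 1) := by
    conv_lhs => rw [h]
    simp [finsetSum_coeff]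
  rw [hc, Finset.sum_div, map_sum, Finset.sum_mul]
  conv_rhs => enter [1]; rw [h]
  rw [← Finset.sum_sub_distrib]
  refine Finset.sum_congr rfl fun a _ => ?_
  rw [bas, mul_div_assoc, C_mul]
  ring

lemma bas_eval_endpoint (e : ℝ) (he : (bub r).eval e = 0) (b : ℕ)
    (hb : b ∈ Finset.range (r + 2)) (hbe : node r b = e) (a : ℕ) :
    (bas r a).eval e = if a = b then 1 else 0 := by
  rw [bas, eval_sub, eval_mul, he, mul_zero, sub_zero, ← hbe]
  split_ifs with h
  · rw [h, Lagrange.eval_basis_self (node_injective r).injOn hb]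
  · rw [Lagrange.eval_basis_of_ne h hb]

/-- The basis polynomials transported to `[p,q]`. -/
noncomputable def bp (r : ℕ) (p q : ℝ) (a : ℕ) : ℝ[X] :=
  (bas r a).comp (C (-(p + q) / (q - p)) + C (2 / (q - p)) * X)

/-- The interpolation nodes in `[p,q]`. -/
noncomputable def nd (r : ℕ) (p q : ℝ) (a : ℕ) : ℝ := aff p q (node r a)

/-- The inverse of `aff p q`. -/
noncomputable def inv (p q x : ℝ) : ℝ := -(p + q) / (q - p) + 2 / (q - p) * x

lemma bp_natDegree (hr : 1 ≤ r) (p q : ℝ) {a : ℕ} (ha : a ∈ Finset.range (r + 2)) :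
    (bp r p q a).natDegree ≤ r := by
  refine natDegree_comp_le.trans ?_
  have h1 : (C (-(p + q) / (q - p)) + C (2 / (q - p)) * X : ℝ[X]).natDegree ≤ 1 := by
    compute_degree
  have := bas_natDegree hr ha
  nlinarith

lemma bp_eval (p q : ℝ) (a : ℕ) (x : ℝ) : (bp r p q a).eval x = (bas r a).eval (inv p q x) := by
  simp [bp, inv]

lemma bp_derivative_eval (p q : ℝ) (a : ℕ) (x : ℝ) :
    (derivative (bp r p q a)).eval x =
      2 / (q - p) * (derivative (bas r a)).eval (inv p q x) := by
  simp [bp, inv, derivative_comp]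

lemma aff_inv {p q : ℝ} (h : p < q) (x : ℝ) : aff p q (inv p q x) = x := by
  have : q - p ≠ 0 := by linarith
  unfold aff inv
  field_simp
  ring

lemma inv_aff {p q : ℝ} (h : p < q) (s : ℝ) : inv p q (aff p q s) = s := by
  have : q - p ≠ 0 := by linarith
  unfold aff inv
  field_simp
  ring

lemma inv_mem {p q : ℝ} (h : p < q) {x : ℝ} (hx : x ∈ Set.Icc p q) :
    inv p q x ∈ Set.Icc (-1 : ℝ) 1 := by
  have h0 : 0 < q - p := by linarith
  have e : inv p q x = (2 * x - (p + q)) / (q - p) := by unfold inv; ring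
  obtain ⟨h1, h2⟩ := hx
  rw [e]
  constructor
  · rw [le_div_iff₀ h0]; linarith
  · rw [div_le_iff₀ h0]; linarith

lemma nd_mem {p q : ℝ} (h : p ≤ q) {a : ℕ} (ha : a ∈ Finset.range (r + 2)) :
    nd r p q a ∈ Set.Icc p q := aff_mem_Icc h (node_mem r a ha)

lemma sum_bp {p q : ℝ} (h : p < q) (P : ℝ[X]) (hP : P.natDegree ≤ r) (x : ℝ) :
    ∑ a ∈ Finset.range (r + 2), P.eval (nd r p q a) * (bp r p q a).eval x = P.eval x := by
  have hd : (pull p q P).natDegree ≤ r := (natDegree_pull_le p q P).trans hP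
  have h1 := sum_bas (pull p q P) (hd.trans (Nat.le_succ r))
  rw [coeff_eq_zero_of_natDegree_lt (Nat.lt_succ_of_le hd)] at h1
  have h2 := congrArg (fun Q => Q.eval (inv p q x)) h1
  simp only [eval_finsetSum, eval_mul, eval_C, eval_pull, zero_div, C_0, zero_mul, sub_zero,
    aff_inv h] at h2
  simp only [bp_eval]
  exact h2

lemma sum_bp_derivative {G : ℕ → ℝ} (hG : IsGaussPoints r G) (hr : 1 ≤ r) {p q : ℝ} (h : p < q)
    (P : ℝ[X]) (hP : P.natDegree ≤ r + 1) {k : ℕ} (hk : k ∈ Finset.Icc 1 r) :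
    ∑ a ∈ Finset.range (r + 2), P.eval (nd r p q a) *
      (derivative (bp r p q a)).eval (aff p q (G k)) =
      (derivative P).eval (aff p q (G k)) := by
  have h1 := sum_bas (pull p q P) ((natDegree_pull_le p q P).trans hP)
  have h2 := congrArg (fun Q => (derivative Q).eval (G k)) h1
  have hL : (Leg r).eval (G k) = 0 :=
    (hG.2 k (Finset.mem_Icc.mp hk).1 (Finset.mem_Icc.mp hk).2).2
  simp only [derivative_sum, derivative_sub, derivative_C_mul, derivative_bub hr,
    eval_finsetSum, eval_sub, eval_mul, eval_C, eval_pull, eval_derivative_pull, hL, mul_zero,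
    sub_zero] at h2
  simp only [bp_derivative_eval, inv_aff h]
  have h0 : q - p ≠ 0 := by linarith
  have e : ∀ a, P.eval (nd r p q a) * (2 / (q - p) * (derivative (bas r a)).eval (G k)) =
      2 / (q - p) * (P.eval (aff p q (node r a)) * (derivative (bas r a)).eval (G k)) := by
    intro a; unfold nd; ring
  rw [Finset.sum_congr rfl fun a _ => e a, ← Finset.mul_sum, h2]
  field_simp

lemma bp_eval_left (hr : 1 ≤ r) {p q : ℝ} (h : p < q) (a : ℕ) :
    (bp r p q a).eval p = if a = 0 then 1 else 0 := by
  have : inv p q p = -1 := by rw [← inv_aff h (-1), aff_neg_one]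
  rw [bp_eval, this]
  exact bas_eval_endpoint _ (bub_eval_neg_one hr) 0 (by simp) (node_zero r) a

lemma bp_eval_right (hr : 1 ≤ r) {p q : ℝ} (h : p < q) (a : ℕ) :
    (bp r p q a).eval q = if a = r + 1 then 1 else 0 := by
  have : inv p q q = 1 := by rw [← inv_aff h 1, aff_one]
  rw [bp_eval, this]
  exact bas_eval_endpoint _ (bub_eval_one hr) (r + 1) (by simp) (node_last r) a

lemma sum_bp_left (hr : 1 ≤ r) {p q : ℝ} (h : p < q) (f : ℝ → ℝ) :
    ∑ a ∈ Finset.range (r + 2), f (nd r p q a) * (bp r p q a).eval p = f p := by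
  rw [Finset.sum_eq_single 0]
  · rw [bp_eval_left hr h, nd, node_zero, aff_neg_one]; simp
  · intro a _ h0
    rw [bp_eval_left hr h, if_neg h0, mul_zero]
  · simp

lemma sum_bp_right (hr : 1 ≤ r) {p q : ℝ} (h : p < q) (f : ℝ → ℝ) :
    ∑ a ∈ Finset.range (r + 2), f (nd r p q a) * (bp r p q a).eval q = f q := by
  rw [Finset.sum_eq_single (r + 1)]
  · rw [bp_eval_right hr h, nd, node_last, aff_one]; simp
  · intro a _ h0
    rw [bp_eval_right hr h, if_neg h0, mul_zero]
  · simp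

lemma exists_bas_bound (r : ℕ) : ∃ K : ℝ, 0 ≤ K ∧ ∀ a ∈ Finset.range (r + 2),
    ∀ s ∈ Set.Icc (-1 : ℝ) 1, |(bas r a).eval s| ≤ K ∧ |(derivative (bas r a)).eval s| ≤ K := by
  have h : ∀ P : ℝ[X], ∃ K : ℝ, 0 ≤ K ∧ ∀ s ∈ Set.Icc (-1 : ℝ) 1, |P.eval s| ≤ K := by
    intro P
    obtain ⟨K, hK⟩ := isCompact_Icc.exists_bound_of_continuousOn
      (P.continuous.continuousOn (s := Set.Icc (-1 : ℝ) 1))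
    exact ⟨K, (norm_nonneg _).trans (hK 0 (by norm_num)), hK⟩
  choose K hK0 hK using h
  refine ⟨∑ a ∈ Finset.range (r + 2), (K (bas r a) + K (derivative (bas r a))),
    Finset.sum_nonneg fun a _ => add_nonneg (hK0 _) (hK0 _), fun a ha s hs => ?_⟩
  have h1 := Finset.single_le_sum
    (f := fun a => K (bas r a) + K (derivative (bas r a)))
    (fun a _ => add_nonneg (hK0 _) (hK0 _)) ha
  have h2 := hK (bas r a) s hs
  have h3 := hK (derivative (bas r a)) s hs
  have h4 := hK0 (bas r a)
  have h5 := hK0 (derivative (bas r a))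
  constructor <;> linarith

/-! ### Taylor approximation -/

lemma exists_taylor (N : ℕ) (D : ℕ → ℝ → ℝ)
    (hD : ∀ n ≤ N, ∀ x, HasDerivAt (D n) (D (n + 1) x) x) (hc : Continuous (D (N + 1)))
    {p q : ℝ} (hpq : p ≤ q) :
    ∃ P : ℝ[X], P.natDegree ≤ N ∧
      (∀ x ∈ Set.Icc p q, |D 0 x - P.eval x| ≤ (q - p) ^ N * ∫ x in p..q, |D (N + 1) x|) ∧
      (1 ≤ N → ∀ x ∈ Set.Icc p q, |D 1 x - (derivative P).eval x| ≤
        (q - p) ^ (N - 1) * ∫ x in p..q, |D (N + 1) x|) := by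
  induction N generalizing D with
  | zero =>
    refine ⟨C (D 0 p), by simp, fun x hx => ?_, fun h => absurd h (by norm_num)⟩
    have h1 : ∫ t in p..x, D 1 t = D 0 x - D 0 p :=
      intervalIntegral.integral_eq_sub_of_hasDerivAt (fun t _ => hD 0 le_rfl t)
        (hc.intervalIntegrable _ _)
    rw [eval_C, ← h1, pow_zero, one_mul]
    refine (intervalIntegral.abs_integral_le_integral_abs hx.1).trans ?_
    exact integral_mono_subinterval le_rfl hx.1 hx.2 hc.abs fun x => abs_nonneg _
  | succ N ih =>
    obtain ⟨P, hPd, hP, -⟩ := ih (fun n => D (n + 1)) (fun n hn x => hD (n + 1) (by omega) x) hc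
    obtain ⟨Q, hQ, hQd⟩ := exists_antiderivative P N hPd
    have hder : derivative (Q - C (Q.eval p) + C (D 0 p)) = P := by simp [hQ]
    have hc1 : Continuous (D 1) :=
      continuous_iff_continuousAt.mpr fun x => (hD 1 (by omega) x).continuousAt
    refine ⟨Q - C (Q.eval p) + C (D 0 p), ?_, fun x hx => ?_, fun _ x hx => ?_⟩
    · refine (natDegree_add_C (a := D 0 p)).le.trans ?_
      rw [natDegree_sub_C]
      exact hQd
    · have h1 : ∫ t in p..x, (D 1 t - P.eval t) = D 0 x - (Q - C (Q.eval p) + C (D 0 p)).eval x := by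
        rw [intervalIntegral.integral_sub (hc1.intervalIntegrable _ _)
          (poly_intervalIntegrable _ _ _)]
        have h2 : ∫ t in p..x, D 1 t = D 0 x - D 0 p :=
          intervalIntegral.integral_eq_sub_of_hasDerivAt (fun t _ => hD 0 (by omega) t)
            (hc1.intervalIntegrable _ _)
        have h3 := integral_derivative_eval Q p x
        rw [hQ] at h3
        rw [h2, h3]
        simp only [eval_add, eval_sub, eval_C]
        ring
      rw [← h1]
      refine (intervalIntegral.norm_integral_le_of_norm_le_const (f := fun t => D 1 t - P.eval t)
        (a := p) (b := x) (C := (q - p) ^ N * ∫ x in p..q, |D (N + 1 + 1) x|)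
        fun t ht => ?_).trans ?_
      · rw [Set.uIoc_of_le hx.1] at ht
        exact hP t ⟨ht.1.le, ht.2.trans hx.2⟩
      · have h0 : 0 ≤ ∫ x in p..q, |D (N + 1 + 1) x| :=
          intervalIntegral.integral_nonneg hpq fun x _ => abs_nonneg _
        have h4 : |x - p| ≤ q - p := by
          rw [abs_of_nonneg (by linarith [hx.1])]; linarith [hx.2]
        have h5 : 0 ≤ q - p := by linarith
        calc _ ≤ ((q - p) ^ N * ∫ x in p..q, |D (N + 1 + 1) x|) * (q - p) :=
              mul_le_mul_of_nonneg_left h4 (by positivity)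
          _ = _ := by ring
    · rw [hder, Nat.add_sub_cancel]
      exact hP x hx

/-! ### Interpolation error estimates -/

lemma abs_sum_mul_le {s : Finset ℕ} {f g : ℕ → ℝ} {A B : ℝ} (hA : 0 ≤ A)
    (hf : ∀ a ∈ s, |f a| ≤ A) (hg : ∀ a ∈ s, |g a| ≤ B) :
    |∑ a ∈ s, f a * g a| ≤ s.card * (A * B) := by
  refine (Finset.abs_sum_le_sum_abs _ _).trans ?_
  rw [← nsmul_eq_mul]
  refine Finset.sum_le_card_nsmul _ _ _ fun a ha => ?_
  rw [abs_mul]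
  exact mul_le_mul (hf a ha) (hg a ha) (abs_nonneg _) hA

lemma sq_integral_abs_le {p q : ℝ} (hpq : p ≤ q) {f : ℝ → ℝ} (hf : Continuous f) :
    (∫ x in p..q, |f x|) ^ 2 ≤ (q - p) * ∫ x in p..q, f x ^ 2 := by
  have := integral_sq_le hpq hf.abs
  simpa only [sq_abs] using this

/-- Error of the interpolant in terms of the derivative of order `N + 1 ≤ r + 1`. -/
lemma interp_error (hr : 1 ≤ r) : ∃ K : ℝ, 0 ≤ K ∧ ∀ N ≤ r, ∀ p q : ℝ, p < q →
    ∀ D : ℕ → ℝ → ℝ, (∀ n ≤ N, ∀ x, HasDerivAt (D n) (D (n + 1) x) x) →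
    Continuous (D (N + 1)) → ∀ x ∈ Set.Icc p q,
    (D 0 x - ∑ a ∈ Finset.range (r + 2), D 0 (nd r p q a) * (bp r p q a).eval x) ^ 2 ≤
      K * (q - p) ^ (2 * N + 1) * ∫ x in p..q, D (N + 1) x ^ 2 := by
  obtain ⟨B, hB0, hB⟩ := exists_bas_bound r
  refine ⟨(1 + (r + 2) * B) ^ 2, by positivity, fun N hN p q hpq D hD hc x hx => ?_⟩
  obtain ⟨P, hPd, hP, -⟩ := exists_taylor N D hD hc hpq.le
  set I := ∫ x in p..q, |D (N + 1) x| with hI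
  have hI0 : 0 ≤ I := intervalIntegral.integral_nonneg hpq.le fun x _ => abs_nonneg _
  have hh : 0 ≤ q - p := by linarith
  have h1 : D 0 x - ∑ a ∈ Finset.range (r + 2), D 0 (nd r p q a) * (bp r p q a).eval x =
      (D 0 x - P.eval x) - ∑ a ∈ Finset.range (r + 2),
        (D 0 (nd r p q a) - P.eval (nd r p q a)) * (bp r p q a).eval x := by
    simp only [sub_mul, Finset.sum_sub_distrib, sum_bp hpq P (hPd.trans hN) x]
    ring
  have h2 : |∑ a ∈ Finset.range (r + 2),
        (D 0 (nd r p q a) - P.eval (nd r p q a)) * (bp r p q a).eval x| ≤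
      (Finset.range (r + 2)).card * ((q - p) ^ N * I * B) := by
    refine abs_sum_mul_le (by positivity) (fun a ha => hP _ (nd_mem hpq.le ha)) fun a ha => ?_
    rw [bp_eval]
    exact (hB a ha _ (inv_mem hpq hx)).1
  rw [Finset.card_range] at h2
  push_cast at h2
  have h3 : |D 0 x - ∑ a ∈ Finset.range (r + 2), D 0 (nd r p q a) * (bp r p q a).eval x| ≤
      (1 + (r + 2) * B) * ((q - p) ^ N * I) := by
    rw [h1]
    refine (abs_sub _ _).trans ?_
    have := hP x hx
    linarith
  have h4 := sq_integral_abs_le hpq.le hc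
  rw [← sq_abs]
  calc _ ≤ ((1 + (r + 2) * B) * ((q - p) ^ N * I)) ^ 2 := by gcongr
    _ = (1 + (r + 2) * B) ^ 2 * (q - p) ^ (2 * N) * I ^ 2 := by ring
    _ ≤ (1 + (r + 2) * B) ^ 2 * (q - p) ^ (2 * N) *
        ((q - p) * ∫ x in p..q, D (N + 1) x ^ 2) := by gcongr
    _ = _ := by ring

/-- Superconvergence of the derivative of the interpolant at the Gauss points. -/
lemma interp_derivative_error {G : ℕ → ℝ} (hG : IsGaussPoints r G) (hr : 1 ≤ r) :
    ∃ K : ℝ, 0 ≤ K ∧ ∀ p q : ℝ, p < q →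
    ∀ D : ℕ → ℝ → ℝ, (∀ n ≤ r + 1, ∀ x, HasDerivAt (D n) (D (n + 1) x) x) →
    Continuous (D (r + 2)) → ∀ k ∈ Finset.Icc 1 r,
    (D 1 (aff p q (G k)) - ∑ a ∈ Finset.range (r + 2), D 0 (nd r p q a) *
        (derivative (bp r p q a)).eval (aff p q (G k))) ^ 2 ≤
      K * (q - p) ^ (2 * r + 1) * ∫ x in p..q, D (r + 2) x ^ 2 := by
  obtain ⟨B, hB0, hB⟩ := exists_bas_bound r
  refine ⟨(1 + (r + 2) * (2 * B)) ^ 2, by positivity, fun p q hpq D hD hc k hk => ?_⟩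
  obtain ⟨P, hPd, hP, hP'⟩ := exists_taylor (r + 1) D hD hc hpq.le
  have hg : G k ∈ Set.Icc (-1 : ℝ) 1 := Set.Ioo_subset_Icc_self
    (hG.2 k (Finset.mem_Icc.mp hk).1 (Finset.mem_Icc.mp hk).2).1
  have hP' := hP' (by omega) (aff p q (G k)) (aff_mem_Icc hpq.le hg)
  rw [Nat.add_sub_cancel] at hP'
  set I := ∫ x in p..q, |D (r + 2) x| with hI
  have hI0 : 0 ≤ I := intervalIntegral.integral_nonneg hpq.le fun x _ => abs_nonneg _
  have hh : 0 < q - p := by linarith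
  have h1 : D 1 (aff p q (G k)) - ∑ a ∈ Finset.range (r + 2), D 0 (nd r p q a) *
        (derivative (bp r p q a)).eval (aff p q (G k)) =
      (D 1 (aff p q (G k)) - (derivative P).eval (aff p q (G k))) -
        ∑ a ∈ Finset.range (r + 2), (D 0 (nd r p q a) - P.eval (nd r p q a)) *
          (derivative (bp r p q a)).eval (aff p q (G k)) := by
    simp only [sub_mul, Finset.sum_sub_distrib, sum_bp_derivative hG hr hpq P hPd hk]
    ring
  have h2 : |∑ a ∈ Finset.range (r + 2), (D 0 (nd r p q a) - P.eval (nd r p q a)) *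
          (derivative (bp r p q a)).eval (aff p q (G k))| ≤
      (Finset.range (r + 2)).card * ((q - p) ^ (r + 1) * I * (2 / (q - p) * B)) := by
    refine abs_sum_mul_le (by positivity) (fun a ha => hP _ (nd_mem hpq.le ha)) fun a ha => ?_
    rw [bp_derivative_eval, inv_aff hpq, abs_mul, abs_of_pos (by positivity : 0 < 2 / (q - p))]
    exact mul_le_mul_of_nonneg_left (hB a ha _ hg).2 (by positivity)
  have h2' : (q - p) ^ (r + 1) * I * (2 / (q - p) * B) = (q - p) ^ r * I * (2 * B) := by
    field_simp
    ring
  rw [Finset.card_range, h2'] at h2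
  push_cast at h2
  have h3 : |D 1 (aff p q (G k)) - ∑ a ∈ Finset.range (r + 2), D 0 (nd r p q a) *
        (derivative (bp r p q a)).eval (aff p q (G k))| ≤
      (1 + (r + 2) * (2 * B)) * ((q - p) ^ r * I) := by
    rw [h1]
    refine (abs_sub _ _).trans ?_
    linarith
  have h4 := sq_integral_abs_le hpq.le hc
  rw [← sq_abs]
  calc _ ≤ ((1 + (r + 2) * (2 * B)) * ((q - p) ^ r * I)) ^ 2 := by gcongr
    _ = (1 + (r + 2) * (2 * B)) ^ 2 * (q - p) ^ (2 * r) * I ^ 2 := by ring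
    _ ≤ (1 + (r + 2) * (2 * B)) ^ 2 * (q - p) ^ (2 * r) *
        ((q - p) * ∫ x in p..q, D (r + 2) x ^ 2) := by gcongr
    _ = _ := by ring

/-- Stability of the derivative of the interpolant. -/
lemma interp_derivative_stable {G : ℕ → ℝ} (hG : IsGaussPoints r G) :
    ∃ K : ℝ, 0 ≤ K ∧ ∀ p q : ℝ, p < q →
    ∀ f f' : ℝ → ℝ, (∀ x, HasDerivAt f (f' x) x) → Continuous f' → ∀ k ∈ Finset.Icc 1 r,
    (q - p) * (∑ a ∈ Finset.range (r + 2), f (nd r p q a) *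
        (derivative (bp r p q a)).eval (aff p q (G k))) ^ 2 ≤
      K * ∫ x in p..q, f' x ^ 2 := by
  obtain ⟨B, hB0, hB⟩ := exists_bas_bound r
  refine ⟨((r + 2) * (2 * B)) ^ 2, by positivity, fun p q hpq f f' hf hc k hk => ?_⟩
  have hg : G k ∈ Set.Icc (-1 : ℝ) 1 := Set.Ioo_subset_Icc_self
    (hG.2 k (Finset.mem_Icc.mp hk).1 (Finset.mem_Icc.mp hk).2).1
  have hT : ∀ x ∈ Set.Icc p q, |f x - f p| ≤ ∫ x in p..q, |f' x| := by
    intro x hx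
    rw [← intervalIntegral.integral_eq_sub_of_hasDerivAt (fun t _ => hf t)
        (hc.intervalIntegrable _ _)]
    refine (intervalIntegral.abs_integral_le_integral_abs hx.1).trans ?_
    exact integral_mono_subinterval le_rfl hx.1 hx.2 hc.abs fun x => abs_nonneg _
  set I := ∫ x in p..q, |f' x| with hI
  have hI0 : 0 ≤ I := intervalIntegral.integral_nonneg hpq.le fun x _ => abs_nonneg _
  have hh : 0 < q - p := by linarith
  have hz : ∑ a ∈ Finset.range (r + 2), f p *
      (derivative (bp r p q a)).eval (aff p q (G k)) = 0 := by
    have h : ∑ a ∈ Finset.range (r + 2), C (f p) * bp r p q a = C (f p) := by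
      refine Polynomial.funext fun x => ?_
      have := sum_bp (r := r) hpq (C (f p)) (by simp) x
      simpa [eval_finsetSum] using this
    have := congrArg (fun Q => (derivative Q).eval (aff p q (G k))) h
    simpa [eval_finsetSum, derivative_sum] using this
  have h1 : ∑ a ∈ Finset.range (r + 2), f (nd r p q a) *
        (derivative (bp r p q a)).eval (aff p q (G k)) =
      ∑ a ∈ Finset.range (r + 2), (f (nd r p q a) - f p) *
        (derivative (bp r p q a)).eval (aff p q (G k)) := by
    simp only [sub_mul, Finset.sum_sub_distrib, hz, sub_zero]
  have h2 : |∑ a ∈ Finset.range (r + 2), (f (nd r p q a) - f p) *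
        (derivative (bp r p q a)).eval (aff p q (G k))| ≤
      (Finset.range (r + 2)).card * (I * (2 / (q - p) * B)) := by
    refine abs_sum_mul_le hI0 (fun a ha => hT _ (nd_mem hpq.le ha)) fun a ha => ?_
    rw [bp_derivative_eval, inv_aff hpq, abs_mul, abs_of_pos (by positivity : 0 < 2 / (q - p))]
    exact mul_le_mul_of_nonneg_left (hB a ha _ hg).2 (by positivity)
  rw [Finset.card_range] at h2
  push_cast at h2
  have h4 := sq_integral_abs_le hpq.le hc
  rw [h1, ← sq_abs]
  calc _ ≤ (q - p) * ((r + 2) * (I * (2 / (q - p) * B))) ^ 2 := by gcongr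
    _ = ((r + 2) * (2 * B)) ^ 2 * (I ^ 2 / (q - p)) := by field_simp
    _ ≤ ((r + 2) * (2 * B)) ^ 2 * (∫ x in p..q, f' x ^ 2) := by
        refine mul_le_mul_of_nonneg_left ?_ (by positivity)
        rw [div_le_iff₀ hh]
        linarith
    _ = _ := by ring

end

/-! ### Partial derivatives -/

lemma contDiff_pdx {f : ℝ × ℝ → ℝ} {n : ℕ} (hf : ContDiff ℝ (n + 1 : ℕ) f) :
    ContDiff ℝ n (pdx f) :=
  (hf.fderiv_right (m := n) (by norm_cast)).clm_apply contDiff_const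

lemma contDiff_pdy {f : ℝ × ℝ → ℝ} {n : ℕ} (hf : ContDiff ℝ (n + 1 : ℕ) f) :
    ContDiff ℝ n (pdy f) :=
  (hf.fderiv_right (m := n) (by norm_cast)).clm_apply contDiff_const

lemma contDiff_iterate_pdx {f : ℝ × ℝ → ℝ} {n : ℕ} (k : ℕ) (hf : ContDiff ℝ (n + k : ℕ) f) :
    ContDiff ℝ n (pdx^[k] f) := by
  induction k generalizing n with
  | zero => exact hf
  | succ k ih =>
    rw [Function.iterate_succ_apply']
    exact contDiff_pdx (ih (by rwa [show n + 1 + k = n + (k + 1) by ring]))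

lemma contDiff_iterate_pdy {f : ℝ × ℝ → ℝ} {n : ℕ} (k : ℕ) (hf : ContDiff ℝ (n + k : ℕ) f) :
    ContDiff ℝ n (pdy^[k] f) := by
  induction k generalizing n with
  | zero => exact hf
  | succ k ih =>
    rw [Function.iterate_succ_apply']
    exact contDiff_pdy (ih (by rwa [show n + 1 + k = n + (k + 1) by ring]))

lemma contDiff_one_of {f : ℝ × ℝ → ℝ} {n : ℕ} (hf : ContDiff ℝ (n + 1 : ℕ) f) :
    ContDiff ℝ 1 f := hf.of_le (by norm_cast; omega)

lemma continuous_pdx {f : ℝ × ℝ → ℝ} (hf : ContDiff ℝ 1 f) : Continuous (pdx f) :=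
  (contDiff_pdx (n := 0) (by exact_mod_cast hf)).continuous

lemma continuous_pdy {f : ℝ × ℝ → ℝ} (hf : ContDiff ℝ 1 f) : Continuous (pdy f) :=
  (contDiff_pdy (n := 0) (by exact_mod_cast hf)).continuous

lemma hasDerivAt_fst {f : ℝ × ℝ → ℝ} (hf : ContDiff ℝ 1 f) (x y : ℝ) :
    HasDerivAt (fun x => f (x, y)) (pdx f (x, y)) x :=
  ((hf.differentiable one_ne_zero (x, y)).hasFDerivAt).comp_hasDerivAt x
    ((hasDerivAt_id x).prodMk (hasDerivAt_const x y))

lemma hasDerivAt_snd {f : ℝ × ℝ → ℝ} (hf : ContDiff ℝ 1 f) (x y : ℝ) :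
    HasDerivAt (fun y => f (x, y)) (pdy f (x, y)) y :=
  ((hf.differentiable one_ne_zero (x, y)).hasFDerivAt).comp_hasDerivAt y
    ((hasDerivAt_const y x).prodMk (hasDerivAt_id y))

lemma pdx_sub {f g : ℝ × ℝ → ℝ} (hf : ContDiff ℝ 1 f) (hg : ContDiff ℝ 1 g) (z : ℝ × ℝ) :
    pdx (fun z => f z - g z) z = pdx f z - pdx g z := by
  unfold pdx
  rw [fderiv_fun_sub (hf.differentiable one_ne_zero z) (hg.differentiable one_ne_zero z)]
  rfl

lemma pdy_sub {f g : ℝ × ℝ → ℝ} (hf : ContDiff ℝ 1 f) (hg : ContDiff ℝ 1 g) (z : ℝ × ℝ) :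
    pdy (fun z => f z - g z) z = pdy f z - pdy g z := by
  unfold pdy
  rw [fderiv_fun_sub (hf.differentiable one_ne_zero z) (hg.differentiable one_ne_zero z)]
  rfl

lemma pdy_pdx {f : ℝ × ℝ → ℝ} (hf : ContDiff ℝ 2 f) : pdy (pdx f) = pdx (pdy f) := by
  funext z
  have hd : DifferentiableAt ℝ (fderiv ℝ f) z :=
    ((hf.fderiv_right (m := 1) (by norm_num)).differentiable one_ne_zero) z
  have hs := (hf.contDiffAt (x := z)).isSymmSndFDerivAt (by simp) (0, 1) (1, 0)
  have e : ∀ a b : ℝ × ℝ, fderiv ℝ (fun z => fderiv ℝ f z a) z b =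
      fderiv ℝ (fderiv ℝ f) z b a := fun a b => by
    rw [fderiv_clm_apply hd (differentiableAt_const a)]
    simp
  change fderiv ℝ (fun z => fderiv ℝ f z (1, 0)) z (0, 1) =
    fderiv ℝ (fun z => fderiv ℝ f z (0, 1)) z (1, 0)
  rw [e, e, hs]

lemma iterate_pdy_pdx {f : ℝ × ℝ → ℝ} (n : ℕ) (hf : ContDiff ℝ (n + 1 : ℕ) f) :
    pdy^[n] (pdx f) = pdx (pdy^[n] f) := by
  induction n generalizing f with
  | zero => rfl
  | succ n ih =>
    have h2 : ContDiff ℝ 2 f := hf.of_le (by norm_cast; omega)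
    rw [Function.iterate_succ_apply, pdy_pdx h2, ih (contDiff_pdy hf), Function.iterate_succ_apply]

lemma pdx_swap (f : ℝ × ℝ → ℝ) : pdx (f ∘ Prod.swap) = pdy f ∘ Prod.swap := by
  funext z
  have := (ContinuousLinearEquiv.prodComm ℝ ℝ ℝ).comp_right_fderiv (f := f) (x := z)
  change fderiv ℝ (f ∘ (ContinuousLinearEquiv.prodComm ℝ ℝ ℝ)) z (1, 0) = _
  rw [this]
  rfl

lemma pdy_swap (f : ℝ × ℝ → ℝ) : pdy (f ∘ Prod.swap) = pdx f ∘ Prod.swap := by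
  funext z
  have := (ContinuousLinearEquiv.prodComm ℝ ℝ ℝ).comp_right_fderiv (f := f) (x := z)
  change fderiv ℝ (f ∘ (ContinuousLinearEquiv.prodComm ℝ ℝ ℝ)) z (0, 1) = _
  rw [this]
  rfl

lemma iterate_pdx_swap (f : ℝ × ℝ → ℝ) (n : ℕ) :
    pdx^[n] (f ∘ Prod.swap) = pdy^[n] f ∘ Prod.swap := by
  induction n generalizing f with
  | zero => rfl
  | succ n ih => rw [Function.iterate_succ_apply, pdx_swap, ih, Function.iterate_succ_apply]

lemma iterate_pdy_swap (f : ℝ × ℝ → ℝ) (n : ℕ) :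
    pdy^[n] (f ∘ Prod.swap) = pdx^[n] f ∘ Prod.swap := by
  induction n generalizing f with
  | zero => rfl
  | succ n ih => rw [Function.iterate_succ_apply, pdy_swap, ih, Function.iterate_succ_apply]

lemma contDiff_swap {f : ℝ × ℝ → ℝ} {n : ℕ} (hf : ContDiff ℝ n f) :
    ContDiff ℝ n (f ∘ Prod.swap) :=
  hf.comp (ContinuousLinearEquiv.prodComm ℝ ℝ ℝ).contDiff

/-! ### Integrals over rectangles -/

section
variable {p q s t : ℝ} {F H : ℝ × ℝ → ℝ}

lemma setIntegral_rect (hpq : p ≤ q) (hst : s ≤ t)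
    (hF : ContinuousOn F (Set.Icc p q ×ˢ Set.Icc s t)) :
    ∫ z in Set.Icc p q ×ˢ Set.Icc s t, F z = rectInt F p q s t := by
  rw [Measure.volume_eq_prod, setIntegral_prod]
  · rw [rectInt, intervalIntegral.integral_of_le hpq, integral_Icc_eq_integral_Ioc]
    refine setIntegral_congr_fun measurableSet_Ioc fun x _ => ?_
    change ∫ y in Set.Icc s t, F (x, y) = ∫ y in s..t, F (x, y)
    rw [intervalIntegral.integral_of_le hst, integral_Icc_eq_integral_Ioc]
  · rw [← Measure.volume_eq_prod]
    exact hF.integrableOn_compact (isCompact_Icc.prod isCompact_Icc)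

lemma rectInt_swap (hF : Continuous F) (p q s t : ℝ) :
    rectInt (F ∘ Prod.swap) s t p q = rectInt F p q s t := by
  unfold rectInt
  refine intervalIntegral_intervalIntegral_swap (F := fun y x => F (x, y)) ?_
  have : Continuous (fun z : ℝ × ℝ => F (z.2, z.1)) := by fun_prop
  exact (this.continuousOn.integrableOn_compact
    (isCompact_uIcc.prod isCompact_uIcc)).mono_set
      (Set.prod_mono Set.uIoc_subset_uIcc Set.uIoc_subset_uIcc)

lemma rectInt_mono (hpq : p ≤ q) (hst : s ≤ t) (hF : Continuous F) (hH : Continuous H)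
    (h : ∀ x ∈ Set.Icc p q, ∀ y ∈ Set.Icc s t, F (x, y) ≤ H (x, y)) :
    rectInt F p q s t ≤ rectInt H p q s t := by
  unfold rectInt
  refine intervalIntegral.integral_mono_on hpq (Continuous.intervalIntegrable (by fun_prop) _ _)
    (Continuous.intervalIntegrable (by fun_prop) _ _) fun x hx => ?_
  exact intervalIntegral.integral_mono_on hst (Continuous.intervalIntegrable (by fun_prop) _ _)
    (Continuous.intervalIntegrable (by fun_prop) _ _) fun y hy => h x hx y hy

lemma rectInt_nonneg (hpq : p ≤ q) (hst : s ≤ t) (h : ∀ z, 0 ≤ F z) :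
    0 ≤ rectInt F p q s t :=
  intervalIntegral.integral_nonneg hpq fun _ _ =>
    intervalIntegral.integral_nonneg hst fun _ _ => h _

lemma rectInt_add (hF : Continuous F) (hH : Continuous H) :
    rectInt (fun z => F z + H z) p q s t = rectInt F p q s t + rectInt H p q s t := by
  unfold rectInt
  rw [← intervalIntegral.integral_add (Continuous.intervalIntegrable (by fun_prop) _ _)
    (Continuous.intervalIntegrable (by fun_prop) _ _)]
  refine intervalIntegral.integral_congr fun x _ => ?_
  exact intervalIntegral.integral_add (Continuous.intervalIntegrable (by fun_prop) _ _)
    (Continuous.intervalIntegrable (by fun_prop) _ _)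

lemma rectInt_const_mul (c : ℝ) :
    rectInt (fun z => c * F z) p q s t = c * rectInt F p q s t := by
  unfold rectInt
  simp only [intervalIntegral.integral_const_mul]

end

/-! ### Polynomials in two variables -/

/-- Polynomials of degree `≤ r` in the first and `≤ s` in the second variable. -/
def biP (r s : ℕ) : Submodule ℝ (ℝ × ℝ → ℝ) :=
  Submodule.span ℝ {f | ∃ P Q : ℝ[X], P.natDegree ≤ r ∧ Q.natDegree ≤ s ∧
    f = fun z => P.eval z.1 * Q.eval z.2}

section
variable {r s : ℕ} {f : ℝ × ℝ → ℝ}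

lemma mul_mem_biP {P Q : ℝ[X]} (hP : P.natDegree ≤ r) (hQ : Q.natDegree ≤ s) :
    (fun z : ℝ × ℝ => P.eval z.1 * Q.eval z.2) ∈ biP r s :=
  Submodule.subset_span ⟨P, Q, hP, hQ, rfl⟩

lemma IsBiPoly.mem (hf : IsBiPoly r f) : f ∈ biP r r := by
  obtain ⟨p, hp, hc, hf⟩ := hf
  have : f = ∑ a ∈ Finset.range (r + 1),
      fun z : ℝ × ℝ => (X ^ a : ℝ[X]).eval z.1 * (p.coeff a).eval z.2 := by
    funext z
    obtain ⟨x, y⟩ := z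
    rw [hf, evalXY, eval_eq_sum_range' (n := r + 1)
      (lt_of_le_of_lt natDegree_map_le (Nat.lt_succ_of_le hp))]
    simp only [coeff_map, Finset.sum_apply, eval_pow, eval_X]
    refine Finset.sum_congr rfl fun a _ => ?_
    rw [coe_evalRingHom, mul_comm]
  rw [this]
  refine Submodule.sum_mem _ fun a ha => mul_mem_biP ?_ (hc a)
  rw [natDegree_X_pow]
  exact Nat.lt_succ_iff.mp (Finset.mem_range.mp ha)

lemma contDiff_eval (P : ℝ[X]) {n : ℕ} : ContDiff ℝ n (fun x => P.eval x) := by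
  simpa using P.contDiff_aeval (𝕜 := ℝ) (n : WithTop ℕ∞)

lemma contDiff_of_mem (hf : f ∈ biP r s) (n : ℕ) : ContDiff ℝ n f := by
  induction hf using Submodule.span_induction with
  | mem f hf =>
    obtain ⟨P, Q, -, -, rfl⟩ := hf
    exact ((contDiff_eval P).comp contDiff_fst).mul ((contDiff_eval Q).comp contDiff_snd)
  | zero => exact contDiff_const
  | add f g _ _ hf hg => exact hf.add hg
  | smul c f _ hf => exact contDiff_const.smul hf

lemma contDiff_one_of_mem (hf : f ∈ biP r s) : ContDiff ℝ 1 f := by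
  exact_mod_cast contDiff_of_mem hf 1

lemma swap_mem (hf : f ∈ biP r s) : f ∘ Prod.swap ∈ biP s r := by
  induction hf using Submodule.span_induction with
  | mem f hf =>
    obtain ⟨P, Q, hP, hQ, rfl⟩ := hf
    have : (fun z : ℝ × ℝ => P.eval z.1 * Q.eval z.2) ∘ Prod.swap =
      fun z => Q.eval z.1 * P.eval z.2 := by funext z; simp [mul_comm]
    rw [this]
    exact mul_mem_biP hQ hP
  | zero => exact Submodule.zero_mem _
  | add f g _ _ hf hg => exact Submodule.add_mem _ hf hg
  | smul c f _ hf => exact Submodule.smul_mem _ c hf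

lemma pdx_mem (hf : f ∈ biP r s) : pdx f ∈ biP (r - 1) s := by
  induction hf using Submodule.span_induction with
  | mem f hf =>
    obtain ⟨P, Q, hP, hQ, rfl⟩ := hf
    have : pdx (fun z : ℝ × ℝ => P.eval z.1 * Q.eval z.2) =
        fun z => (derivative P).eval z.1 * Q.eval z.2 := by
      funext z
      refine (hasDerivAt_fst (contDiff_one_of_mem (mul_mem_biP hP hQ)) z.1 z.2).unique ?_
      exact (P.hasDerivAt z.1).mul_const (Q.eval z.2)
    rw [this]
    exact mul_mem_biP ((natDegree_derivative_le P).trans (Nat.sub_le_sub_right hP 1)) hQ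
  | zero =>
    have : pdx (0 : ℝ × ℝ → ℝ) = 0 := by
      funext z; simp [pdx]
    rw [this]
    exact Submodule.zero_mem _
  | add f g hf' hg' hf hg =>
    have : pdx (f + g) = pdx f + pdx g := by
      funext z
      unfold pdx
      rw [fderiv_add ((contDiff_one_of_mem hf').differentiable one_ne_zero z)
        ((contDiff_one_of_mem hg').differentiable one_ne_zero z)]
      rfl
    rw [this]
    exact Submodule.add_mem _ hf hg
  | smul c f hf' hf =>
    have : pdx (c • f) = c • pdx f := by
      funext z
      unfold pdx
      rw [fderiv_const_smul ((contDiff_one_of_mem hf').differentiable one_ne_zero z)]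
      rfl
    rw [this]
    exact Submodule.smul_mem _ c hf

lemma pdy_mem (hf : f ∈ biP r s) : pdy f ∈ biP r (s - 1) := by
  have := swap_mem (pdx_mem (swap_mem hf))
  rwa [pdx_swap] at this

/-- The restrictions to horizontal lines are polynomials. -/
lemma exists_slice_fst (hf : f ∈ biP r s) (y : ℝ) :
    ∃ P : ℝ[X], P.natDegree ≤ r ∧ (∀ x, f (x, y) = P.eval x) ∧
      ∀ x, pdx f (x, y) = (derivative P).eval x := by
  have : ∃ P : ℝ[X], P.natDegree ≤ r ∧ ∀ x, f (x, y) = P.eval x := by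
    induction hf using Submodule.span_induction with
    | mem f hf =>
      obtain ⟨P, Q, hP, hQ, rfl⟩ := hf
      exact ⟨C (Q.eval y) * P, (natDegree_C_mul_le _ _).trans hP, fun x => by simp [mul_comm]⟩
    | zero => exact ⟨0, by simp, fun x => by simp⟩
    | add f g _ _ hf hg =>
      obtain ⟨P, hP, hP'⟩ := hf
      obtain ⟨Q, hQ, hQ'⟩ := hg
      exact ⟨P + Q, natDegree_add_le_of_degree_le hP hQ, fun x => by simp [hP', hQ']⟩
    | smul c f _ hf =>
      obtain ⟨P, hP, hP'⟩ := hf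
      exact ⟨C c * P, (natDegree_C_mul_le _ _).trans hP, fun x => by simp [hP']⟩
  obtain ⟨P, hP, hP'⟩ := this
  refine ⟨P, hP, hP', fun x => ?_⟩
  refine (hasDerivAt_fst (contDiff_one_of_mem hf) x y).unique ?_
  rw [funext hP']
  exact P.hasDerivAt x

/-- The restrictions to vertical lines are polynomials. -/
lemma exists_slice_snd (hf : f ∈ biP r s) (x : ℝ) :
    ∃ P : ℝ[X], P.natDegree ≤ s ∧ (∀ y, f (x, y) = P.eval y) ∧
      ∀ y, pdy f (x, y) = (derivative P).eval y := by
  obtain ⟨P, hP, h1, h2⟩ := exists_slice_fst (swap_mem hf) x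
  refine ⟨P, hP, h1, fun y => ?_⟩
  rw [← h2, pdx_swap]
  rfl

end

/-! ### Local estimates on a rectangle -/

/-- The tensor product interpolant on `[p,q] × [s,t]`. -/
noncomputable def interp (r : ℕ) (p q s t : ℝ) (u : ℝ × ℝ → ℝ) (z : ℝ × ℝ) : ℝ :=
  ∑ a ∈ Finset.range (r + 2), ∑ b ∈ Finset.range (r + 2),
    u (nd r p q a, nd r s t b) * (bp r p q a).eval z.1 * (bp r s t b).eval z.2

lemma interp_swap (r : ℕ) (p q s t : ℝ) (u : ℝ × ℝ → ℝ) :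
    interp r s t p q (u ∘ Prod.swap) = interp r p q s t u ∘ Prod.swap := by
  funext z
  simp only [interp, Function.comp, Prod.swap_prod_mk, Prod.fst_swap, Prod.snd_swap]
  rw [Finset.sum_comm]
  exact Finset.sum_congr rfl fun a _ => Finset.sum_congr rfl fun b _ => by ring

section
variable {r : ℕ} {G : ℕ → ℝ}

lemma interp_mem (hr : 1 ≤ r) (p q s t : ℝ) (u : ℝ × ℝ → ℝ) :
    interp r p q s t u ∈ biP r r := by
  have : interp r p q s t u = ∑ a ∈ Finset.range (r + 2), ∑ b ∈ Finset.range (r + 2),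
      u (nd r p q a, nd r s t b) • fun z : ℝ × ℝ =>
        (bp r p q a).eval z.1 * (bp r s t b).eval z.2 := by
    funext z
    simp only [interp, Finset.sum_apply, Pi.smul_apply, smul_eq_mul, mul_assoc]
  rw [this]
  exact Submodule.sum_mem _ fun a ha => Submodule.sum_mem _ fun b hb =>
    Submodule.smul_mem _ _ (mul_mem_biP (bp_natDegree hr _ _ ha) (bp_natDegree hr _ _ hb))

lemma pdx_interp (hr : 1 ≤ r) (p q s t : ℝ) (u : ℝ × ℝ → ℝ) (x y : ℝ) :
    pdx (interp r p q s t u) (x, y) =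
      ∑ a ∈ Finset.range (r + 2), ∑ b ∈ Finset.range (r + 2),
        u (nd r p q a, nd r s t b) * (derivative (bp r p q a)).eval x * (bp r s t b).eval y := by
  refine (hasDerivAt_fst (contDiff_one_of_mem (interp_mem hr p q s t u)) x y).unique ?_
  unfold interp
  refine HasDerivAt.fun_sum fun a _ => HasDerivAt.fun_sum fun b _ => ?_
  exact (((bp r p q a).hasDerivAt x).const_mul _).mul_const ((bp r s t b).eval y)

lemma hasDerivAt_iterate_pdx {u : ℝ × ℝ → ℝ} {N : ℕ} (hu : ContDiff ℝ (N + 1 : ℕ) u)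
    {n : ℕ} (hn : n ≤ N) (x y : ℝ) :
    HasDerivAt (fun x => pdx^[n] u (x, y)) (pdx^[n + 1] u (x, y)) x := by
  rw [Function.iterate_succ_apply']
  refine hasDerivAt_fst ?_ x y
  exact_mod_cast contDiff_iterate_pdx (n := 1) n (hu.of_le (by norm_cast; omega))

lemma hasDerivAt_iterate_pdy {u : ℝ × ℝ → ℝ} {N : ℕ} (hu : ContDiff ℝ (N + 1 : ℕ) u)
    {n : ℕ} (hn : n ≤ N) (x y : ℝ) :
    HasDerivAt (fun y => pdy^[n] u (x, y)) (pdy^[n + 1] u (x, y)) y := by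
  rw [Function.iterate_succ_apply']
  refine hasDerivAt_snd ?_ x y
  exact_mod_cast contDiff_iterate_pdy (n := 1) n (hu.of_le (by norm_cast; omega))

lemma continuous_iterate_pdx {u : ℝ × ℝ → ℝ} {n : ℕ} (hu : ContDiff ℝ n u) :
    Continuous (pdx^[n] u) :=
  (contDiff_iterate_pdx (n := 0) n (by simpa using hu)).continuous

lemma continuous_iterate_pdy {u : ℝ × ℝ → ℝ} {n : ℕ} (hu : ContDiff ℝ n u) :
    Continuous (pdy^[n] u) :=
  (contDiff_iterate_pdy (n := 0) n (by simpa using hu)).continuous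

/-- One-dimensional interpolation error in the second variable. -/
lemma interp_error_snd (hr : 1 ≤ r) : ∃ K : ℝ, 0 ≤ K ∧ ∀ s t : ℝ, s < t →
    ∀ u : ℝ × ℝ → ℝ, ContDiff ℝ (r + 1 : ℕ) u → ∀ x, ∀ y ∈ Set.Icc s t,
    (u (x, y) - ∑ b ∈ Finset.range (r + 2), u (x, nd r s t b) * (bp r s t b).eval y) ^ 2 ≤
      K * (t - s) ^ (2 * r + 1) * ∫ y in s..t, (pdy^[r + 1] u (x, y)) ^ 2 := by
  obtain ⟨K, hK, h⟩ := interp_error hr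
  refine ⟨K, hK, fun s t hst u hu x y hy => ?_⟩
  exact h r le_rfl s t hst (fun n y => pdy^[n] u (x, y))
    (fun n hn y => hasDerivAt_iterate_pdy hu hn x y)
    ((continuous_iterate_pdy hu).comp (by fun_prop)) y hy

/-- The error in the second variable as a function of the first variable is differentiable. -/
lemma hasDerivAt_error {u : ℝ × ℝ → ℝ} (hu : ContDiff ℝ 1 u) (s t x y : ℝ) :
    HasDerivAt
      (fun x => u (x, y) - ∑ b ∈ Finset.range (r + 2), u (x, nd r s t b) * (bp r s t b).eval y)
      (pdx u (x, y) - ∑ b ∈ Finset.range (r + 2),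
        pdx u (x, nd r s t b) * (bp r s t b).eval y) x :=
  (hasDerivAt_fst hu x y).sub
    (HasDerivAt.fun_sum fun _ _ => (hasDerivAt_fst hu x _).mul_const _)

lemma continuous_error {v : ℝ × ℝ → ℝ} (hv : Continuous v) (s t y : ℝ) :
    Continuous (fun x => v (x, y) - ∑ b ∈ Finset.range (r + 2),
        v (x, nd r s t b) * (bp r s t b).eval y) := by fun_prop

/-- Integrated square of the mixed error. -/
lemma mixed_error (hr : 1 ≤ r) : ∃ K : ℝ, 0 ≤ K ∧ ∀ p q s t : ℝ, p ≤ q → s < t →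
    ∀ u : ℝ × ℝ → ℝ, ContDiff ℝ (r + 2 : ℕ) u → ∀ y ∈ Set.Icc s t,
    ∫ x in p..q, (pdx u (x, y) - ∑ b ∈ Finset.range (r + 2),
        pdx u (x, nd r s t b) * (bp r s t b).eval y) ^ 2 ≤
      K * (t - s) ^ (2 * r + 1) * rectInt (fun z => (pdx (pdy^[r + 1] u) z) ^ 2) p q s t := by
  obtain ⟨K, hK, h⟩ := interp_error_snd hr
  refine ⟨K, hK, fun p q s t hpq hst u hu y hy => ?_⟩
  have hu1 : ContDiff ℝ (r + 1 : ℕ) (pdx u) := contDiff_pdx hu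
  have hc : Continuous (pdx u) := hu1.continuous
  have hc2 : Continuous (pdy^[r + 1] (pdx u)) := continuous_iterate_pdy hu1
  have e : pdx (pdy^[r + 1] u) = pdy^[r + 1] (pdx u) := (iterate_pdy_pdx _ hu).symm
  rw [e, rectInt, ← intervalIntegral.integral_const_mul]
  refine intervalIntegral.integral_mono_on hpq
    (((continuous_error hc s t y).pow 2).intervalIntegrable _ _)
    (Continuous.intervalIntegrable (by fun_prop) _ _) fun x _ => ?_
  exact h s t hst _ hu1 x y hy

/-- Error of the interpolant in the gradient at the Gauss lines. -/
lemma flux_error (hG : IsGaussPoints r G) (hr : 1 ≤ r) : ∃ K : ℝ, 0 ≤ K ∧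
    ∀ p q s t : ℝ, p < q → s < t →
    ∀ u : ℝ × ℝ → ℝ, ContDiff ℝ (r + 2 : ℕ) u → ∀ k ∈ Finset.Icc 1 r,
    (q - p) * (∫ y in s..t,
        pdx (fun z => u z - interp r p q s t u z) (aff p q (G k), y) ^ 2) ≤
      K * ((q - p) ^ (2 * r + 2) * rectInt (fun z => (pdx^[r + 2] u z) ^ 2) p q s t +
        (t - s) ^ (2 * r + 2) * rectInt (fun z => (pdx (pdy^[r + 1] u) z) ^ 2) p q s t) := by
  obtain ⟨K₁, hK₁, h₁⟩ := interp_derivative_error hG hr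
  obtain ⟨K₂, hK₂, h₂⟩ := interp_derivative_stable hG
  obtain ⟨K₃, hK₃, h₃⟩ := mixed_error hr
  refine ⟨2 * K₁ + 2 * (K₂ * K₃), by positivity, fun p q s t hpq hst u hu k hk => ?_⟩
  have hu1 : ContDiff ℝ 1 u := contDiff_one_of hu
  have hI := contDiff_one_of_mem (interp_mem hr p q s t u)
  have hcx : Continuous (pdx^[r + 2] u) := continuous_iterate_pdx hu
  have hqp : 0 < q - p := by linarith
  have hts : 0 < t - s := by linarith
  set g := aff p q (G k) with hg
  set M := rectInt (fun z => (pdx (pdy^[r + 1] u) z) ^ 2) p q s t with hM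
  have hM0 : 0 ≤ M := rectInt_nonneg hpq.le hst.le fun z => sq_nonneg _
  have hR0 : 0 ≤ rectInt (fun z => (pdx^[r + 2] u z) ^ 2) p q s t :=
    rectInt_nonneg hpq.le hst.le fun z => sq_nonneg _
  have hpt : ∀ y ∈ Set.Icc s t,
      (q - p) * pdx (fun z => u z - interp r p q s t u z) (g, y) ^ 2 ≤
      2 * K₁ * (q - p) ^ (2 * r + 2) * (∫ x in p..q, (pdx^[r + 2] u (x, y)) ^ 2) +
        2 * (K₂ * K₃) * (t - s) ^ (2 * r + 1) * M := by
    intro y hy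
    have e : pdx (fun z => u z - interp r p q s t u z) (g, y) =
        (pdx u (g, y) - ∑ a ∈ Finset.range (r + 2),
          u (nd r p q a, y) * (derivative (bp r p q a)).eval g) +
        ∑ a ∈ Finset.range (r + 2), (u (nd r p q a, y) - ∑ b ∈ Finset.range (r + 2),
          u (nd r p q a, nd r s t b) * (bp r s t b).eval y) *
            (derivative (bp r p q a)).eval g := by
      rw [pdx_sub hu1 hI, pdx_interp hr]
      simp only [sub_mul, Finset.sum_sub_distrib, Finset.sum_mul]
      rw [sub_add_sub_cancel]
      congr 1
      exact Finset.sum_congr rfl fun a _ => Finset.sum_congr rfl fun b _ => by ring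
    have b₁ := h₁ p q hpq (fun n x => pdx^[n] u (x, y))
      (fun n hn x => hasDerivAt_iterate_pdx hu hn x y) (hcx.comp (by fun_prop)) k hk
    have b₂ := h₂ p q hpq _ _ (fun x => hasDerivAt_error (r := r) hu1 s t x y)
      (continuous_error (continuous_pdx hu1) s t y) k hk
    have b₃ := h₃ p q s t hpq.le hst u hu y hy
    simp only [Function.iterate_one, Function.iterate_zero, id] at b₁
    rw [← hg] at b₁ b₂
    rw [e]
    set A := pdx u (g, y) - ∑ a ∈ Finset.range (r + 2),
          u (nd r p q a, y) * (derivative (bp r p q a)).eval g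
    set B := ∑ a ∈ Finset.range (r + 2), (u (nd r p q a, y) - ∑ b ∈ Finset.range (r + 2),
          u (nd r p q a, nd r s t b) * (bp r s t b).eval y) *
            (derivative (bp r p q a)).eval g
    calc (q - p) * (A + B) ^ 2 ≤ 2 * ((q - p) * A ^ 2) + 2 * ((q - p) * B ^ 2) := by
          nlinarith [mul_nonneg hqp.le (sq_nonneg (A - B))]
      _ ≤ 2 * ((q - p) * (K₁ * (q - p) ^ (2 * r + 1) *
            ∫ x in p..q, (pdx^[r + 2] u (x, y)) ^ 2)) +
          2 * (K₂ * (K₃ * (t - s) ^ (2 * r + 1) * M)) := by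
          have := b₂.trans (mul_le_mul_of_nonneg_left b₃ hK₂)
          have := mul_le_mul_of_nonneg_left b₁ hqp.le
          linarith
      _ = _ := by ring
  have hcd : Continuous (pdx (fun z => u z - interp r p q s t u z)) :=
    continuous_pdx (hu1.sub hI)
  have hmono := intervalIntegral.integral_mono_on (μ := volume) hst.le
    (f := fun y => (q - p) * pdx (fun z => u z - interp r p q s t u z) (g, y) ^ 2)
    (g := fun y => 2 * K₁ * (q - p) ^ (2 * r + 2) *
      (∫ x in p..q, (pdx^[r + 2] u (x, y)) ^ 2) + 2 * (K₂ * K₃) * (t - s) ^ (2 * r + 1) * M)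
    (Continuous.intervalIntegrable (by fun_prop) _ _)
    (Continuous.intervalIntegrable (by fun_prop) _ _) hpt
  rw [intervalIntegral.integral_const_mul, intervalIntegral.integral_add
    (Continuous.intervalIntegrable (by fun_prop) _ _)
    (Continuous.intervalIntegrable (by fun_prop) _ _), intervalIntegral.integral_const_mul,
    intervalIntegral.integral_const, smul_eq_mul] at hmono
  have hsw : (∫ y in s..t, ∫ x in p..q, (pdx^[r + 2] u (x, y)) ^ 2) =
      rectInt (fun z => (pdx^[r + 2] u z) ^ 2) p q s t :=
    rectInt_swap (F := fun z => (pdx^[r + 2] u z) ^ 2) (by fun_prop) p q s t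
  rw [hsw] at hmono
  refine hmono.trans ?_
  have h0 : 0 ≤ 2 * K₁ * ((t - s) ^ (2 * r + 2) * M) := by positivity
  have h1 : 0 ≤ 2 * (K₂ * K₃) *
    ((q - p) ^ (2 * r + 2) * rectInt (fun z => (pdx^[r + 2] u z) ^ 2) p q s t) := by positivity
  calc _ = 2 * K₁ * ((q - p) ^ (2 * r + 2) *
        rectInt (fun z => (pdx^[r + 2] u z) ^ 2) p q s t) +
        2 * (K₂ * K₃) * ((t - s) ^ (2 * r + 2) * M) := by ring
    _ ≤ _ := by linarith

/-- `L²` error of the interpolant. -/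
lemma interp_L2_error (hr : 1 ≤ r) : ∃ K : ℝ, 0 ≤ K ∧
    ∀ p q s t : ℝ, p < q → s < t → ∀ u : ℝ × ℝ → ℝ, ContDiff ℝ (r + 2 : ℕ) u →
    rectInt (fun z => (u z - interp r p q s t u z) ^ 2) p q s t ≤
      K * ((q - p) ^ (2 * r + 2) * rectInt (fun z => (pdx^[r + 1] u z) ^ 2) p q s t +
        (t - s) ^ (2 * r + 2) * rectInt (fun z => (pdy^[r + 1] u z) ^ 2) p q s t +
        (q - p) ^ 2 * (t - s) ^ (2 * r + 2) *
          rectInt (fun z => (pdx (pdy^[r + 1] u) z) ^ 2) p q s t) := by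
  obtain ⟨K₁, hK₁, h₁⟩ := interp_error hr
  obtain ⟨K₂, hK₂, h₂⟩ := interp_error_snd hr
  obtain ⟨K₃, hK₃, h₃⟩ := mixed_error hr
  refine ⟨3 * K₁ + 3 * K₂ + 3 * (K₁ * K₃), by positivity, fun p q s t hpq hst u hu => ?_⟩
  have hu1 : ContDiff ℝ 1 u := contDiff_one_of hu
  have hu2 : ContDiff ℝ (r + 1 : ℕ) u := hu.of_le (by norm_cast; omega)
  have hI := contDiff_one_of_mem (interp_mem hr p q s t u)
  have hIc : Continuous (interp r p q s t u) := hI.continuous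
  have huc : Continuous u := hu1.continuous
  have hcx : Continuous (pdx^[r + 1] u) := continuous_iterate_pdx hu2
  have hcy : Continuous (pdy^[r + 1] u) := continuous_iterate_pdy hu2
  have hqp : 0 < q - p := by linarith
  have hts : 0 < t - s := by linarith
  set M := rectInt (fun z => (pdx (pdy^[r + 1] u) z) ^ 2) p q s t with hM
  have hM0 : 0 ≤ M := rectInt_nonneg hpq.le hst.le fun z => sq_nonneg _
  have hX0 : 0 ≤ rectInt (fun z => (pdx^[r + 1] u z) ^ 2) p q s t :=
    rectInt_nonneg hpq.le hst.le fun z => sq_nonneg _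
  have hY0 : 0 ≤ rectInt (fun z => (pdy^[r + 1] u z) ^ 2) p q s t :=
    rectInt_nonneg hpq.le hst.le fun z => sq_nonneg _
  have hpt : ∀ x ∈ Set.Icc p q, ∀ y ∈ Set.Icc s t,
      (u (x, y) - interp r p q s t u (x, y)) ^ 2 ≤
      3 * K₁ * (q - p) ^ (2 * r + 1) * (∫ x in p..q, (pdx^[r + 1] u (x, y)) ^ 2) +
        3 * K₂ * (t - s) ^ (2 * r + 1) * (∫ y in s..t, (pdy^[r + 1] u (x, y)) ^ 2) +
        3 * (K₁ * K₃) * (q - p) * (t - s) ^ (2 * r + 1) * M := by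
    intro x hx y hy
    set f : ℝ → ℝ := fun x => u (x, y) - ∑ b ∈ Finset.range (r + 2),
          u (x, nd r s t b) * (bp r s t b).eval y with hf
    have e : u (x, y) - interp r p q s t u (x, y) =
        (u (x, y) - ∑ a ∈ Finset.range (r + 2), u (nd r p q a, y) * (bp r p q a).eval x) + f x -
        (f x - ∑ a ∈ Finset.range (r + 2), f (nd r p q a) * (bp r p q a).eval x) := by
      have e1 : ∑ a ∈ Finset.range (r + 2), f (nd r p q a) * (bp r p q a).eval x =
          ∑ a ∈ Finset.range (r + 2), u (nd r p q a, y) * (bp r p q a).eval x -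
          interp r p q s t u (x, y) := by
        simp only [hf, interp, sub_mul, Finset.sum_sub_distrib, Finset.sum_mul]
        congr 1
        exact Finset.sum_congr rfl fun a _ => Finset.sum_congr rfl fun b _ => by ring
      rw [e1]
      ring
    have b₁ := h₁ r le_rfl p q hpq (fun n x => pdx^[n] u (x, y))
      (fun n hn x => hasDerivAt_iterate_pdx hu2 hn x y) (hcx.comp (by fun_prop)) x hx
    have b₂ := h₂ s t hst u hu2 x y hy
    have b₃ := h₁ 0 (Nat.zero_le r) p q hpq
      (fun n x => if n = 0 then f x else pdx u (x, y) - ∑ b ∈ Finset.range (r + 2),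
        pdx u (x, nd r s t b) * (bp r s t b).eval y)
      (fun n hn x => by
        obtain rfl : n = 0 := by omega
        simpa using hasDerivAt_error (r := r) hu1 s t x y)
      (by simpa using continuous_error (continuous_pdx hu1) s t y) x hx
    have b₄ := h₃ p q s t hpq.le hst u hu y hy
    simp only [Function.iterate_zero, id] at b₁
    simp only [mul_zero, zero_add, pow_one, one_ne_zero, if_true, if_false] at b₃
    rw [e]
    set A := u (x, y) - ∑ a ∈ Finset.range (r + 2), u (nd r p q a, y) * (bp r p q a).eval x
    set B := f x
    set D := B - ∑ a ∈ Finset.range (r + 2), f (nd r p q a) * (bp r p q a).eval x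
    calc (A + B - D) ^ 2 ≤ 3 * A ^ 2 + 3 * B ^ 2 + 3 * D ^ 2 := by
          nlinarith [sq_nonneg (A - B), sq_nonneg (A + D), sq_nonneg (B + D)]
      _ ≤ 3 * (K₁ * (q - p) ^ (2 * r + 1) * ∫ x in p..q, (pdx^[r + 1] u (x, y)) ^ 2) +
          3 * (K₂ * (t - s) ^ (2 * r + 1) * ∫ y in s..t, (pdy^[r + 1] u (x, y)) ^ 2) +
          3 * (K₁ * (q - p) * (K₃ * (t - s) ^ (2 * r + 1) * M)) := by
          have h5 : 0 ≤ K₁ * (q - p) := by positivity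
          have := b₃.trans (mul_le_mul_of_nonneg_left b₄ h5)
          linarith
      _ = _ := by ring
  have hmono := rectInt_mono hpq.le hst.le (F := fun z => (u z - interp r p q s t u z) ^ 2)
    (H := fun z => 3 * K₁ * (q - p) ^ (2 * r + 1) *
        (∫ x in p..q, (pdx^[r + 1] u (x, z.2)) ^ 2) +
        3 * K₂ * (t - s) ^ (2 * r + 1) * (∫ y in s..t, (pdy^[r + 1] u (z.1, y)) ^ 2) +
        3 * (K₁ * K₃) * (q - p) * (t - s) ^ (2 * r + 1) * M)
    (by fun_prop) (by fun_prop) hpt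
  rw [rectInt_add (by fun_prop) (by fun_prop), rectInt_add (by fun_prop) (by fun_prop),
    rectInt_const_mul, rectInt_const_mul] at hmono
  have hsw : (∫ y in s..t, ∫ x in p..q, (pdx^[r + 1] u (x, y)) ^ 2) =
      rectInt (fun z => (pdx^[r + 1] u z) ^ 2) p q s t :=
    rectInt_swap (F := fun z => (pdx^[r + 1] u z) ^ 2) (by fun_prop) p q s t
  have e1 : rectInt (fun z => ∫ x in p..q, (pdx^[r + 1] u (x, z.2)) ^ 2) p q s t =
      (q - p) * rectInt (fun z => (pdx^[r + 1] u z) ^ 2) p q s t := by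
    rw [← hsw]
    simp [rectInt]
  have e2 : rectInt (fun z => ∫ y in s..t, (pdy^[r + 1] u (z.1, y)) ^ 2) p q s t =
      (t - s) * rectInt (fun z => (pdy^[r + 1] u z) ^ 2) p q s t := by
    simp [rectInt]
  have e3 : ∀ c : ℝ, rectInt (fun _ => c) p q s t = (q - p) * (t - s) * c := by
    intro c
    simp only [rectInt, intervalIntegral.integral_const, smul_eq_mul]
    ring
  rw [e1, e2, e3] at hmono
  refine hmono.trans ?_
  set X := rectInt (fun z => (pdx^[r + 1] u z) ^ 2) p q s t
  set Y := rectInt (fun z => (pdy^[r + 1] u z) ^ 2) p q s t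
  have n1 : 0 ≤ (q - p) ^ (2 * r + 2) * X := by positivity
  have n2 : 0 ≤ (t - s) ^ (2 * r + 2) * Y := by positivity
  have n3 : 0 ≤ (q - p) ^ 2 * (t - s) ^ (2 * r + 2) * M := by positivity
  have n4 : 0 ≤ K₁ * K₃ := by positivity
  calc _ = 3 * K₁ * ((q - p) ^ (2 * r + 2) * X) + 3 * K₂ * ((t - s) ^ (2 * r + 2) * Y) +
        3 * (K₁ * K₃) * ((q - p) ^ 2 * (t - s) ^ (2 * r + 2) * M) := by ring
    _ ≤ 3 * K₁ * ((q - p) ^ (2 * r + 2) * X) + 3 * K₂ * ((t - s) ^ (2 * r + 2) * Y) +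
        3 * (K₁ * K₃) * ((q - p) ^ 2 * (t - s) ^ (2 * r + 2) * M) +
        (3 * K₁ * ((t - s) ^ (2 * r + 2) * Y) +
          3 * K₁ * ((q - p) ^ 2 * (t - s) ^ (2 * r + 2) * M) +
         (3 * K₂ * ((q - p) ^ (2 * r + 2) * X) +
          3 * K₂ * ((q - p) ^ 2 * (t - s) ^ (2 * r + 2) * M)) +
         (3 * (K₁ * K₃) * ((q - p) ^ (2 * r + 2) * X) +
          3 * (K₁ * K₃) * ((t - s) ^ (2 * r + 2) * Y))) :=
        le_add_of_nonneg_right (by positivity)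
    _ = _ := by ring

/-- The contribution of the `x`-fluxes on the rectangle `[p,q] × [s,t]` to the bilinear form. -/
noncomputable def fluxForm (r : ℕ) (G : ℕ → ℝ) (p q s t : ℝ) (v e : ℝ × ℝ → ℝ) : ℝ :=
  ∑ k ∈ Finset.Icc 1 r, (q - p) / 2 * wt r G k *
    bform r G s t (fun y => pdx v (aff p q (G k), y)) (fun y => pdy (pdx v) (aff p q (G k), y))
      (fun y => pdx e (aff p q (G k), y))

lemma fluxForm_le (hG : IsGaussPoints r G) (hr : 1 ≤ r) : ∃ K : ℝ, 0 ≤ K ∧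
    ∀ p q s t : ℝ, p < q → s < t → ∀ v ∈ biP r r, ∀ w : ℝ × ℝ → ℝ, ContDiff ℝ 1 w →
    fluxForm r G p q s t v (fun z => w z - v z) ≤
      -(1 / 2) * rectInt (fun z => pdx v z ^ 2) p q s t +
        K * ∑ k ∈ Finset.Icc 1 r, (q - p) / 2 * wt r G k *
          ∫ y in s..t, pdx w (aff p q (G k), y) ^ 2 := by
  obtain ⟨K, hK, h⟩ := bform_le hG hr
  refine ⟨K, hK, fun p q s t hpq hst v hv w hw => ?_⟩
  have hv1 := contDiff_one_of_mem hv
  have hcv : Continuous (pdx v) := continuous_pdx hv1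
  have hcw : Continuous (pdx w) := continuous_pdx hw
  have hterm : ∀ k ∈ Finset.Icc 1 r,
      (q - p) / 2 * wt r G k * bform r G s t (fun y => pdx v (aff p q (G k), y))
        (fun y => pdy (pdx v) (aff p q (G k), y))
        (fun y => pdx (fun z => w z - v z) (aff p q (G k), y)) ≤
      -(1 / 2) * ((q - p) / 2 * wt r G k * ∫ y in s..t, pdx v (aff p q (G k), y) ^ 2) +
        K * ((q - p) / 2 * wt r G k * ∫ y in s..t, pdx w (aff p q (G k), y) ^ 2) := by
    intro k hk
    have hw0 : 0 ≤ (q - p) / 2 * wt r G k :=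
      mul_nonneg (by linarith) (wt_nonneg hG hk)
    obtain ⟨Q, hQ, hQ1, hQ2⟩ := exists_slice_snd (pdx_mem hv) (aff p q (G k))
    have := h s t hst Q hQ (fun y => pdx w (aff p q (G k), y)) (by fun_prop)
    simp only [← hQ1, ← hQ2] at this
    simp only [pdx_sub hw hv1]
    have := mul_le_mul_of_nonneg_left this hw0
    linarith
  have hexact : ∑ k ∈ Finset.Icc 1 r, ((q - p) / 2 * wt r G k *
      ∫ y in s..t, pdx v (aff p q (G k), y) ^ 2) = rectInt (fun z => pdx v z ^ 2) p q s t := by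
    rw [← rectInt_swap (by fun_prop), rectInt]
    simp only [← intervalIntegral.integral_const_mul]
    rw [← intervalIntegral.integral_finsetSum
      fun k _ => Continuous.intervalIntegrable (by fun_prop) _ _]
    refine intervalIntegral.integral_congr fun y _ => ?_
    obtain ⟨Q, hQ, hQ1, -⟩ := exists_slice_fst (pdx_mem hv) y
    have hdeg : (Q ^ 2).natDegree < 2 * r := by
      have := natDegree_pow_le (p := Q) (n := 2)
      omega
    have := gauss_exact hG p q (Q ^ 2) hdeg
    simp only [eval_pow, ← hQ1] at this
    exact this
  calc _ ≤ _ := Finset.sum_le_sum hterm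
    _ = _ := by rw [Finset.sum_add_distrib, ← Finset.mul_sum, ← Finset.mul_sum, hexact]

lemma fluxForm_error_le (hG : IsGaussPoints r G) (hr : 1 ≤ r) : ∃ K : ℝ, 0 ≤ K ∧
    ∀ p q s t : ℝ, p < q → s < t → ∀ v ∈ biP r r,
    ∀ u : ℝ × ℝ → ℝ, ContDiff ℝ (r + 2 : ℕ) u →
    fluxForm r G p q s t v (fun z => u z - interp r p q s t u z - v z) ≤
      -(1 / 2) * rectInt (fun z => pdx v z ^ 2) p q s t +
      K * ((q - p) ^ (2 * r + 2) * rectInt (fun z => (pdx^[r + 2] u z) ^ 2) p q s t +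
        (t - s) ^ (2 * r + 2) * rectInt (fun z => (pdx (pdy^[r + 1] u) z) ^ 2) p q s t) := by
  obtain ⟨K₁, hK₁, h₁⟩ := fluxForm_le hG hr
  obtain ⟨K₂, hK₂, h₂⟩ := flux_error hG hr
  have hW : 0 ≤ ∑ k ∈ Finset.Icc 1 r, wt r G k / 2 :=
    Finset.sum_nonneg fun k hk => div_nonneg (wt_nonneg hG hk) (by norm_num)
  refine ⟨K₁ * ((∑ k ∈ Finset.Icc 1 r, wt r G k / 2) * K₂), by positivity,
    fun p q s t hpq hst v hv u hu => ?_⟩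
  have hw : ContDiff ℝ 1 (fun z => u z - interp r p q s t u z) :=
    (contDiff_one_of hu).sub (contDiff_one_of_mem (interp_mem hr p q s t u))
  refine (h₁ p q s t hpq hst v hv _ hw).trans ?_
  rw [mul_assoc K₁, mul_assoc _ K₂, Finset.sum_mul]
  refine add_le_add_right (mul_le_mul_of_nonneg_left (Finset.sum_le_sum fun k hk => ?_) hK₁) _
  have := mul_le_mul_of_nonneg_left (h₂ p q s t hpq hst u hu k hk)
    (div_nonneg (wt_nonneg hG hk) (by norm_num : (0 : ℝ) ≤ 2))
  linarith

lemma pdy_iterate_pdx {f : ℝ × ℝ → ℝ} (n : ℕ) (hf : ContDiff ℝ (n + 1 : ℕ) f) :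
    pdx^[n] (pdy f) = pdy (pdx^[n] f) := by
  have h := iterate_pdy_pdx n (contDiff_swap hf)
  rw [pdx_swap, iterate_pdy_swap, iterate_pdy_swap, pdx_swap] at h
  exact Prod.swap_surjective.injective_comp_right h

/-- Local stability and consistency on one rectangle. -/
lemma cellForm_le (hG : IsGaussPoints r G) (hr : 1 ≤ r) : ∃ K : ℝ, 0 ≤ K ∧
    ∀ p q s t : ℝ, p < q → s < t → ∀ h : ℝ, q - p ≤ h → t - s ≤ h → ∀ v ∈ biP r r,
    ∀ u : ℝ × ℝ → ℝ, ContDiff ℝ (r + 2 : ℕ) u →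
    fluxForm r G p q s t v (fun z => u z - interp r p q s t u z - v z) +
      fluxForm r G s t p q (v ∘ Prod.swap)
        ((fun z => u z - interp r p q s t u z - v z) ∘ Prod.swap) ≤
      -(1 / 2) * (rectInt (fun z => pdx v z ^ 2) p q s t +
        rectInt (fun z => pdy v z ^ 2) p q s t) +
      K * h ^ (2 * r + 2) * (rectInt (fun z => (pdx^[r + 2] u z) ^ 2) p q s t +
        rectInt (fun z => (pdx (pdy^[r + 1] u) z) ^ 2) p q s t +
        rectInt (fun z => (pdy^[r + 2] u z) ^ 2) p q s t +
        rectInt (fun z => (pdx^[r + 1] (pdy u) z) ^ 2) p q s t) := by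
  obtain ⟨K, hK, hle⟩ := fluxForm_error_le hG hr
  refine ⟨K, hK, fun p q s t hpq hst h hqp hts v hv u hu => ?_⟩
  have b₁ := hle p q s t hpq hst v hv u hu
  have b₂ := hle s t p q hst hpq _ (swap_mem hv) _ (contDiff_swap hu)
  have hcv := continuous_pdy (contDiff_one_of_mem hv)
  have c₁ : Continuous (pdy^[r + 2] u) := continuous_iterate_pdy hu
  have c₂ : Continuous (pdy (pdx^[r + 1] u)) := continuous_pdy (by
    exact_mod_cast contDiff_iterate_pdx (n := 1) (r + 1)
      (by rwa [show 1 + (r + 1) = r + 2 by ring]))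
  have sw : ∀ F : ℝ × ℝ → ℝ, Continuous F →
      rectInt (fun z => ((F ∘ Prod.swap) z) ^ 2) s t p q = rectInt (fun z => F z ^ 2) p q s t :=
    fun F hF => rectInt_swap (F := fun z => F z ^ 2) (by fun_prop) p q s t
  rw [interp_swap, iterate_pdx_swap, iterate_pdy_swap, pdx_swap, pdx_swap, sw _ hcv, sw _ c₁,
    sw _ c₂] at b₂
  rw [pdy_iterate_pdx (r + 1) hu]
  have n : ∀ F : ℝ × ℝ → ℝ, 0 ≤ rectInt (fun z => F z ^ 2) p q s t :=
    fun F => rectInt_nonneg hpq.le hst.le fun z => sq_nonneg _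
  have n₁ := n (pdx^[r + 2] u)
  have n₂ := n (pdx (pdy^[r + 1] u))
  have n₃ := n (pdy^[r + 2] u)
  have n₄ := n (pdy (pdx^[r + 1] u))
  have e₁ : (q - p) ^ (2 * r + 2) ≤ h ^ (2 * r + 2) := by gcongr
  have e₂ : (t - s) ^ (2 * r + 2) ≤ h ^ (2 * r + 2) := by gcongr
  refine (add_le_add b₁ b₂).trans ?_
  have := mul_le_mul_of_nonneg_left (add_le_add (add_le_add (mul_le_mul_of_nonneg_right e₁ n₁)
    (mul_le_mul_of_nonneg_right e₂ n₂)) (add_le_add (mul_le_mul_of_nonneg_right e₂ n₃)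
    (mul_le_mul_of_nonneg_right e₁ n₄))) hK
  linarith

end

/-! ### Regrouping dual volumes by cells -/

/-- Dual Gauss points along one coordinate direction. -/
noncomputable def dualPt (r : ℕ) (G : ℕ → ℝ) (m : ℕ) (x : ℕ → ℝ) (i k : ℕ) : ℝ :=
  if k = r + 1 then
    (if i = m then x m else (x (i + 1) + x i + (x (i + 1) - x i) * G 1) / 2)
  else (x i + x (i - 1) + (x i - x (i - 1)) * G k) / 2

section
variable {r : ℕ} {G : ℕ → ℝ} {m : ℕ} {x : ℕ → ℝ}

lemma dualPt_mid {i k : ℕ} (hk : k ∈ Finset.Icc 1 r) :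
    dualPt r G m x i k = gam r G (x (i - 1)) (x i) k := by
  obtain ⟨h1, h2⟩ := Finset.mem_Icc.mp hk
  rw [gam_mid r G _ _ h1 h2, dualPt, if_neg (by omega), aff]
  ring

lemma pred_lt (hx : ∀ i < m, x i < x (i + 1)) {i : ℕ} (hi : i ∈ Finset.Icc 1 m) :
    x (i - 1) < x i := by
  obtain ⟨h1, h2⟩ := Finset.mem_Icc.mp hi
  have := hx (i - 1) (by omega)
  rwa [Nat.sub_add_cancel h1] at this

lemma dualPt_last (hr : 1 ≤ r) {i : ℕ} (hi : i ≠ m) :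
    dualPt r G m x i (r + 1) = gam r G (x i) (x (i + 1)) 1 := by
  rw [gam_mid r G _ _ le_rfl hr, dualPt, if_pos rfl, if_neg hi, aff]
  ring

lemma le_dualPt_last (hG : IsGaussPoints r G) (hr : 1 ≤ r) (hx : ∀ i < m, x i < x (i + 1))
    {i : ℕ} (hi : i ∈ Finset.Icc 1 m) : x i ≤ dualPt r G m x i (r + 1) := by
  by_cases h : i = m
  · rw [dualPt, if_pos rfl, if_pos h, h]
  · rw [dualPt_last hr h]
    exact (gam_mem hG (hx i (lt_of_le_of_ne (Finset.mem_Icc.mp hi).2 h)) (by omega)).1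

lemma min_dualPt (hG : IsGaussPoints r G) (hr : 1 ≤ r) (hx : ∀ i < m, x i < x (i + 1))
    {i k : ℕ} (hi : i ∈ Finset.Icc 1 m) (hk : k ∈ Finset.Icc 1 r) :
    min (dualPt r G m x i (k + 1)) (x i) = gam r G (x (i - 1)) (x i) (k + 1) := by
  obtain ⟨h1, h2⟩ := Finset.mem_Icc.mp hk
  rcases eq_or_lt_of_le h2 with rfl | h2
  · rw [gam_last, min_eq_right (le_dualPt_last hG hr hx hi)]
  · rw [dualPt_mid (Finset.mem_Icc.mpr ⟨by omega, h2⟩), min_eq_left]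
    exact (gam_mem hG (pred_lt hx hi) (by omega)).2

lemma max_dualPt (hG : IsGaussPoints r G) (hx : ∀ i < m, x i < x (i + 1))
    {i k : ℕ} (hi : i ∈ Finset.Icc 1 m) (hk : k ∈ Finset.Icc 1 r) (hkr : k ≠ r) :
    max (dualPt r G m x i (k + 1)) (x i) = x i := by
  obtain ⟨h1, h2⟩ := Finset.mem_Icc.mp hk
  rw [dualPt_mid (Finset.mem_Icc.mpr ⟨by omega, by omega⟩), max_eq_right]
  exact (gam_mem hG (pred_lt hx hi) (by omega)).2

lemma max_dualPt_last (hG : IsGaussPoints r G) (hr : 1 ≤ r) (hx : ∀ i < m, x i < x (i + 1))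
    {i : ℕ} (hi : i ∈ Finset.Icc 1 m) (him : i ≠ m) :
    max (dualPt r G m x i (r + 1)) (x i) = gam r G (x i) (x (i + 1)) 1 := by
  rw [max_eq_left (le_dualPt_last hG hr hx hi), dualPt_last hr him]

lemma sum_Icc_shift (m : ℕ) (f g : ℕ → ℝ) (hf : f m = 0) (hg : g 1 = 0)
    (h : ∀ i, 1 ≤ i → i < m → f i = g (i + 1)) :
    ∑ i ∈ Finset.Icc 1 m, f i = ∑ i ∈ Finset.Icc 1 m, g i := by
  cases m with
  | zero => simp
  | succ m =>
    rw [Finset.sum_Icc_succ_top (by omega), hf, add_zero,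
      ← Finset.add_sum_Ioc_eq_sum_Icc (f := g) (Nat.succ_le_succ (Nat.zero_le m)), hg, zero_add]
    refine Finset.sum_bij (fun i _ => i + 1) (fun i hi => ?_) (fun _ _ _ _ h => by omega)
      (fun j hj => ?_) fun i hi => ?_
    · simp only [Finset.mem_Icc, Finset.mem_Ioc] at *; omega
    · simp only [Finset.mem_Ioc] at hj
      exact ⟨j - 1, Finset.mem_Icc.mpr (by omega), by omega⟩
    · simp only [Finset.mem_Icc] at hi
      exact h i hi.1 (by omega)

/-- Sums over dual intervals as sums over cells. -/
lemma regroup (hG : IsGaussPoints r G) (hr : 1 ≤ r) (hx : ∀ i < m, x i < x (i + 1))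
    (W : ℕ → ℕ → ℝ) (J : ℕ → ℝ → ℝ → ℝ) (hJ : ∀ i a, J i a a = 0)
    (h0 : W 1 0 = 0) (hstep : ∀ i, 1 ≤ i → i < m → W (i + 1) 0 = W i r) (hlast : W m r = 0) :
    ∑ i ∈ Finset.Icc 1 m, ∑ k ∈ Finset.Icc 1 r, W i k *
      (J i (dualPt r G m x i k) (min (dualPt r G m x i (k + 1)) (x i)) +
        J (i + 1) (x i) (max (dualPt r G m x i (k + 1)) (x i))) =
    ∑ i ∈ Finset.Icc 1 m, ∑ k ∈ Finset.range (r + 1), W i k *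
      J i (gam r G (x (i - 1)) (x i) k) (gam r G (x (i - 1)) (x i) (k + 1)) := by
  have h1 : ∀ i ∈ Finset.Icc 1 m, ∑ k ∈ Finset.Icc 1 r, W i k *
      (J i (dualPt r G m x i k) (min (dualPt r G m x i (k + 1)) (x i)) +
        J (i + 1) (x i) (max (dualPt r G m x i (k + 1)) (x i))) =
      (∑ k ∈ Finset.Icc 1 r, W i k *
        J i (gam r G (x (i - 1)) (x i) k) (gam r G (x (i - 1)) (x i) (k + 1))) +
      W i r * J (i + 1) (x i) (max (dualPt r G m x i (r + 1)) (x i)) := by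
    intro i hi
    simp only [mul_add, Finset.sum_add_distrib]
    congr 1
    · refine Finset.sum_congr rfl fun k hk => ?_
      rw [dualPt_mid hk, min_dualPt hG hr hx hi hk]
    · refine Finset.sum_eq_single_of_mem r (by simp [hr]) fun k hk hkr => ?_
      rw [max_dualPt hG hx hi hk hkr, hJ, mul_zero]
  rw [Finset.sum_congr rfl h1, Finset.sum_add_distrib]
  have h2 : ∀ i ∈ Finset.Icc 1 m, ∑ k ∈ Finset.range (r + 1), W i k *
      J i (gam r G (x (i - 1)) (x i) k) (gam r G (x (i - 1)) (x i) (k + 1)) =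
      (∑ k ∈ Finset.Icc 1 r, W i k *
        J i (gam r G (x (i - 1)) (x i) k) (gam r G (x (i - 1)) (x i) (k + 1))) +
      W i 0 * J i (x (i - 1)) (gam r G (x (i - 1)) (x i) 1) := by
    intro i _
    rw [Finset.range_eq_Ico, Finset.sum_eq_sum_Ico_succ_bot (by omega), add_comm, gam_zero]
    rfl
  rw [Finset.sum_congr rfl h2, Finset.sum_add_distrib]
  congr 1
  refine sum_Icc_shift m _ _ (by rw [hlast, zero_mul]) (by rw [h0, zero_mul]) fun i hi him => ?_
  rw [max_dualPt_last hG hr hx (Finset.mem_Icc.mpr ⟨hi, him.le⟩) him.ne, hstep i hi him,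
    Nat.add_sub_cancel]

end

/-- Extended coefficients of a test function on an `m × n` mesh. -/
structure Adm (r m n : ℕ) (V : ℕ → ℕ → ℕ → ℕ → ℝ) : Prop where
  x_zero : ∀ j l, V 1 0 j l = 0
  x_step : ∀ i, 1 ≤ i → ∀ j l, V (i + 1) 0 j l = V i r j l
  x_last : ∀ j ∈ Finset.Icc 1 n, ∀ l ≤ r, V m r j l = 0
  y_zero : ∀ i k, V i k 1 0 = 0
  y_step : ∀ j, 1 ≤ j → ∀ i k, V i k (j + 1) 0 = V i k j r
  y_last : ∀ i ∈ Finset.Icc 1 m, ∀ k ≤ r, V i k n r = 0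

lemma Adm.swap {r m n : ℕ} {V : ℕ → ℕ → ℕ → ℕ → ℝ} (h : Adm r m n V) :
    Adm r n m (fun j l i k => V i k j l) where
  x_zero := fun i k => h.y_zero i k
  x_step := fun j hj i k => h.y_step j hj i k
  x_last := h.y_last
  y_zero := fun j l => h.x_zero j l
  y_step := fun i hi j l => h.x_step i hi j l
  y_last := h.x_last

lemma adm_wE {a b c d : ℝ} {r : ℕ} (hr : 1 ≤ r) {P : RectPartition a b c d}
    {w : ℕ → ℕ → ℕ → ℕ → ℝ} (hw : IsTestFun r P w) : Adm r P.m P.n (wE r w) where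
  x_zero := fun j l => by simp [wE]
  x_step := fun i hi j l => by
    have h1 : i ≠ 0 := by omega
    have h2 : r ≠ 0 := by omega
    simp [wE, h1, h2]
  x_last := fun j hj l hl => by
    have h2 : r ≠ 0 := by omega
    rw [Finset.mem_Icc] at hj
    by_cases hl0 : l = 0
    · by_cases hj1 : j = 1
      · simp [wE, hl0, hj1]
      · simp only [wE, h2, hl0, hj1, false_and, and_false, or_false, if_false, if_true]
        exact hw.1 _ (Finset.mem_Icc.mpr (by omega)) _ (by simp [hr])
    · simp only [wE, h2, hl0, false_and, or_false, if_false]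
      exact hw.1 _ (Finset.mem_Icc.mpr hj) _ (Finset.mem_Icc.mpr (by omega))
  y_zero := fun i k => by simp [wE]
  y_step := fun j hj i k => by
    have h1 : j ≠ 0 := by omega
    have h2 : r ≠ 0 := by omega
    simp [wE, h1, h2]
  y_last := fun i hi k hk => by
    have h2 : r ≠ 0 := by omega
    rw [Finset.mem_Icc] at hi
    by_cases hk0 : k = 0
    · by_cases hi1 : i = 1
      · simp [wE, hk0, hi1]
      · simp only [wE, h2, hk0, hi1, false_and, and_false, or_false, if_false, if_true]
        exact hw.2 _ (Finset.mem_Icc.mpr (by omega)) _ (by simp [hr])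
    · simp only [wE, h2, hk0, false_and, or_false, if_false]
      exact hw.2 _ (Finset.mem_Icc.mpr hi) _ (Finset.mem_Icc.mpr (by omega))

/-- The `x`-flux sums of a cellwise function `D` against coefficients `V` on cell `(i,j)`. -/
noncomputable def fluxSum (r : ℕ) (G : ℕ → ℝ) (x y : ℕ → ℝ) (V : ℕ → ℕ → ℕ → ℕ → ℝ)
    (D : ℝ × ℝ → ℝ) (i j : ℕ) : ℝ :=
  ∑ k ∈ Finset.Icc 1 r, ∑ l ∈ Finset.range (r + 1), (V i k j l - V i (k - 1) j l) *
    ∫ t in (gam r G (y (j - 1)) (y j) l)..(gam r G (y (j - 1)) (y j) (l + 1)),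
      D (aff (x (i - 1)) (x i) (G k), t)

section
variable {r m n : ℕ} {G : ℕ → ℝ} {x y : ℕ → ℝ} {V : ℕ → ℕ → ℕ → ℕ → ℝ}

/-- The `x`-part of the bilinear form as a sum over cells. -/
lemma regroup_flux (hG : IsGaussPoints r G) (hr : 1 ≤ r) (hx : ∀ i < m, x i < x (i + 1))
    (hy : ∀ j < n, y j < y (j + 1)) (hV : Adm r m n V) (D : ℕ → ℕ → ℝ × ℝ → ℝ)
    (α : ℝ × ℝ → ℝ) (A : ℕ → ℕ → ℝ)
    (hA : ∀ i ∈ Finset.Icc 1 m, ∀ j ∈ Finset.Icc 1 n, ∀ s ∈ Set.Ioo (x (i - 1)) (x i),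
      ∀ t ∈ Set.Ioo (y (j - 1)) (y j), α (s, t) = A i j) :
    ∑ i ∈ Finset.Icc 1 m, ∑ k ∈ Finset.Icc 1 r, ∑ j ∈ Finset.Icc 1 n, ∑ l ∈ Finset.Icc 1 r,
      (V i k j l - V i (k - 1) j l) *
      ((∫ t in (dualPt r G n y j l)..(min (dualPt r G n y j (l + 1)) (y j)),
          α (dualPt r G m x i k, t) * D i j (dualPt r G m x i k, t)) +
       ∫ t in (y j)..(max (dualPt r G n y j (l + 1)) (y j)),
          α (dualPt r G m x i k, t) * D i (j + 1) (dualPt r G m x i k, t)) =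
    ∑ i ∈ Finset.Icc 1 m, ∑ j ∈ Finset.Icc 1 n, A i j * fluxSum r G x y V (D i j) i j := by
  refine Finset.sum_congr rfl fun i hi => ?_
  have h1 : ∀ k ∈ Finset.Icc 1 r, ∑ j ∈ Finset.Icc 1 n, ∑ l ∈ Finset.Icc 1 r,
      (V i k j l - V i (k - 1) j l) *
      ((∫ t in (dualPt r G n y j l)..(min (dualPt r G n y j (l + 1)) (y j)),
          α (dualPt r G m x i k, t) * D i j (dualPt r G m x i k, t)) +
       ∫ t in (y j)..(max (dualPt r G n y j (l + 1)) (y j)),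
          α (dualPt r G m x i k, t) * D i (j + 1) (dualPt r G m x i k, t)) =
      ∑ j ∈ Finset.Icc 1 n, A i j * ∑ l ∈ Finset.range (r + 1),
        (V i k j l - V i (k - 1) j l) *
        ∫ t in (gam r G (y (j - 1)) (y j) l)..(gam r G (y (j - 1)) (y j) (l + 1)),
          D i j (aff (x (i - 1)) (x i) (G k), t) := by
    intro k hk
    have hk' := Finset.mem_Icc.mp hk
    rw [regroup hG hr hy (fun j l => V i k j l - V i (k - 1) j l)
      (fun j s t => ∫ t in s..t, α (dualPt r G m x i k, t) * D i j (dualPt r G m x i k, t))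
      (by simp) (by simp [hV.y_zero]) (fun j hj _ => by simp [hV.y_step j hj])
      (by simp [hV.y_last i hi k hk'.2, hV.y_last i hi (k - 1) (by omega)])]
    refine Finset.sum_congr rfl fun j hj => ?_
    rw [Finset.mul_sum]
    refine Finset.sum_congr rfl fun l hl => ?_
    have hl' : l ≤ r := Nat.lt_succ_iff.mp (Finset.mem_range.mp hl)
    have hyj := pred_lt hy hj
    rw [dualPt_mid hk, gam_mid r G _ _ hk'.1 hk'.2, mul_left_comm]
    congr 1
    rw [← intervalIntegral.integral_const_mul]
    apply intervalIntegral.integral_congr_Ioo_of_le (gam_lt hG hyj hl').le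
    intro t ht
    have hα := hA i hi j hj (aff (x (i - 1)) (x i) (G k))
      (aff_mem_Ioo (pred_lt hx hi) (hG.2 k hk'.1 hk'.2).1) t
      ⟨lt_of_le_of_lt (gam_mem hG hyj (by omega)).1 ht.1,
        lt_of_lt_of_le ht.2 (gam_mem hG hyj (by omega)).2⟩
    simp only [hα]
  rw [Finset.sum_congr rfl h1, Finset.sum_comm]
  refine Finset.sum_congr rfl fun j _ => ?_
  rw [← Finset.mul_sum, fluxSum]

/-- The right-hand side as a sum over cells. -/
lemma regroup_source (hG : IsGaussPoints r G) (hr : 1 ≤ r) (hx : ∀ i < m, x i < x (i + 1))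
    (hy : ∀ j < n, y j < y (j + 1)) (hV : Adm r m n V) (F : ℕ → ℕ → ℝ × ℝ → ℝ) :
    ∑ i ∈ Finset.Icc 1 m, ∑ k ∈ Finset.Icc 1 r, ∑ j ∈ Finset.Icc 1 n, ∑ l ∈ Finset.Icc 1 r,
      V i k j l *
      (rectInt (F i j) (dualPt r G m x i k) (min (dualPt r G m x i (k + 1)) (x i))
          (dualPt r G n y j l) (min (dualPt r G n y j (l + 1)) (y j)) +
        rectInt (F (i + 1) j) (x i) (max (dualPt r G m x i (k + 1)) (x i))
          (dualPt r G n y j l) (min (dualPt r G n y j (l + 1)) (y j)) +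
        rectInt (F i (j + 1)) (dualPt r G m x i k) (min (dualPt r G m x i (k + 1)) (x i))
          (y j) (max (dualPt r G n y j (l + 1)) (y j)) +
        rectInt (F (i + 1) (j + 1)) (x i) (max (dualPt r G m x i (k + 1)) (x i))
          (y j) (max (dualPt r G n y j (l + 1)) (y j))) =
    ∑ i ∈ Finset.Icc 1 m, ∑ j ∈ Finset.Icc 1 n, ∑ k ∈ Finset.range (r + 1),
      ∑ l ∈ Finset.range (r + 1), V i k j l *
        rectInt (F i j) (gam r G (x (i - 1)) (x i) k) (gam r G (x (i - 1)) (x i) (k + 1))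
          (gam r G (y (j - 1)) (y j) l) (gam r G (y (j - 1)) (y j) (l + 1)) := by
  set g : ℕ → ℕ → ℝ := fun j l => gam r G (y (j - 1)) (y j) l with hg
  have h1 : ∀ i ∈ Finset.Icc 1 m, ∀ k ∈ Finset.Icc 1 r,
      ∑ j ∈ Finset.Icc 1 n, ∑ l ∈ Finset.Icc 1 r, V i k j l *
      (rectInt (F i j) (dualPt r G m x i k) (min (dualPt r G m x i (k + 1)) (x i))
          (dualPt r G n y j l) (min (dualPt r G n y j (l + 1)) (y j)) +
        rectInt (F (i + 1) j) (x i) (max (dualPt r G m x i (k + 1)) (x i))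
          (dualPt r G n y j l) (min (dualPt r G n y j (l + 1)) (y j)) +
        rectInt (F i (j + 1)) (dualPt r G m x i k) (min (dualPt r G m x i (k + 1)) (x i))
          (y j) (max (dualPt r G n y j (l + 1)) (y j)) +
        rectInt (F (i + 1) (j + 1)) (x i) (max (dualPt r G m x i (k + 1)) (x i))
          (y j) (max (dualPt r G n y j (l + 1)) (y j))) =
      ∑ j ∈ Finset.Icc 1 n, ∑ l ∈ Finset.range (r + 1), V i k j l *
      (rectInt (F i j) (dualPt r G m x i k) (min (dualPt r G m x i (k + 1)) (x i))
          (g j l) (g j (l + 1)) +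
        rectInt (F (i + 1) j) (x i) (max (dualPt r G m x i (k + 1)) (x i))
          (g j l) (g j (l + 1))) := by
    intro i hi k hk
    have hk' := Finset.mem_Icc.mp hk
    rw [← regroup hG hr hy (fun j l => V i k j l)
      (fun j s t => rectInt (F i j) (dualPt r G m x i k) (min (dualPt r G m x i (k + 1)) (x i))
          s t + rectInt (F (i + 1) j) (x i) (max (dualPt r G m x i (k + 1)) (x i)) s t)
      (by simp [rectInt]) (hV.y_zero i k) (fun j hj _ => hV.y_step j hj i k)
      (hV.y_last i hi k hk'.2)]
    refine Finset.sum_congr rfl fun j _ => Finset.sum_congr rfl fun l _ => ?_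
    ring
  rw [Finset.sum_congr rfl fun i hi => Finset.sum_congr rfl (h1 i hi)]
  have h2 : ∀ (t : Finset ℕ) (f : ℕ → ℕ → ℕ → ℕ → ℝ),
      ∑ i ∈ Finset.Icc 1 m, ∑ k ∈ t, ∑ j ∈ Finset.Icc 1 n, ∑ l ∈ Finset.range (r + 1), f i k j l =
      ∑ j ∈ Finset.Icc 1 n, ∑ l ∈ Finset.range (r + 1), ∑ i ∈ Finset.Icc 1 m, ∑ k ∈ t,
        f i k j l := by
    intro t f
    simp only [Finset.sum_comm (s := t)]
    simp only [Finset.sum_comm (s := Finset.Icc 1 m)]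
  have h3 : ∀ f : ℕ → ℕ → ℕ → ℕ → ℝ,
      ∑ i ∈ Finset.Icc 1 m, ∑ j ∈ Finset.Icc 1 n, ∑ k ∈ Finset.range (r + 1),
        ∑ l ∈ Finset.range (r + 1), f i k j l =
      ∑ i ∈ Finset.Icc 1 m, ∑ k ∈ Finset.range (r + 1), ∑ j ∈ Finset.Icc 1 n,
        ∑ l ∈ Finset.range (r + 1), f i k j l :=
    fun f => Finset.sum_congr rfl fun i _ => Finset.sum_comm
  rw [h2, h3, h2]
  refine Finset.sum_congr rfl fun j hj => Finset.sum_congr rfl fun l hl => ?_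
  exact regroup hG hr hx (fun i k => V i k j l)
    (fun i s t => rectInt (F i j) s t (g j l) (g j (l + 1)))
    (by simp [rectInt]) (hV.x_zero j l) (fun i hi _ => hV.x_step i hi j l)
    (hV.x_last j hj l (Nat.lt_succ_iff.mp (Finset.mem_range.mp hl)))

end

/-! ### Consistency of the scheme -/

lemma rectInt_pdx {F : ℝ × ℝ → ℝ} (hF : ContDiff ℝ 1 F) (p q s t : ℝ) :
    rectInt (pdx F) p q s t = (∫ y in s..t, F (q, y)) - ∫ y in s..t, F (p, y) := by
  have hc := continuous_pdx hF
  have hF0 := hF.continuous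
  rw [← rectInt_swap hc, rectInt, ← intervalIntegral.integral_sub
    (Continuous.intervalIntegrable (by fun_prop) _ _)
    (Continuous.intervalIntegrable (by fun_prop) _ _)]
  refine intervalIntegral.integral_congr fun y _ => ?_
  exact intervalIntegral.integral_eq_sub_of_hasDerivAt (fun x _ => hasDerivAt_fst hF x y)
    (Continuous.intervalIntegrable (by fun_prop) _ _)

/-- A rectangular integral over the `(k,l)`-th Gauss subcell of cell `(i,j)`. -/
noncomputable def subInt (r : ℕ) (G x y : ℕ → ℝ) (F : ℝ × ℝ → ℝ) (i k j l : ℕ) : ℝ :=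
  rectInt F (gam r G (x (i - 1)) (x i) k) (gam r G (x (i - 1)) (x i) (k + 1))
    (gam r G (y (j - 1)) (y j) l) (gam r G (y (j - 1)) (y j) (l + 1))

section
variable {r m n : ℕ} {G : ℕ → ℝ} {x y : ℕ → ℝ} {V : ℕ → ℕ → ℕ → ℕ → ℝ}

lemma consistency_cell {D : ℝ × ℝ → ℝ} (hD : ContDiff ℝ 1 D) (i j : ℕ) :
    ∑ k ∈ Finset.range (r + 1), ∑ l ∈ Finset.range (r + 1),
      V i k j l * subInt r G x y (pdx D) i k j l =
    (∑ l ∈ Finset.range (r + 1), V i r j l *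
      ∫ t in (gam r G (y (j - 1)) (y j) l)..(gam r G (y (j - 1)) (y j) (l + 1)), D (x i, t)) -
    (∑ l ∈ Finset.range (r + 1), V i 0 j l *
      ∫ t in (gam r G (y (j - 1)) (y j) l)..(gam r G (y (j - 1)) (y j) (l + 1)), D (x (i - 1), t)) -
    fluxSum r G x y V D i j := by
  rw [fluxSum, Finset.sum_comm, Finset.sum_comm (s := Finset.Icc 1 r), ← Finset.sum_sub_distrib,
    ← Finset.sum_sub_distrib]
  refine Finset.sum_congr rfl fun l _ => ?_
  have := abel_sum r (fun k => V i k j l) (fun k =>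
    ∫ t in (gam r G (y (j - 1)) (y j) l)..(gam r G (y (j - 1)) (y j) (l + 1)),
      D (gam r G (x (i - 1)) (x i) k, t))
  simp only [gam_zero, gam_last] at this
  simp only [subInt, rectInt_pdx hD, this]
  congr 1
  refine Finset.sum_congr rfl fun k hk => ?_
  obtain ⟨h1, h2⟩ := Finset.mem_Icc.mp hk
  rw [gam_mid r G _ _ h1 h2]

/-- Integration by parts for the `x`-derivatives, using continuity of the `x`-fluxes. -/
lemma consistency_x (hG : IsGaussPoints r G) (hy : ∀ j < n, y j < y (j + 1)) (hV : Adm r m n V)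
    (D : ℕ → ℕ → ℝ × ℝ → ℝ) (A : ℕ → ℕ → ℝ)
    (hD : ∀ i ∈ Finset.Icc 1 m, ∀ j ∈ Finset.Icc 1 n, ContDiff ℝ 1 (D i j))
    (hA : ∀ i, 1 ≤ i → i < m → ∀ j ∈ Finset.Icc 1 n, ∀ t ∈ Set.Icc (y (j - 1)) (y j),
      A i j * D i j (x i, t) = A (i + 1) j * D (i + 1) j (x i, t)) :
    ∑ i ∈ Finset.Icc 1 m, ∑ j ∈ Finset.Icc 1 n, A i j * ∑ k ∈ Finset.range (r + 1),
      ∑ l ∈ Finset.range (r + 1), V i k j l * subInt r G x y (pdx (D i j)) i k j l =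
    -∑ i ∈ Finset.Icc 1 m, ∑ j ∈ Finset.Icc 1 n, A i j * fluxSum r G x y V (D i j) i j := by
  have h1 : ∀ i ∈ Finset.Icc 1 m, ∀ j ∈ Finset.Icc 1 n, A i j * ∑ k ∈ Finset.range (r + 1),
      ∑ l ∈ Finset.range (r + 1), V i k j l * subInt r G x y (pdx (D i j)) i k j l =
      (∑ l ∈ Finset.range (r + 1), V i r j l *
        ∫ t in (gam r G (y (j - 1)) (y j) l)..(gam r G (y (j - 1)) (y j) (l + 1)),
          A i j * D i j (x i, t)) -
      (∑ l ∈ Finset.range (r + 1), V i 0 j l *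
        ∫ t in (gam r G (y (j - 1)) (y j) l)..(gam r G (y (j - 1)) (y j) (l + 1)),
          A i j * D i j (x (i - 1), t)) -
      A i j * fluxSum r G x y V (D i j) i j := by
    intro i hi j hj
    simp only [consistency_cell (hD i hi j hj), mul_sub, Finset.mul_sum,
      intervalIntegral.integral_const_mul, mul_left_comm (A i j)]
  rw [Finset.sum_congr rfl fun i hi => Finset.sum_congr rfl (h1 i hi)]
  simp only [Finset.sum_sub_distrib]
  rw [sub_eq_neg_self, sub_eq_zero, Finset.sum_comm, Finset.sum_comm (s := Finset.Icc 1 m)]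
  refine Finset.sum_congr rfl fun j hj => ?_
  refine sum_Icc_shift m _ _ (Finset.sum_eq_zero fun l hl => ?_)
    (Finset.sum_eq_zero fun l _ => ?_) fun i hi him => ?_
  · rw [hV.x_last j hj l (Nat.lt_succ_iff.mp (Finset.mem_range.mp hl)), zero_mul]
  · rw [hV.x_zero, zero_mul]
  · refine Finset.sum_congr rfl fun l hl => ?_
    have hl' : l ≤ r := Nat.lt_succ_iff.mp (Finset.mem_range.mp hl)
    have hyj := pred_lt hy hj
    rw [hV.x_step i hi, Nat.add_sub_cancel]
    congr 1
    refine intervalIntegral.integral_congr fun t ht => ?_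
    rw [Set.uIcc_of_le (gam_lt hG hyj hl').le] at ht
    exact hA i hi him j hj t ⟨(gam_mem hG hyj (by omega)).1.trans ht.1,
      ht.2.trans (gam_mem hG hyj (by omega)).2⟩

/-- Integration by parts for the `y`-derivatives, using continuity of the `y`-fluxes. -/
lemma consistency_y (hG : IsGaussPoints r G) (hx : ∀ i < m, x i < x (i + 1)) (hV : Adm r m n V)
    (D : ℕ → ℕ → ℝ × ℝ → ℝ) (A : ℕ → ℕ → ℝ)
    (hD : ∀ i ∈ Finset.Icc 1 m, ∀ j ∈ Finset.Icc 1 n, ContDiff ℝ 1 (D i j))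
    (hA : ∀ j, 1 ≤ j → j < n → ∀ i ∈ Finset.Icc 1 m, ∀ s ∈ Set.Icc (x (i - 1)) (x i),
      A i j * D i j (s, y j) = A i (j + 1) * D i (j + 1) (s, y j)) :
    ∑ i ∈ Finset.Icc 1 m, ∑ j ∈ Finset.Icc 1 n, A i j * ∑ k ∈ Finset.range (r + 1),
      ∑ l ∈ Finset.range (r + 1), V i k j l * subInt r G x y (pdy (D i j)) i k j l =
    -∑ i ∈ Finset.Icc 1 m, ∑ j ∈ Finset.Icc 1 n,
      A i j * fluxSum r G y x (fun j l i k => V i k j l) (D i j ∘ Prod.swap) j i := by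
  have h := consistency_x (x := y) hG hx hV.swap (fun j i => D i j ∘ Prod.swap) (fun j i => A i j)
    (fun j hj i hi => by exact_mod_cast contDiff_swap (n := 1) (by exact_mod_cast hD i hi j hj))
    (fun j hj hjn i hi s hs => hA j hj hjn i hi s hs)
  rw [Finset.sum_comm, Finset.sum_comm (s := Finset.Icc 1 m), ← h]
  refine Finset.sum_congr rfl fun j hj => Finset.sum_congr rfl fun i hi => ?_
  rw [Finset.sum_comm]
  congr 1
  refine Finset.sum_congr rfl fun l _ => Finset.sum_congr rfl fun k _ => ?_
  rw [pdx_swap, subInt, subInt, rectInt_swap (continuous_pdy (hD i hi j hj))]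

end

/-! ### The error equation -/

section
variable {a b c d : ℝ} {P : RectPartition a b c d} {r : ℕ} {G : ℕ → ℝ} {α : ℝ × ℝ → ℝ}
  {A : ℕ → ℕ → ℝ} {w : ℕ → ℕ → ℕ → ℕ → ℝ}

lemma aP_eq (hG : IsGaussPoints r G) (hr : 1 ≤ r)
    (hA : ∀ i ∈ Finset.Icc 1 P.m, ∀ j ∈ Finset.Icc 1 P.n, ∀ z ∈ P.openCell i j, α z = A i j)
    (hw : IsTestFun r P w) (Dx Dy : ℕ → ℕ → ℝ × ℝ → ℝ) :
    aP r G P α Dx Dy w =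
      (∑ i ∈ Finset.Icc 1 P.m, ∑ j ∈ Finset.Icc 1 P.n,
        A i j * fluxSum r G P.x P.y (wE r w) (Dx i j) i j) +
      ∑ i ∈ Finset.Icc 1 P.m, ∑ j ∈ Finset.Icc 1 P.n,
        A i j * fluxSum r G P.y P.x (fun j l i k => wE r w i k j l) (Dy i j ∘ Prod.swap) j i := by
  have hV := adm_wE hr hw
  rw [aP]
  congr 1
  · rw [idxX, Finset.sum_filter_of_ne]
    · simp only [Finset.sum_product]
      exact regroup_flux hG hr P.hxlt P.hylt hV Dx α A
        fun i hi j hj s hs t ht => hA i hi j hj (s, t) ⟨hs, ht⟩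
    · rintro ⟨i, k, j, l⟩ hq hne ⟨rfl, rfl⟩
      simp only [Finset.mem_product, Finset.mem_Icc] at hq
      refine hne ?_
      simp only [jumpX]
      rw [hV.y_last i (Finset.mem_Icc.mpr hq.1) k (by dsimp only; omega),
        hV.y_last i (Finset.mem_Icc.mpr hq.1) (k - 1) (by dsimp only; omega)]
      ring
  · rw [idxY, Finset.sum_filter_of_ne]
    · have h := regroup_flux hG hr P.hylt P.hxlt hV.swap (fun j i => Dy i j ∘ Prod.swap)
        (α ∘ Prod.swap) (fun j i => A i j)
        fun j hj i hi t ht s hs => hA i hi j hj (s, t) ⟨hs, ht⟩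
      rw [Finset.sum_comm (s := Finset.Icc 1 P.m), ← h]
      simp only [Finset.sum_product]
      have hc : ∀ f : ℕ → ℕ → ℕ → ℕ → ℝ,
          ∑ i ∈ Finset.Icc 1 P.m, ∑ k ∈ Finset.Icc 1 r, ∑ j ∈ Finset.Icc 1 P.n,
            ∑ l ∈ Finset.Icc 1 r, f i k j l =
          ∑ j ∈ Finset.Icc 1 P.n, ∑ l ∈ Finset.Icc 1 r, ∑ i ∈ Finset.Icc 1 P.m,
            ∑ k ∈ Finset.Icc 1 r, f i k j l := by
        intro f
        have h1 : ∀ i, ∑ k ∈ Finset.Icc 1 r, ∑ j ∈ Finset.Icc 1 P.n, ∑ l ∈ Finset.Icc 1 r,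
            f i k j l = ∑ j ∈ Finset.Icc 1 P.n, ∑ l ∈ Finset.Icc 1 r, ∑ k ∈ Finset.Icc 1 r,
            f i k j l := fun i => by
          rw [Finset.sum_comm]
          exact Finset.sum_congr rfl fun j _ => Finset.sum_comm
        simp only [h1]
        rw [Finset.sum_comm]
        exact Finset.sum_congr rfl fun j _ => Finset.sum_comm
      exact hc _
    · rintro ⟨i, k, j, l⟩ hq hne ⟨rfl, rfl⟩
      simp only [Finset.mem_product, Finset.mem_Icc] at hq
      refine hne ?_
      simp only [jumpY]
      rw [hV.x_last j (Finset.mem_Icc.mpr hq.2.2.1) l (by dsimp only; omega),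
        hV.x_last j (Finset.mem_Icc.mpr hq.2.2.1) (l - 1) (by dsimp only; omega)]
      ring

lemma subInt_cellSource (hG : IsGaussPoints r G)
    (hA : ∀ i ∈ Finset.Icc 1 P.m, ∀ j ∈ Finset.Icc 1 P.n, ∀ z ∈ P.openCell i j, α z = A i j)
    {u : PiecewiseFun P} (hu : CellSmooth P (r + 2) u) {i j k l : ℕ} (hi : i ∈ Finset.Icc 1 P.m)
    (hj : j ∈ Finset.Icc 1 P.n) (hk : k ≤ r) (hl : l ≤ r) :
    subInt r G P.x P.y (cellSource α u i j) i k j l =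
      -(A i j * subInt r G P.x P.y (pdx (cellDx u i j)) i k j l) -
        A i j * subInt r G P.x P.y (pdy (cellDy u i j)) i k j l := by
  have hc := hu i hi j hj
  have h1 : Continuous (pdx (cellDx u i j)) :=
    (contDiff_pdx (n := r) (contDiff_pdx (n := r + 1) hc)).continuous
  have h2 : Continuous (pdy (cellDy u i j)) :=
    (contDiff_pdy (n := r) (contDiff_pdy (n := r + 1) hc)).continuous
  have hxi := pred_lt P.hxlt hi
  have hyj := pred_lt P.hylt hj
  have h3 : subInt r G P.x P.y (cellSource α u i j) i k j l =
      subInt r G P.x P.y (fun z => (-A i j) * (pdx (cellDx u i j) z + pdy (cellDy u i j) z))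
        i k j l := by
    unfold subInt rectInt
    apply intervalIntegral.integral_congr_Ioo_of_le (gam_lt hG hxi hk).le
    intro s hs
    apply intervalIntegral.integral_congr_Ioo_of_le (gam_lt hG hyj hl).le
    intro t ht
    have := hA i hi j hj (s, t)
      ⟨⟨lt_of_le_of_lt (gam_mem hG hxi (by omega)).1 hs.1,
        lt_of_lt_of_le hs.2 (gam_mem hG hxi (by omega)).2⟩,
      ⟨lt_of_le_of_lt (gam_mem hG hyj (by omega)).1 ht.1,
        lt_of_lt_of_le ht.2 (gam_mem hG hyj (by omega)).2⟩⟩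
    simp only [cellSource, this, cellDx, cellDy]
    ring
  rw [h3]
  unfold subInt
  rw [rectInt_const_mul, rectInt_add h1 h2]
  ring

lemma fvRHS_eq (hG : IsGaussPoints r G) (hr : 1 ≤ r)
    (hA : ∀ i ∈ Finset.Icc 1 P.m, ∀ j ∈ Finset.Icc 1 P.n, ∀ z ∈ P.openCell i j, α z = A i j)
    (hw : IsTestFun r P w) {u : PiecewiseFun P} (hu : CellSmooth P (r + 2) u) :
    fvRHS r G P α u w =
      -(∑ i ∈ Finset.Icc 1 P.m, ∑ j ∈ Finset.Icc 1 P.n, A i j * ∑ k ∈ Finset.range (r + 1),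
        ∑ l ∈ Finset.range (r + 1),
          wE r w i k j l * subInt r G P.x P.y (pdx (cellDx u i j)) i k j l) -
      ∑ i ∈ Finset.Icc 1 P.m, ∑ j ∈ Finset.Icc 1 P.n, A i j * ∑ k ∈ Finset.range (r + 1),
        ∑ l ∈ Finset.range (r + 1),
          wE r w i k j l * subInt r G P.x P.y (pdy (cellDy u i j)) i k j l := by
  have hV := adm_wE hr hw
  have hwE : ∀ i k j l, 1 ≤ k → 1 ≤ l → w i k j l = wE r w i k j l := by
    intro i k j l hk hl
    have h1 : k ≠ 0 := by omega
    have h2 : l ≠ 0 := by omega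
    simp [wE, h1, h2]
  rw [fvRHS, idxZ, Finset.sum_filter_of_ne]
  · simp only [Finset.sum_product]
    have h1 : ∀ i ∈ Finset.Icc 1 P.m, ∀ k ∈ Finset.Icc 1 r, ∀ j ∈ Finset.Icc 1 P.n,
        ∀ l ∈ Finset.Icc 1 r, w i k j l * dualCellInt r G P (cellSource α u) i k j l =
        wE r w i k j l * dualCellInt r G P (cellSource α u) i k j l := by
      intro i _ k hk j _ l hl
      rw [hwE i k j l (Finset.mem_Icc.mp hk).1 (Finset.mem_Icc.mp hl).1]
    rw [Finset.sum_congr rfl fun i hi => Finset.sum_congr rfl fun k hk =>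
      Finset.sum_congr rfl fun j hj => Finset.sum_congr rfl (h1 i hi k hk j hj)]
    refine (regroup_source hG hr P.hxlt P.hylt hV (cellSource α u)).trans ?_
    rw [← Finset.sum_neg_distrib, ← Finset.sum_sub_distrib]
    refine Finset.sum_congr rfl fun i hi => ?_
    rw [← Finset.sum_neg_distrib, ← Finset.sum_sub_distrib]
    refine Finset.sum_congr rfl fun j hj => ?_
    simp only [Finset.mul_sum]
    rw [← Finset.sum_neg_distrib, ← Finset.sum_sub_distrib]
    refine Finset.sum_congr rfl fun k hk => ?_
    rw [← Finset.sum_neg_distrib, ← Finset.sum_sub_distrib]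
    refine Finset.sum_congr rfl fun l hl => ?_
    have h := subInt_cellSource hG hA hu hi hj
      (Nat.lt_succ_iff.mp (Finset.mem_range.mp hk)) (Nat.lt_succ_iff.mp (Finset.mem_range.mp hl))
    rw [subInt] at h
    rw [h]
    ring
  · rintro ⟨i, k, j, l⟩ hq hne
    simp only [Finset.mem_product, Finset.mem_Icc] at hq
    constructor
    · rintro ⟨rfl, rfl⟩
      exact hne (by
        simp only [hw.1 j (Finset.mem_Icc.mpr hq.2.2.1) l (Finset.mem_Icc.mpr hq.2.2.2), zero_mul])
    · rintro ⟨rfl, rfl⟩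
      exact hne (by
        simp only [hw.2 i (Finset.mem_Icc.mpr hq.1) k (Finset.mem_Icc.mpr hq.2.1), zero_mul])

/-- A continuous flux takes the cellwise values up to the boundary of each closed cell. -/
lemma flux_closed_cell {F : ℝ × ℝ → ℝ} (hF : ContinuousOn F P.dom) {D : ℝ × ℝ → ℝ}
    (hD : Continuous D) {i j : ℕ} (hi : i ∈ Finset.Icc 1 P.m) (hj : j ∈ Finset.Icc 1 P.n)
    (hdom : P.cell i j ⊆ P.dom) (h : ∀ z ∈ P.openCell i j, F z = D z) :
    ∀ z ∈ P.cell i j, F z = D z := by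
  have hcl : P.cell i j ⊆ closure (P.openCell i j) := by
    rw [RectPartition.openCell, closure_prod_eq, closure_Ioo (pred_lt P.hxlt hi).ne,
      closure_Ioo (pred_lt P.hylt hj).ne]
    exact subset_rfl
  have hsub : P.openCell i j ⊆ P.cell i j :=
    Set.prod_mono Set.Ioo_subset_Icc_self Set.Ioo_subset_Icc_self
  exact Set.EqOn.of_subset_closure (s := P.openCell i j) (t := P.cell i j) h (hF.mono hdom)
    hD.continuousOn hsub hcl

lemma mono_of_step {m : ℕ} {x : ℕ → ℝ} (hx : ∀ i < m, x i < x (i + 1)) {i j : ℕ} (hij : i ≤ j)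
    (hj : j ≤ m) : x i ≤ x j := by
  induction j, hij using Nat.le_induction with
  | base => exact le_rfl
  | succ j _ ih => exact (ih (by omega)).trans (hx j (by omega)).le

lemma cell_subset_dom {i j : ℕ} (hi : i ∈ Finset.Icc 1 P.m) (hj : j ∈ Finset.Icc 1 P.n) :
    P.cell i j ⊆ P.dom := by
  rw [Finset.mem_Icc] at hi hj
  refine Set.prod_mono (Set.Icc_subset_Icc ?_ ?_) (Set.Icc_subset_Icc ?_ ?_)
  · exact P.hxa.symm.le.trans (mono_of_step P.hxlt (Nat.zero_le _) (by omega))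
  · exact (mono_of_step P.hxlt hi.2 le_rfl).trans P.hxb.le
  · exact P.hyc.symm.le.trans (mono_of_step P.hylt (Nat.zero_le _) (by omega))
  · exact (mono_of_step P.hylt hj.2 le_rfl).trans P.hyd.le

/-- The error of the finite volume solution is annihilated by the bilinear form. -/
lemma error_equation (hG : IsGaussPoints r G) (hr : 1 ≤ r)
    (hA : ∀ i ∈ Finset.Icc 1 P.m, ∀ j ∈ Finset.Icc 1 P.n, ∀ z ∈ P.openCell i j, α z = A i j)
    (hw : IsTestFun r P w) {u uP : PiecewiseFun P} (hu : CellSmooth P (r + 2) u)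
    (hflux : FluxContinuous P α u) (hP : IsFVSolution r G P α u uP) :
    ∑ i ∈ Finset.Icc 1 P.m, ∑ j ∈ Finset.Icc 1 P.n, A i j *
      ((fluxSum r G P.x P.y (wE r w) (cellDx u i j) i j -
        fluxSum r G P.x P.y (wE r w) (cellDx uP i j) i j) +
       (fluxSum r G P.y P.x (fun j l i k => wE r w i k j l) (cellDy u i j ∘ Prod.swap) j i -
        fluxSum r G P.y P.x (fun j l i k => wE r w i k j l) (cellDy uP i j ∘ Prod.swap) j i)) =
      0 := by
  have hV := adm_wE hr hw
  obtain ⟨Fx, Fy, hFx, hFy, hF⟩ := hflux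
  have hDx : ∀ i ∈ Finset.Icc 1 P.m, ∀ j ∈ Finset.Icc 1 P.n, ContDiff ℝ 1 (cellDx u i j) :=
    fun i hi j hj => contDiff_one_of (contDiff_pdx (n := r + 1) (hu i hi j hj))
  have hDy : ∀ i ∈ Finset.Icc 1 P.m, ∀ j ∈ Finset.Icc 1 P.n, ContDiff ℝ 1 (cellDy u i j) :=
    fun i hi j hj => contDiff_one_of (contDiff_pdy (n := r + 1) (hu i hi j hj))
  have hcx : ∀ i ∈ Finset.Icc 1 P.m, ∀ j ∈ Finset.Icc 1 P.n, ∀ z ∈ P.cell i j,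
      Fx z = A i j * cellDx u i j z := fun i hi j hj =>
    flux_closed_cell hFx (continuous_const.mul (hDx i hi j hj).continuous) hi hj
      (cell_subset_dom hi hj) fun z hz => by rw [(hF i hi j hj z hz).1, hA i hi j hj z hz]; rfl
  have hcy : ∀ i ∈ Finset.Icc 1 P.m, ∀ j ∈ Finset.Icc 1 P.n, ∀ z ∈ P.cell i j,
      Fy z = A i j * cellDy u i j z := fun i hi j hj =>
    flux_closed_cell hFy (continuous_const.mul (hDy i hi j hj).continuous) hi hj
      (cell_subset_dom hi hj) fun z hz => by rw [(hF i hi j hj z hz).2, hA i hi j hj z hz]; rfl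
  have h1 := hP.2 w hw
  rw [aP_eq hG hr hA hw, fvRHS_eq hG hr hA hw hu,
    consistency_x hG P.hylt hV (cellDx u) A hDx ?_,
    consistency_y hG P.hxlt hV (cellDy u) A hDy ?_] at h1
  · simp only [mul_add, mul_sub, Finset.sum_add_distrib, Finset.sum_sub_distrib]
    linarith
  · intro j hj hjn i hi s hs
    have hj1 : j ∈ Finset.Icc 1 P.n := Finset.mem_Icc.mpr ⟨hj, hjn.le⟩
    have hj2 : j + 1 ∈ Finset.Icc 1 P.n := Finset.mem_Icc.mpr ⟨by omega, hjn⟩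
    rw [← hcy i hi j hj1 (s, P.y j) ⟨hs, (pred_lt P.hylt hj1).le, le_rfl⟩,
      ← hcy i hi (j + 1) hj2 (s, P.y j) ⟨hs, le_rfl, (P.hylt j hjn).le⟩]
  · intro i hi him j hj t ht
    have hi1 : i ∈ Finset.Icc 1 P.m := Finset.mem_Icc.mpr ⟨hi, him.le⟩
    have hi2 : i + 1 ∈ Finset.Icc 1 P.m := Finset.mem_Icc.mpr ⟨by omega, him⟩
    rw [← hcx i hi1 j hj (P.x i, t) ⟨⟨(pred_lt P.hxlt hi1).le, le_rfl⟩, ht⟩,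
      ← hcx (i + 1) hi2 j hj (P.x i, t) ⟨⟨le_rfl, (P.hxlt i him).le⟩, ht⟩]

end

/-! ### The test function attached to a trial function -/

/-- Coefficients of the test function attached to `v` on the cell `[p,q] × [s,t]`. -/
noncomputable def tst (r : ℕ) (G : ℕ → ℝ) (p q s t : ℝ) (v : ℝ × ℝ → ℝ) (k l : ℕ) : ℝ :=
  jop r G p q k (fun x => jop r G s t l (fun y => v (x, y)) (fun y => pdy v (x, y)))
    (fun x => jop r G s t l (fun y => pdx v (x, y)) (fun y => pdy (pdx v) (x, y)))

section
variable {r : ℕ} {G : ℕ → ℝ} {p q s t : ℝ} {v v' : ℝ × ℝ → ℝ}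

lemma tst_swap (hv : ContDiff ℝ 2 v) (k l : ℕ) :
    tst r G s t p q (v ∘ Prod.swap) l k = tst r G p q s t v k l := by
  unfold tst
  rw [pdx_swap, pdy_swap, pdy_swap, pdy_pdx hv]
  simp only [jop, Function.comp, Prod.swap, mul_add, Finset.sum_add_distrib, Finset.mul_sum]
  rw [Finset.sum_comm]
  simp only [mul_left_comm]
  ring

lemma tst_zero (l : ℕ) :
    tst r G p q s t v 0 l = jop r G s t l (fun y => v (p, y)) (fun y => pdy v (p, y)) := by
  rw [tst, jop_zero]

lemma tst_last (hG : IsGaussPoints r G) (hr : 1 ≤ r) (hv : v ∈ biP r r) (l : ℕ) :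
    tst r G p q s t v r l = jop r G s t l (fun y => v (q, y)) (fun y => pdy v (q, y)) := by
  have h2 : ContDiff ℝ 2 v := by exact_mod_cast contDiff_of_mem hv 2
  have key : ∀ (f : ℝ × ℝ → ℝ) (n : ℕ), f ∈ biP r n → ∀ y,
      jop r G p q r (fun x => f (x, y)) (fun x => pdx f (x, y)) = f (q, y) := by
    intro f n hf y
    obtain ⟨P, hP, h1, h2⟩ := exists_slice_fst hf y
    simp only [h1, h2]
    exact jop_last hG hr p q P hP
  rw [← tst_swap h2, tst, pdx_swap, pdy_swap, pdy_swap]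
  have e1 := key v r hv
  have e2 := key (pdy v) (r - 1) (pdy_mem hv)
  simp only [Function.comp, Prod.swap, e1, e2]

lemma pdy_congr_line (hv : ContDiff ℝ 1 v) (hv' : ContDiff ℝ 1 v') {x : ℝ}
    (h : ∀ y, v (x, y) = v' (x, y)) (y : ℝ) : pdy v (x, y) = pdy v' (x, y) := by
  have h1 := hasDerivAt_snd hv x y
  rw [show (fun y => v (x, y)) = fun y => v' (x, y) from funext h] at h1
  exact h1.unique (hasDerivAt_snd hv' x y)

lemma pdy_zero_line (hv : ContDiff ℝ 1 v) {x : ℝ} (h : ∀ y, v (x, y) = 0) (y : ℝ) :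
    pdy v (x, y) = 0 := by
  have h1 := hasDerivAt_snd hv x y
  rw [show (fun y => v (x, y)) = fun _ => (0 : ℝ) from funext h] at h1
  exact h1.unique (hasDerivAt_const y 0)

lemma tst_succ_sub (k l : ℕ) :
    tst r G p q s t v (k + 1) l - tst r G p q s t v k l =
      (q - p) / 2 * wt r G (k + 1) * jop r G s t l (fun y => pdx v (aff p q (G (k + 1)), y))
        (fun y => pdy (pdx v) (aff p q (G (k + 1)), y)) := by
  rw [tst, jop_succ, tst]
  ring

end

/-- Cellwise polynomials which match across edges and vanish on the boundary. -/
structure Conf (r m n : ℕ) (x y : ℕ → ℝ) (v : ℕ → ℕ → ℝ × ℝ → ℝ) : Prop where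
  mem : ∀ i ∈ Finset.Icc 1 m, ∀ j ∈ Finset.Icc 1 n, v i j ∈ biP r r
  x_zero : ∀ j ∈ Finset.Icc 1 n, ∀ t, v 1 j (x 0, t) = 0
  x_step : ∀ i, 1 ≤ i → i < m → ∀ j ∈ Finset.Icc 1 n, ∀ t, v (i + 1) j (x i, t) = v i j (x i, t)
  x_last : ∀ j ∈ Finset.Icc 1 n, ∀ t, v m j (x m, t) = 0
  y_zero : ∀ i ∈ Finset.Icc 1 m, ∀ s, v i 1 (s, y 0) = 0
  y_step : ∀ j, 1 ≤ j → j < n → ∀ i ∈ Finset.Icc 1 m, ∀ s, v i (j + 1) (s, y j) = v i j (s, y j)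
  y_last : ∀ i ∈ Finset.Icc 1 m, ∀ s, v i n (s, y n) = 0

section
variable {r m n : ℕ} {G x y : ℕ → ℝ} {v : ℕ → ℕ → ℝ × ℝ → ℝ}

lemma Conf.swap (h : Conf r m n x y v) : Conf r n m y x (fun j i => v i j ∘ Prod.swap) where
  mem := fun j hj i hi => swap_mem (h.mem i hi j hj)
  x_zero := h.y_zero
  x_step := h.y_step
  x_last := h.y_last
  y_zero := h.x_zero
  y_step := h.x_step
  y_last := h.x_last

/-- The test function attached to `v`. -/
noncomputable def tw (r : ℕ) (G x y : ℕ → ℝ) (v : ℕ → ℕ → ℝ × ℝ → ℝ) (i k j l : ℕ) : ℝ :=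
  tst r G (x (i - 1)) (x i) (y (j - 1)) (y j) (v i j) k l

lemma tw_swap (h : Conf r m n x y v) {i j : ℕ} (hi : i ∈ Finset.Icc 1 m)
    (hj : j ∈ Finset.Icc 1 n) (k l : ℕ) :
    tw r G y x (fun j i => v i j ∘ Prod.swap) j l i k = tw r G x y v i k j l :=
  tst_swap (by exact_mod_cast contDiff_of_mem (h.mem i hi j hj) 2) k l

lemma tw_zero (h : Conf r m n x y v) (hm : 0 < m) {j : ℕ} (hj : j ∈ Finset.Icc 1 n) (l : ℕ) :
    tw r G x y v 1 0 j l = 0 := by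
  have hv := contDiff_one_of_mem (h.mem 1 (Finset.mem_Icc.mpr ⟨le_rfl, hm⟩) j hj)
  rw [tw, tst_zero, Nat.sub_self]
  simp [jop, h.x_zero j hj, pdy_zero_line hv (h.x_zero j hj)]

lemma tw_last (hG : IsGaussPoints r G) (hr : 1 ≤ r) (h : Conf r m n x y v) (hm : 0 < m)
    {j : ℕ} (hj : j ∈ Finset.Icc 1 n) (l : ℕ) : tw r G x y v m r j l = 0 := by
  have hv := h.mem m (Finset.mem_Icc.mpr ⟨hm, le_rfl⟩) j hj
  rw [tw, tst_last hG hr hv]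
  simp [jop, h.x_last j hj, pdy_zero_line (contDiff_one_of_mem hv) (h.x_last j hj)]

lemma tw_step (hG : IsGaussPoints r G) (hr : 1 ≤ r) (h : Conf r m n x y v) {i : ℕ} (hi : 1 ≤ i)
    (him : i < m) {j : ℕ} (hj : j ∈ Finset.Icc 1 n) (l : ℕ) :
    tw r G x y v i r j l = tw r G x y v (i + 1) 0 j l := by
  have hv := h.mem i (Finset.mem_Icc.mpr ⟨hi, him.le⟩) j hj
  have hv' := h.mem (i + 1) (Finset.mem_Icc.mpr ⟨by omega, him⟩) j hj
  rw [tw, tst_last hG hr hv, tw, tst_zero, Nat.add_sub_cancel]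
  simp only [h.x_step i hi him j hj,
    pdy_congr_line (contDiff_one_of_mem hv') (contDiff_one_of_mem hv) (h.x_step i hi him j hj)]

lemma wE_tw_right (hG : IsGaussPoints r G) (hr : 1 ≤ r) (h : Conf r m n x y v) {i j k l : ℕ}
    (hi : i ∈ Finset.Icc 1 m) (hj : j ∈ Finset.Icc 1 n) (hk : 1 ≤ k) :
    wE r (tw r G x y v) i k j l = tw r G x y v i k j l := by
  have hk0 : k ≠ 0 := by omega
  have hj' := Finset.mem_Icc.mp hj
  by_cases hl : l = 0
  · subst hl
    by_cases hj1 : j = 1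
    · subst hj1
      rw [← tw_swap h hi hj, tw_zero h.swap (by omega) hi]
      simp [wE]
    · simp only [wE, hk0, hj1, false_and, and_false, or_self, if_false, if_true]
      obtain ⟨j, rfl⟩ : ∃ j', j = j' + 1 := ⟨j - 1, by omega⟩
      have hj2 : j ∈ Finset.Icc 1 n := Finset.mem_Icc.mpr (by omega)
      rw [Nat.add_sub_cancel, ← tw_swap h hi hj, ← tw_swap h hi hj2,
        tw_step hG hr h.swap (by omega) (by omega) hi]
  · simp [wE, hk0, hl]

/-- The attached test function extends to the conventional indices cell by cell. -/
lemma wE_tw (hG : IsGaussPoints r G) (hr : 1 ≤ r) (h : Conf r m n x y v) {i j k l : ℕ}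
    (hi : i ∈ Finset.Icc 1 m) (hj : j ∈ Finset.Icc 1 n) :
    wE r (tw r G x y v) i k j l = tw r G x y v i k j l := by
  rcases Nat.eq_zero_or_pos k with rfl | hk
  · have hi' := Finset.mem_Icc.mp hi
    by_cases hi1 : i = 1
    · subst hi1
      rw [tw_zero h (by omega) hj]
      simp [wE]
    · obtain ⟨i, rfl⟩ : ∃ i', i = i' + 1 := ⟨i - 1, by omega⟩
      have hi2 : i ∈ Finset.Icc 1 m := Finset.mem_Icc.mpr (by omega)
      rw [← tw_step hG hr h (by omega) (by omega) hj, ← wE_tw_right hG hr h hi2 hj hr]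
      have hr0 : r ≠ 0 := by omega
      have hi0 : i ≠ 0 := by omega
      simp [wE, hr0, hi0]
  · exact wE_tw_right hG hr h hi hj hk

lemma fluxSum_tw {V : ℕ → ℕ → ℕ → ℕ → ℝ} {i j : ℕ}
    (hV : ∀ k l, V i k j l = tw r G x y v i k j l) (e : ℝ × ℝ → ℝ) :
    fluxSum r G x y V (pdx e) i j =
      fluxForm r G (x (i - 1)) (x i) (y (j - 1)) (y j) (v i j) e := by
  rw [fluxSum, fluxForm]
  refine Finset.sum_congr rfl fun k hk => ?_
  obtain ⟨k, rfl⟩ : ∃ k', k = k' + 1 := ⟨k - 1, by have := (Finset.mem_Icc.mp hk).1; omega⟩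
  rw [bform, Finset.mul_sum]
  refine Finset.sum_congr rfl fun l _ => ?_
  rw [Nat.add_sub_cancel, hV, hV, tw, tw, tst_succ_sub]
  ring

lemma fluxSum_sub (V : ℕ → ℕ → ℕ → ℕ → ℝ) {D D' : ℝ × ℝ → ℝ} (hD : Continuous D)
    (hD' : Continuous D') (i j : ℕ) :
    fluxSum r G x y V D i j - fluxSum r G x y V D' i j =
      fluxSum r G x y V (fun z => D z - D' z) i j := by
  rw [fluxSum, fluxSum, fluxSum, ← Finset.sum_sub_distrib]
  refine Finset.sum_congr rfl fun k _ => ?_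
  rw [← Finset.sum_sub_distrib]
  refine Finset.sum_congr rfl fun l _ => ?_
  rw [intervalIntegral.integral_sub (Continuous.intervalIntegrable (by fun_prop) _ _)
    (Continuous.intervalIntegrable (by fun_prop) _ _), mul_sub]

end

section
variable {a b c d : ℝ} {P : RectPartition a b c d} {r : ℕ} {G : ℕ → ℝ} {α : ℝ × ℝ → ℝ}
  {A : ℕ → ℕ → ℝ}

lemma isTestFun_tw (hG : IsGaussPoints r G) (hr : 1 ≤ r) {v : ℕ → ℕ → ℝ × ℝ → ℝ}
    (h : Conf r P.m P.n P.x P.y v) : IsTestFun r P (tw r G P.x P.y v) := by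
  refine ⟨fun j hj l _ => tw_last hG hr h P.hm hj l, fun i hi k _ => ?_⟩
  rw [← tw_swap h hi (Finset.mem_Icc.mpr ⟨P.hn, le_rfl⟩)]
  exact tw_last hG hr h.swap P.hn hi k

/-- The error equation tested with the function attached to `v`, cell by cell. -/
lemma error_equation_cells (hG : IsGaussPoints r G) (hr : 1 ≤ r)
    (hA : ∀ i ∈ Finset.Icc 1 P.m, ∀ j ∈ Finset.Icc 1 P.n, ∀ z ∈ P.openCell i j, α z = A i j)
    {u uP : PiecewiseFun P} (hu : CellSmooth P (r + 2) u)
    (hflux : FluxContinuous P α u) (hP : IsFVSolution r G P α u uP)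
    {v : ℕ → ℕ → ℝ × ℝ → ℝ} (hv : Conf r P.m P.n P.x P.y v) :
    ∑ i ∈ Finset.Icc 1 P.m, ∑ j ∈ Finset.Icc 1 P.n, A i j *
      (fluxForm r G (P.x (i - 1)) (P.x i) (P.y (j - 1)) (P.y j) (v i j)
          (fun z => u.cellFun i j z - uP.cellFun i j z) +
        fluxForm r G (P.y (j - 1)) (P.y j) (P.x (i - 1)) (P.x i) (v i j ∘ Prod.swap)
          ((fun z => u.cellFun i j z - uP.cellFun i j z) ∘ Prod.swap)) = 0 := by
  rw [← error_equation hG hr hA (isTestFun_tw hG hr hv) hu hflux hP]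
  refine Finset.sum_congr rfl fun i hi => Finset.sum_congr rfl fun j hj => ?_
  have h1 : ContDiff ℝ 1 (u.cellFun i j) := contDiff_one_of (n := r + 1) (hu i hi j hj)
  have h2 : ContDiff ℝ 1 (uP.cellFun i j) := contDiff_one_of_mem (IsBiPoly.mem (hP.1.2.2 i hi j hj))
  have hdx : pdx (fun z => u.cellFun i j z - uP.cellFun i j z) =
      fun z => cellDx u i j z - cellDx uP i j z := funext fun z => pdx_sub h1 h2 z
  have hdy : pdx ((fun z => u.cellFun i j z - uP.cellFun i j z) ∘ Prod.swap) =
      fun z => (cellDy u i j ∘ Prod.swap) z - (cellDy uP i j ∘ Prod.swap) z := by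
    rw [pdx_swap]
    exact funext fun z => pdy_sub h1 h2 z.swap
  rw [fluxSum_sub (D := cellDx u i j) (D' := cellDx uP i j) _ (continuous_pdx h1)
      (continuous_pdx h2),
    fluxSum_sub (D := cellDy u i j ∘ Prod.swap) (D' := cellDy uP i j ∘ Prod.swap) _
      ((continuous_pdy h1).comp continuous_swap)
      ((continuous_pdy h2).comp continuous_swap), ← hdx, ← hdy,
    fluxSum_tw (fun k l => wE_tw hG hr hv hi hj),
    fluxSum_tw (v := fun j i => v i j ∘ Prod.swap) (fun l k => by
      rw [tw_swap hv hi hj]; exact wE_tw hG hr hv hi hj)]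

end

/-! ### Conformity of the discrete error -/

lemma eq_on_line {r s : ℕ} {f g : ℝ × ℝ → ℝ} (hf : f ∈ biP r s) (hg : g ∈ biP r s) {x p q : ℝ}
    (hpq : p < q) (h : ∀ y ∈ Set.Icc p q, f (x, y) = g (x, y)) (y : ℝ) : f (x, y) = g (x, y) := by
  obtain ⟨P, -, hP, -⟩ := exists_slice_snd hf x
  obtain ⟨Q, -, hQ, -⟩ := exists_slice_snd hg x
  have : P = Q := Polynomial.eq_of_infinite_eval_eq P Q
    ((Set.Icc_infinite hpq).mono fun y hy => by
      change P.eval y = Q.eval y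
      rw [← hP, ← hQ, h y hy])
  rw [hP, hQ, this]

lemma conf_of_eqOn_edges {r m n : ℕ} {x y : ℕ → ℝ} {v : ℕ → ℕ → ℝ × ℝ → ℝ}
    (hm : 0 < m) (hn : 0 < n) (hx : ∀ i < m, x i < x (i + 1)) (hy : ∀ j < n, y j < y (j + 1))
    (mem : ∀ i ∈ Finset.Icc 1 m, ∀ j ∈ Finset.Icc 1 n, v i j ∈ biP r r)
    (x_zero : ∀ j ∈ Finset.Icc 1 n, ∀ t ∈ Set.Icc (y (j - 1)) (y j), v 1 j (x 0, t) = 0)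
    (x_step : ∀ i, 1 ≤ i → i < m → ∀ j ∈ Finset.Icc 1 n, ∀ t ∈ Set.Icc (y (j - 1)) (y j),
      v (i + 1) j (x i, t) = v i j (x i, t))
    (x_last : ∀ j ∈ Finset.Icc 1 n, ∀ t ∈ Set.Icc (y (j - 1)) (y j), v m j (x m, t) = 0)
    (y_zero : ∀ i ∈ Finset.Icc 1 m, ∀ s ∈ Set.Icc (x (i - 1)) (x i), v i 1 (s, y 0) = 0)
    (y_step : ∀ j, 1 ≤ j → j < n → ∀ i ∈ Finset.Icc 1 m, ∀ s ∈ Set.Icc (x (i - 1)) (x i),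
      v i (j + 1) (s, y j) = v i j (s, y j))
    (y_last : ∀ i ∈ Finset.Icc 1 m, ∀ s ∈ Set.Icc (x (i - 1)) (x i), v i n (s, y n) = 0) :
    Conf r m n x y v where
  mem := mem
  x_zero := fun j hj => eq_on_line (mem 1 (Finset.mem_Icc.mpr ⟨le_rfl, hm⟩) j hj)
    (Submodule.zero_mem _) (pred_lt hy hj) (x_zero j hj)
  x_step := fun i hi him j hj => eq_on_line (mem (i + 1) (Finset.mem_Icc.mpr ⟨by omega, him⟩) j hj)
    (mem i (Finset.mem_Icc.mpr ⟨hi, him.le⟩) j hj) (pred_lt hy hj) (x_step i hi him j hj)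
  x_last := fun j hj => eq_on_line (mem m (Finset.mem_Icc.mpr ⟨hm, le_rfl⟩) j hj)
    (Submodule.zero_mem _) (pred_lt hy hj) (x_last j hj)
  y_zero := fun i hi => eq_on_line (swap_mem (mem i hi 1 (Finset.mem_Icc.mpr ⟨le_rfl, hn⟩)))
    (Submodule.zero_mem _) (pred_lt hx hi) (y_zero i hi)
  y_step := fun j hj hjn i hi =>
    eq_on_line (swap_mem (mem i hi (j + 1) (Finset.mem_Icc.mpr ⟨by omega, hjn⟩)))
      (swap_mem (mem i hi j (Finset.mem_Icc.mpr ⟨hj, hjn.le⟩))) (pred_lt hx hi)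
      (y_step j hj hjn i hi)
  y_last := fun i hi => eq_on_line (swap_mem (mem i hi n (Finset.mem_Icc.mpr ⟨hn, le_rfl⟩)))
    (Submodule.zero_mem _) (pred_lt hx hi) (y_last i hi)

section
variable {r : ℕ} {p q s t : ℝ}

lemma interp_left (hr : 1 ≤ r) (hpq : p < q) (u : ℝ × ℝ → ℝ) (y : ℝ) :
    interp r p q s t u (p, y) =
      ∑ b ∈ Finset.range (r + 2), u (p, nd r s t b) * (bp r s t b).eval y := by
  rw [interp, Finset.sum_comm]
  refine Finset.sum_congr rfl fun b _ => ?_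
  rw [← Finset.sum_mul, sum_bp_left hr hpq (fun x => u (x, nd r s t b))]

lemma interp_right (hr : 1 ≤ r) (hpq : p < q) (u : ℝ × ℝ → ℝ) (y : ℝ) :
    interp r p q s t u (q, y) =
      ∑ b ∈ Finset.range (r + 2), u (q, nd r s t b) * (bp r s t b).eval y := by
  rw [interp, Finset.sum_comm]
  refine Finset.sum_congr rfl fun b _ => ?_
  rw [← Finset.sum_mul, sum_bp_right hr hpq (fun x => u (x, nd r s t b))]

lemma interp_bottom (hr : 1 ≤ r) (hst : s < t) (u : ℝ × ℝ → ℝ) (x : ℝ) :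
    interp r p q s t u (x, s) =
      ∑ a ∈ Finset.range (r + 2), u (nd r p q a, s) * (bp r p q a).eval x := by
  have := interp_left (s := p) (t := q) hr hst (u ∘ Prod.swap) x
  rwa [interp_swap] at this

lemma interp_top (hr : 1 ≤ r) (hst : s < t) (u : ℝ × ℝ → ℝ) (x : ℝ) :
    interp r p q s t u (x, t) =
      ∑ a ∈ Finset.range (r + 2), u (nd r p q a, t) * (bp r p q a).eval x := by
  have := interp_right (s := p) (t := q) hr hst (u ∘ Prod.swap) x
  rwa [interp_swap] at this

end

/-- The difference of the finite volume solution and the interpolant on cell `(i,j)`. -/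
noncomputable def discErr {a b c d : ℝ} (r : ℕ) (P : RectPartition a b c d)
    (u uP : PiecewiseFun P) (i j : ℕ) (z : ℝ × ℝ) : ℝ :=
  uP.cellFun i j z -
    interp r (P.x (i - 1)) (P.x i) (P.y (j - 1)) (P.y j) (u.cellFun i j) z

section
variable {a b c d : ℝ} {P : RectPartition a b c d} {r : ℕ}

lemma mem_cell_left {i j : ℕ} (hi : i ∈ Finset.Icc 1 P.m) {t : ℝ}
    (ht : t ∈ Set.Icc (P.y (j - 1)) (P.y j)) : (P.x (i - 1), t) ∈ P.cell i j :=
  ⟨⟨le_rfl, (pred_lt P.hxlt hi).le⟩, ht⟩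

lemma mem_cell_right {i j : ℕ} (hi : i ∈ Finset.Icc 1 P.m) {t : ℝ}
    (ht : t ∈ Set.Icc (P.y (j - 1)) (P.y j)) : (P.x i, t) ∈ P.cell i j :=
  ⟨⟨(pred_lt P.hxlt hi).le, le_rfl⟩, ht⟩

lemma mem_cell_bottom {i j : ℕ} (hj : j ∈ Finset.Icc 1 P.n) {s : ℝ}
    (hs : s ∈ Set.Icc (P.x (i - 1)) (P.x i)) : (s, P.y (j - 1)) ∈ P.cell i j :=
  ⟨hs, ⟨le_rfl, (pred_lt P.hylt hj).le⟩⟩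

lemma mem_cell_top {i j : ℕ} (hj : j ∈ Finset.Icc 1 P.n) {s : ℝ}
    (hs : s ∈ Set.Icc (P.x (i - 1)) (P.x i)) : (s, P.y j) ∈ P.cell i j :=
  ⟨hs, ⟨(pred_lt P.hylt hj).le, le_rfl⟩⟩

lemma mem_bdry_x {x t : ℝ} (hz : (x, t) ∈ P.dom) (hx : x = a ∨ x = b) : (x, t) ∈ P.bdry := by
  refine ⟨hz, fun h => ?_⟩
  rcases hx with rfl | rfl
  · exact lt_irrefl _ h.1.1
  · exact lt_irrefl _ h.1.2

lemma mem_bdry_y {s y : ℝ} (hz : (s, y) ∈ P.dom) (hy : y = c ∨ y = d) : (s, y) ∈ P.bdry := by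
  refine ⟨hz, fun h => ?_⟩
  rcases hy with rfl | rfl
  · exact lt_irrefl _ h.2.1
  · exact lt_irrefl _ h.2.2

lemma discErr_left (hr : 1 ≤ r) (u uP : PiecewiseFun P) {i j : ℕ} (hi : i ∈ Finset.Icc 1 P.m)
    (hj : j ∈ Finset.Icc 1 P.n) {t : ℝ} (ht : t ∈ Set.Icc (P.y (j - 1)) (P.y j)) :
    discErr r P u uP i j (P.x (i - 1), t) = uP.toFun (P.x (i - 1), t) -
      ∑ k ∈ Finset.range (r + 2), u.toFun (P.x (i - 1), nd r (P.y (j - 1)) (P.y j) k) *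
        (bp r (P.y (j - 1)) (P.y j) k).eval t := by
  rw [discErr, interp_left hr (pred_lt P.hxlt hi), uP.agree i hi j hj _ (mem_cell_left hi ht)]
  congr 1
  refine Finset.sum_congr rfl fun k hk => ?_
  rw [u.agree i hi j hj _ (mem_cell_left hi (nd_mem (pred_lt P.hylt hj).le hk))]

lemma discErr_right (hr : 1 ≤ r) (u uP : PiecewiseFun P) {i j : ℕ} (hi : i ∈ Finset.Icc 1 P.m)
    (hj : j ∈ Finset.Icc 1 P.n) {t : ℝ} (ht : t ∈ Set.Icc (P.y (j - 1)) (P.y j)) :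
    discErr r P u uP i j (P.x i, t) = uP.toFun (P.x i, t) -
      ∑ k ∈ Finset.range (r + 2), u.toFun (P.x i, nd r (P.y (j - 1)) (P.y j) k) *
        (bp r (P.y (j - 1)) (P.y j) k).eval t := by
  rw [discErr, interp_right hr (pred_lt P.hxlt hi), uP.agree i hi j hj _ (mem_cell_right hi ht)]
  congr 1
  refine Finset.sum_congr rfl fun k hk => ?_
  rw [u.agree i hi j hj _ (mem_cell_right hi (nd_mem (pred_lt P.hylt hj).le hk))]

lemma discErr_bottom (hr : 1 ≤ r) (u uP : PiecewiseFun P) {i j : ℕ} (hi : i ∈ Finset.Icc 1 P.m)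
    (hj : j ∈ Finset.Icc 1 P.n) {s : ℝ} (hs : s ∈ Set.Icc (P.x (i - 1)) (P.x i)) :
    discErr r P u uP i j (s, P.y (j - 1)) = uP.toFun (s, P.y (j - 1)) -
      ∑ k ∈ Finset.range (r + 2), u.toFun (nd r (P.x (i - 1)) (P.x i) k, P.y (j - 1)) *
        (bp r (P.x (i - 1)) (P.x i) k).eval s := by
  rw [discErr, interp_bottom hr (pred_lt P.hylt hj), uP.agree i hi j hj _ (mem_cell_bottom hj hs)]
  congr 1
  refine Finset.sum_congr rfl fun k hk => ?_
  rw [u.agree i hi j hj _ (mem_cell_bottom hj (nd_mem (pred_lt P.hxlt hi).le hk))]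

lemma discErr_top (hr : 1 ≤ r) (u uP : PiecewiseFun P) {i j : ℕ} (hi : i ∈ Finset.Icc 1 P.m)
    (hj : j ∈ Finset.Icc 1 P.n) {s : ℝ} (hs : s ∈ Set.Icc (P.x (i - 1)) (P.x i)) :
    discErr r P u uP i j (s, P.y j) = uP.toFun (s, P.y j) -
      ∑ k ∈ Finset.range (r + 2), u.toFun (nd r (P.x (i - 1)) (P.x i) k, P.y j) *
        (bp r (P.x (i - 1)) (P.x i) k).eval s := by
  rw [discErr, interp_top hr (pred_lt P.hylt hj), uP.agree i hi j hj _ (mem_cell_top hj hs)]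
  congr 1
  refine Finset.sum_congr rfl fun k hk => ?_
  rw [u.agree i hi j hj _ (mem_cell_top hj (nd_mem (pred_lt P.hxlt hi).le hk))]

/-- The discrete error is conforming. -/
lemma conf_discErr (hr : 1 ≤ r) {u uP : PiecewiseFun P} (hu : ∀ z ∈ P.bdry, u.toFun z = 0)
    (huP : IsTrialFun r P uP) : Conf r P.m P.n P.x P.y (discErr r P u uP) := by
  have h1m : 1 ∈ Finset.Icc 1 P.m := Finset.mem_Icc.mpr ⟨le_rfl, P.hm⟩
  have hmm : P.m ∈ Finset.Icc 1 P.m := Finset.mem_Icc.mpr ⟨P.hm, le_rfl⟩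
  have h1n : 1 ∈ Finset.Icc 1 P.n := Finset.mem_Icc.mpr ⟨le_rfl, P.hn⟩
  have hnn : P.n ∈ Finset.Icc 1 P.n := Finset.mem_Icc.mpr ⟨P.hn, le_rfl⟩
  refine conf_of_eqOn_edges P.hm P.hn P.hxlt P.hylt (fun i hi j hj => ?_) (fun j hj t ht => ?_)
    (fun i hi him j hj t ht => ?_) (fun j hj t ht => ?_) (fun i hi s hs => ?_)
    (fun j hj hjn i hi s hs => ?_) (fun i hi s hs => ?_)
  · exact Submodule.sub_mem _ (IsBiPoly.mem (huP.2.2 i hi j hj)) (interp_mem hr _ _ _ _ _)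
  · have h0 : ∀ t ∈ Set.Icc (P.y (j - 1)) (P.y j), (P.x (1 - 1), t) ∈ P.bdry := fun t ht =>
      mem_bdry_x (cell_subset_dom h1m hj (mem_cell_left h1m ht)) (Or.inl P.hxa)
    refine (discErr_left hr u uP h1m hj ht).trans ?_
    rw [huP.2.1 _ (h0 t ht), Finset.sum_eq_zero, sub_zero]
    intro k hk
    rw [hu _ (h0 _ (nd_mem (pred_lt P.hylt hj).le hk)), zero_mul]
  · have hi1 : i ∈ Finset.Icc 1 P.m := Finset.mem_Icc.mpr ⟨hi, him.le⟩
    have hi2 : i + 1 ∈ Finset.Icc 1 P.m := Finset.mem_Icc.mpr ⟨by omega, him⟩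
    rw [discErr_right hr u uP hi1 hj ht]
    exact discErr_left hr u uP hi2 hj ht
  · have h0 : ∀ t ∈ Set.Icc (P.y (j - 1)) (P.y j), (P.x P.m, t) ∈ P.bdry := fun t ht =>
      mem_bdry_x (cell_subset_dom hmm hj (mem_cell_right hmm ht)) (Or.inr P.hxb)
    rw [discErr_right hr u uP hmm hj ht, huP.2.1 _ (h0 t ht), Finset.sum_eq_zero, sub_zero]
    intro k hk
    rw [hu _ (h0 _ (nd_mem (pred_lt P.hylt hj).le hk)), zero_mul]
  · have h0 : ∀ s ∈ Set.Icc (P.x (i - 1)) (P.x i), (s, P.y (1 - 1)) ∈ P.bdry := fun s hs =>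
      mem_bdry_y (cell_subset_dom hi h1n (mem_cell_bottom h1n hs)) (Or.inl P.hyc)
    refine (discErr_bottom hr u uP hi h1n hs).trans ?_
    rw [huP.2.1 _ (h0 s hs), Finset.sum_eq_zero, sub_zero]
    intro k hk
    rw [hu _ (h0 _ (nd_mem (pred_lt P.hxlt hi).le hk)), zero_mul]
  · have hj1 : j ∈ Finset.Icc 1 P.n := Finset.mem_Icc.mpr ⟨hj, hjn.le⟩
    have hj2 : j + 1 ∈ Finset.Icc 1 P.n := Finset.mem_Icc.mpr ⟨by omega, hjn⟩
    rw [discErr_top hr u uP hi hj1 hs]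
    exact discErr_bottom hr u uP hi hj2 hs
  · have h0 : ∀ s ∈ Set.Icc (P.x (i - 1)) (P.x i), (s, P.y P.n) ∈ P.bdry := fun s hs =>
      mem_bdry_y (cell_subset_dom hi hnn (mem_cell_top hnn hs)) (Or.inr P.hyd)
    rw [discErr_top hr u uP hi hnn hs, huP.2.1 _ (h0 s hs), Finset.sum_eq_zero, sub_zero]
    intro k hk
    rw [hu _ (h0 _ (nd_mem (pred_lt P.hxlt hi).le hk)), zero_mul]

end

/-! ### A discrete-in-space Poincaré inequality -/

lemma add_sq_le_of_sq_le {p q L l S s : ℝ} (hL : 0 ≤ L) (hl : 0 ≤ l) (hS : 0 ≤ S) (hs : 0 ≤ s)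
    (hp : p ^ 2 ≤ L * S) (hq : q ^ 2 ≤ l * s) : (p + q) ^ 2 ≤ (L + l) * (S + s) := by
  have h1 : (p * q) ^ 2 ≤ (L * s) * (l * S) := by
    calc (p * q) ^ 2 = p ^ 2 * q ^ 2 := by ring
      _ ≤ (L * S) * (l * s) := mul_le_mul hp hq (sq_nonneg _) (by positivity)
      _ = _ := by ring
  have h2 : (2 * (p * q)) ^ 2 ≤ (L * s + l * S) ^ 2 := by
    nlinarith [sq_nonneg (L * s - l * S)]
  have h3 := abs_le_of_sq_le_sq' h2 (by positivity)
  nlinarith [h3.2]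

section
variable {m : ℕ} {x : ℕ → ℝ} {f f' : ℕ → ℝ → ℝ}

lemma sq_le_of_chain (hx : ∀ i < m, x i < x (i + 1))
    (hf : ∀ i < m, ∀ t, HasDerivAt (f i) (f' i t) t) (hf' : ∀ i < m, Continuous (f' i))
    (h0 : f 0 (x 0) = 0) (hstep : ∀ i, i + 1 < m → f (i + 1) (x (i + 1)) = f i (x (i + 1)))
    {k : ℕ} (hk : k < m) : ∀ t ∈ Set.Icc (x k) (x (k + 1)),
      f k t ^ 2 ≤ (t - x 0) * ∑ i ∈ Finset.range (k + 1), ∫ s in (x i)..(x (i + 1)), f' i s ^ 2 := by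
  have key : ∀ k < m, ∀ t ∈ Set.Icc (x k) (x (k + 1)), f k t = f k (x k) + ∫ s in (x k)..t, f' k s :=
    fun k hk t _ => by
      rw [intervalIntegral.integral_eq_sub_of_hasDerivAt (fun s _ => hf k hk s)
        ((hf' k hk).intervalIntegrable _ _)]
      ring
  have hq : ∀ k < m, ∀ t ∈ Set.Icc (x k) (x (k + 1)), (∫ s in (x k)..t, f' k s) ^ 2 ≤
      (t - x k) * ∫ s in (x k)..(x (k + 1)), f' k s ^ 2 := fun k hk t ht =>
    (integral_sq_le ht.1 (hf' k hk)).trans (mul_le_mul_of_nonneg_left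
      (integral_mono_subinterval le_rfl ht.1 ht.2 ((hf' k hk).pow 2) fun _ => sq_nonneg _)
      (sub_nonneg.mpr ht.1))
  have hnn : ∀ k < m, 0 ≤ ∫ s in (x k)..(x (k + 1)), f' k s ^ 2 := fun k hk =>
    intervalIntegral.integral_nonneg (hx k hk).le fun _ _ => sq_nonneg _
  induction k with
  | zero =>
    intro t ht
    rw [key 0 hk t ht, h0, zero_add, Finset.sum_range_one]
    exact hq 0 hk t ht
  | succ k ih =>
    intro t ht
    have hp := ih (by omega) (x (k + 1)) ⟨(hx k (by omega)).le, le_rfl⟩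
    rw [← hstep k hk] at hp
    rw [key _ hk t ht, Finset.sum_range_succ]
    have := add_sq_le_of_sq_le
      (sub_nonneg.mpr (mono_of_step hx (Nat.zero_le (k + 1)) hk.le)) (sub_nonneg.mpr ht.1)
      (Finset.sum_nonneg fun i hi => hnn i (by have := Finset.mem_range.mp hi; omega))
      (hnn _ hk) hp (hq _ hk t ht)
    refine this.trans_eq ?_
    ring

lemma poincare_chain (hx : ∀ i < m, x i < x (i + 1))
    (hf : ∀ i < m, ∀ t, HasDerivAt (f i) (f' i t) t) (hf' : ∀ i < m, Continuous (f' i))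
    (h0 : f 0 (x 0) = 0) (hstep : ∀ i, i + 1 < m → f (i + 1) (x (i + 1)) = f i (x (i + 1))) :
    ∑ i ∈ Finset.range m, ∫ s in (x i)..(x (i + 1)), f i s ^ 2 ≤
      (x m - x 0) ^ 2 * ∑ i ∈ Finset.range m, ∫ s in (x i)..(x (i + 1)), f' i s ^ 2 := by
  set S := ∑ i ∈ Finset.range m, ∫ s in (x i)..(x (i + 1)), f' i s ^ 2 with hS
  have hnn : ∀ k < m, 0 ≤ ∫ s in (x k)..(x (k + 1)), f' k s ^ 2 := fun k hk =>
    intervalIntegral.integral_nonneg (hx k hk).le fun _ _ => sq_nonneg _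
  have hle : ∀ k ∈ Finset.range m, ∫ s in (x k)..(x (k + 1)), f k s ^ 2 ≤
      (x (k + 1) - x k) * ((x m - x 0) * S) := fun k hk => by
    have hk' := Finset.mem_range.mp hk
    have hc : Continuous (f k) := continuous_iff_continuousAt.mpr fun t => (hf k hk' t).continuousAt
    rw [← smul_eq_mul, ← intervalIntegral.integral_const]
    refine intervalIntegral.integral_mono_on (hx k hk').le ((hc.pow 2).intervalIntegrable _ _)
      (continuous_const.intervalIntegrable _ _) fun t ht => ?_
    refine (sq_le_of_chain hx hf hf' h0 hstep hk' t ht).trans ?_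
    refine mul_le_mul ?_ ?_ ?_ ?_
    · exact sub_le_sub_right (ht.2.trans (mono_of_step hx hk' le_rfl)) _
    · exact Finset.sum_le_sum_of_subset_of_nonneg (Finset.range_subset_range.mpr hk') fun i hi _ =>
        hnn i (Finset.mem_range.mp hi)
    · exact Finset.sum_nonneg fun i hi => hnn i (by have := Finset.mem_range.mp hi; omega)
    · exact sub_nonneg.mpr (mono_of_step hx (Nat.zero_le m) le_rfl)
  refine (Finset.sum_le_sum hle).trans_eq ?_
  rw [← Finset.sum_mul, Finset.sum_range_sub]
  ring

end

lemma sum_Icc_one (m : ℕ) (f : ℕ → ℝ) :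
    ∑ i ∈ Finset.Icc 1 m, f i = ∑ i ∈ Finset.range m, f (i + 1) := by
  induction m with
  | zero => simp
  | succ m ih => rw [Finset.sum_Icc_succ_top (by omega), ih, Finset.sum_range_succ]

lemma sum_rectInt_eq {m : ℕ} {x : ℕ → ℝ} {F : ℕ → ℝ × ℝ → ℝ} (hF : ∀ i < m, Continuous (F i))
    (s t : ℝ) : ∑ i ∈ Finset.range m, rectInt (F i) (x i) (x (i + 1)) s t =
      ∫ y in s..t, ∑ i ∈ Finset.range m, ∫ z in (x i)..(x (i + 1)), F i (z, y) := by
  rw [intervalIntegral.integral_finsetSum]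
  · refine Finset.sum_congr rfl fun i hi => ?_
    rw [← rectInt_swap (hF i (Finset.mem_range.mp hi))]
    rfl
  · intro i hi
    have := hF i (Finset.mem_range.mp hi)
    exact Continuous.intervalIntegrable (by fun_prop) _ _

/-- Poincaré inequality on a strip for conforming piecewise polynomials. -/
lemma Conf.poincare {r m n : ℕ} {x y : ℕ → ℝ} {v : ℕ → ℕ → ℝ × ℝ → ℝ} (h : Conf r m n x y v)
    (hx : ∀ i < m, x i < x (i + 1)) (hy : ∀ j < n, y j < y (j + 1)) {j : ℕ}
    (hj : j ∈ Finset.Icc 1 n) :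
    ∑ i ∈ Finset.Icc 1 m, rectInt (fun z => v i j z ^ 2) (x (i - 1)) (x i) (y (j - 1)) (y j) ≤
      (x m - x 0) ^ 2 * ∑ i ∈ Finset.Icc 1 m,
        rectInt (fun z => pdx (v i j) z ^ 2) (x (i - 1)) (x i) (y (j - 1)) (y j) := by
  have hmem : ∀ i < m, i + 1 ∈ Finset.Icc 1 m := fun i hi => Finset.mem_Icc.mpr ⟨by omega, hi⟩
  have h1 : ∀ i < m, ContDiff ℝ 1 (v (i + 1) j) := fun i hi =>
    contDiff_one_of_mem (h.mem _ (hmem i hi) j hj)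
  have hc : ∀ i < m, Continuous (fun z => v (i + 1) j z ^ 2) := fun i hi =>
    (h1 i hi).continuous.pow 2
  have hd : ∀ i < m, Continuous (fun z => pdx (v (i + 1) j) z ^ 2) := fun i hi =>
    (continuous_pdx (h1 i hi)).pow 2
  simp only [sum_Icc_one, Nat.add_sub_cancel]
  rw [sum_rectInt_eq hc, sum_rectInt_eq hd, ← intervalIntegral.integral_const_mul]
  refine intervalIntegral.integral_mono_on (pred_lt hy hj).le
    (Continuous.intervalIntegrable ?_ _ _) (Continuous.intervalIntegrable ?_ _ _) fun t _ => ?_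
  · refine continuous_finsetSum _ fun i hi => ?_
    have := (h1 i (Finset.mem_range.mp hi)).continuous
    fun_prop
  · refine continuous_const.mul (continuous_finsetSum _ fun i hi => ?_)
    have := continuous_pdx (h1 i (Finset.mem_range.mp hi))
    fun_prop
  · refine poincare_chain (f := fun i z => v (i + 1) j (z, t))
      (f' := fun i z => pdx (v (i + 1) j) (z, t)) hx (fun i hi z => hasDerivAt_fst (h1 i hi) z t)
      (fun i hi => ?_) (h.x_zero j hj t) fun i hi => h.x_step (i + 1) (by omega) hi j hj t
    have := continuous_pdx (h1 i hi)
    fun_prop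

/-! ### The error estimate -/

lemma rectInt_congr {F H : ℝ × ℝ → ℝ} {p q s t : ℝ} (hpq : p ≤ q) (hst : s ≤ t)
    (h : ∀ x ∈ Set.Icc p q, ∀ y ∈ Set.Icc s t, F (x, y) = H (x, y)) :
    rectInt F p q s t = rectInt H p q s t := by
  refine intervalIntegral.integral_congr fun x hx => ?_
  rw [Set.uIcc_of_le hpq] at hx
  refine intervalIntegral.integral_congr fun y hy => ?_
  rw [Set.uIcc_of_le hst] at hy
  exact h x hx y hy

lemma rectInt_split {m n : ℕ} (x y : ℕ → ℝ) {F : ℝ × ℝ → ℝ} (hF : Continuous F) :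
    rectInt F (x 0) (x m) (y 0) (y n) = ∑ i ∈ Finset.Icc 1 m, ∑ j ∈ Finset.Icc 1 n,
      rectInt F (x (i - 1)) (x i) (y (j - 1)) (y j) := by
  simp only [sum_Icc_one, Nat.add_sub_cancel, rectInt]
  rw [← intervalIntegral.sum_integral_adjacent_intervals fun k _ =>
    Continuous.intervalIntegrable (by fun_prop) _ _]
  refine Finset.sum_congr rfl fun i _ => ?_
  rw [← intervalIntegral.integral_finsetSum fun j _ =>
    Continuous.intervalIntegrable (by fun_prop) _ _]
  refine intervalIntegral.integral_congr fun s _ => ?_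
  exact (intervalIntegral.sum_integral_adjacent_intervals fun k _ =>
    Continuous.intervalIntegrable (by fun_prop) _ _).symm

section
variable {a b c d : ℝ} {P : RectPartition a b c d} {r : ℕ}

lemma setIntegral_dom (hab : a ≤ b) (hcd : c ≤ d) {F : ℝ × ℝ → ℝ} (hF : ContinuousOn F P.dom) :
    ∫ z in P.dom, F z = ∑ i ∈ Finset.Icc 1 P.m, ∑ j ∈ Finset.Icc 1 P.n,
      rectInt F (P.x (i - 1)) (P.x i) (P.y (j - 1)) (P.y j) := by
  set H : ℝ × ℝ → ℝ := fun z => F (max a (min z.1 b), max c (min z.2 d)) with hH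
  have hHc : Continuous H := hF.comp_continuous (by fun_prop) fun z =>
    ⟨⟨le_max_left _ _, max_le hab (min_le_right _ _)⟩,
      ⟨le_max_left _ _, max_le hcd (min_le_right _ _)⟩⟩
  have hFH : ∀ z ∈ P.dom, F z = H z := fun z hz => by
    have h1 : max a (min z.1 b) = z.1 := by rw [min_eq_left hz.1.2, max_eq_right hz.1.1]
    have h2 : max c (min z.2 d) = z.2 := by rw [min_eq_left hz.2.2, max_eq_right hz.2.1]
    simp only [hH, h1, h2]
  have e1 : ∫ z in P.dom, F z = rectInt H a b c d := by
    rw [← setIntegral_rect hab hcd hHc.continuousOn]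
    exact setIntegral_congr_fun (measurableSet_Icc.prod measurableSet_Icc) hFH
  have e2 := rectInt_split (m := P.m) (n := P.n) P.x P.y hHc
  rw [P.hxa, P.hxb, P.hyc, P.hyd] at e2
  rw [e1, e2]
  refine Finset.sum_congr rfl fun i hi => Finset.sum_congr rfl fun j hj => ?_
  exact rectInt_congr (pred_lt P.hxlt hi).le (pred_lt P.hylt hj).le fun s hs t ht =>
    (hFH _ (cell_subset_dom hi hj ⟨hs, ht⟩)).symm

/-- The sum over all cells of the integrals of `F i j`. -/
noncomputable def cellSum (P : RectPartition a b c d) (F : ℕ → ℕ → ℝ × ℝ → ℝ) : ℝ :=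
  ∑ i ∈ Finset.Icc 1 P.m, ∑ j ∈ Finset.Icc 1 P.n,
    rectInt (F i j) (P.x (i - 1)) (P.x i) (P.y (j - 1)) (P.y j)

lemma cellSum_le_brokenNorm_sq {N : ℕ} {u : PiecewiseFun P} (hu : CellSmooth P N u) {s t : ℕ}
    (hs : s ≤ N) (ht : t ≤ s) :
    cellSum P (fun i j z => (pdx^[t] (pdy^[s - t] (u.cellFun i j)) z) ^ 2) ≤
      brokenNorm P u N ^ 2 := by
  have hnn : ∀ i j s t, 0 ≤ ∫ z in P.cell i j, (pdx^[t] (pdy^[s - t] (u.cellFun i j)) z) ^ 2 :=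
    fun i j s t => integral_nonneg fun _ => sq_nonneg _
  rw [brokenNorm, Real.sq_sqrt (Finset.sum_nonneg fun _ _ => sq_nonneg _)]
  refine le_trans ?_ (Finset.single_le_sum (f := fun s => brokenSemi P u s ^ 2)
    (fun _ _ => sq_nonneg _) (Finset.mem_range.mpr (Nat.lt_succ_of_le hs)))
  rw [brokenSemi, Real.sq_sqrt (Finset.sum_nonneg fun i _ => Finset.sum_nonneg fun j _ =>
    Finset.sum_nonneg fun t _ => hnn i j s t)]
  refine Finset.sum_le_sum fun i hi => Finset.sum_le_sum fun j hj => ?_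
  refine le_trans (le_of_eq ?_) (Finset.single_le_sum
    (f := fun t => ∫ z in P.cell i j, (pdx^[t] (pdy^[s - t] (u.cellFun i j)) z) ^ 2)
    (fun t _ => hnn i j s t) (Finset.mem_range.mpr (Nat.lt_succ_of_le ht)))
  have hc : Continuous (pdx^[t] (pdy^[s - t] (u.cellFun i j))) := by
    refine (contDiff_iterate_pdx (n := 0) t (contDiff_iterate_pdy (s - t) ?_)).continuous
    exact (hu i hi j hj).of_le (by norm_cast; omega)
  exact (setIntegral_rect (pred_lt P.hxlt hi).le (pred_lt P.hylt hj).le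
    (hc.pow 2).continuousOn).symm

lemma hx_le_meshSize {i : ℕ} (hi : i ∈ Finset.Icc 1 P.m) : P.x i - P.x (i - 1) ≤ P.meshSize :=
  Finset.le_max' _ _ (Finset.mem_union_left _ (Finset.mem_image_of_mem P.hx hi))

lemma hy_le_meshSize {j : ℕ} (hj : j ∈ Finset.Icc 1 P.n) : P.y j - P.y (j - 1) ≤ P.meshSize :=
  Finset.le_max' _ _ (Finset.mem_union_right _ (Finset.mem_image_of_mem P.hy hj))

lemma meshSize_nonneg : 0 ≤ P.meshSize := by
  have h1 : 1 ∈ Finset.Icc 1 P.m := Finset.mem_Icc.mpr ⟨le_rfl, P.hm⟩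
  exact (sub_nonneg.mpr (pred_lt P.hxlt h1).le).trans (hx_le_meshSize h1)

lemma hx_le_length {i : ℕ} (hi : i ∈ Finset.Icc 1 P.m) : P.x i - P.x (i - 1) ≤ b - a := by
  have hi' := Finset.mem_Icc.mp hi
  exact sub_le_sub ((mono_of_step P.hxlt hi'.2 le_rfl).trans P.hxb.le)
    (P.hxa.symm.le.trans (mono_of_step P.hxlt (Nat.zero_le _) (by omega)))

/-- Global interpolation error in `L²`. -/
lemma cellSum_interp_error (hr : 1 ≤ r) : ∃ K : ℝ, 0 ≤ K ∧
    ∀ (a b c d : ℝ) (P : RectPartition a b c d) (u : PiecewiseFun P), CellSmooth P (r + 2) u →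
    cellSum P (fun i j z => (u.cellFun i j z - interp r (P.x (i - 1)) (P.x i) (P.y (j - 1))
      (P.y j) (u.cellFun i j) z) ^ 2) ≤
      K * (2 + (b - a) ^ 2) * P.meshSize ^ (2 * r + 2) * brokenNorm P u (r + 2) ^ 2 := by
  obtain ⟨K, hK, hle⟩ := interp_L2_error hr
  refine ⟨K, hK, fun a b c d P u hu => ?_⟩
  set H := P.meshSize
  have hH : 0 ≤ H := meshSize_nonneg
  have h1 := cellSum_le_brokenNorm_sq hu (s := r + 1) (t := r + 1) (by omega) le_rfl
  have h2 := cellSum_le_brokenNorm_sq hu (s := r + 1) (t := 0) (by omega) (by omega)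
  have h3 := cellSum_le_brokenNorm_sq hu (s := r + 2) (t := 1) (by omega) (by omega)
  rw [show r + 2 - 1 = r + 1 by omega] at h3
  simp only [Nat.sub_self, Nat.sub_zero, Function.iterate_zero, id_eq, Function.iterate_one]
    at h1 h2 h3
  calc cellSum P (fun i j z => (u.cellFun i j z - interp r (P.x (i - 1)) (P.x i) (P.y (j - 1))
      (P.y j) (u.cellFun i j) z) ^ 2)
      ≤ K * H ^ (2 * r + 2) * (cellSum P (fun i j z => (pdx^[r + 1] (u.cellFun i j) z) ^ 2) +
        cellSum P (fun i j z => (pdy^[r + 1] (u.cellFun i j) z) ^ 2) +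
        (b - a) ^ 2 * cellSum P (fun i j z => (pdx (pdy^[r + 1] (u.cellFun i j)) z) ^ 2)) := by
        simp only [cellSum, mul_add, Finset.mul_sum, ← Finset.sum_add_distrib]
        refine Finset.sum_le_sum fun i hi => Finset.sum_le_sum fun j hj => ?_
        have hx := pred_lt P.hxlt hi
        have hy := pred_lt P.hylt hj
        refine (hle _ _ _ _ hx hy _ (hu i hi j hj)).trans ?_
        have n1 : 0 ≤ rectInt (fun z => (pdx^[r + 1] (u.cellFun i j) z) ^ 2)
          (P.x (i - 1)) (P.x i) (P.y (j - 1)) (P.y j) :=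
          rectInt_nonneg hx.le hy.le fun _ => sq_nonneg _
        have n2 : 0 ≤ rectInt (fun z => (pdy^[r + 1] (u.cellFun i j) z) ^ 2)
          (P.x (i - 1)) (P.x i) (P.y (j - 1)) (P.y j) :=
          rectInt_nonneg hx.le hy.le fun _ => sq_nonneg _
        have n3 : 0 ≤ rectInt (fun z => (pdx (pdy^[r + 1] (u.cellFun i j)) z) ^ 2)
          (P.x (i - 1)) (P.x i) (P.y (j - 1)) (P.y j) :=
          rectInt_nonneg hx.le hy.le fun _ => sq_nonneg _
        have p1 : (P.x i - P.x (i - 1)) ^ (2 * r + 2) ≤ H ^ (2 * r + 2) :=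
          pow_le_pow_left₀ (sub_nonneg.mpr hx.le) (hx_le_meshSize hi) _
        have p2 : (P.y j - P.y (j - 1)) ^ (2 * r + 2) ≤ H ^ (2 * r + 2) :=
          pow_le_pow_left₀ (sub_nonneg.mpr hy.le) (hy_le_meshSize hj) _
        have p3 : (P.x i - P.x (i - 1)) ^ 2 ≤ (b - a) ^ 2 :=
          pow_le_pow_left₀ (sub_nonneg.mpr hx.le) (hx_le_length hi) _
        have p4 : (P.x i - P.x (i - 1)) ^ 2 * (P.y j - P.y (j - 1)) ^ (2 * r + 2) ≤
            (b - a) ^ 2 * H ^ (2 * r + 2) :=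
          mul_le_mul p3 p2 (pow_nonneg (sub_nonneg.mpr hy.le) _) (sq_nonneg _)
        refine (mul_le_mul_of_nonneg_left (add_le_add (add_le_add
          (mul_le_mul_of_nonneg_right p1 n1) (mul_le_mul_of_nonneg_right p2 n2))
          (mul_le_mul_of_nonneg_right p4 n3)) hK).trans_eq ?_
        ring
    _ ≤ K * H ^ (2 * r + 2) * (brokenNorm P u (r + 2) ^ 2 + brokenNorm P u (r + 2) ^ 2 +
        (b - a) ^ 2 * brokenNorm P u (r + 2) ^ 2) := by gcongr
    _ = _ := by ring

lemma Conf.cellSum_sq_le {v : ℕ → ℕ → ℝ × ℝ → ℝ} (h : Conf r P.m P.n P.x P.y v) :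
    cellSum P (fun i j z => v i j z ^ 2) ≤
      (b - a) ^ 2 * cellSum P (fun i j z => pdx (v i j) z ^ 2) := by
  rw [cellSum, cellSum, Finset.sum_comm, Finset.sum_comm (s := Finset.Icc 1 P.m), Finset.mul_sum]
  refine Finset.sum_le_sum fun j hj => ?_
  have := h.poincare P.hxlt P.hylt hj
  rwa [P.hxa, P.hxb] at this

/-- Energy estimate for the difference between the finite volume solution and the interpolant. -/
lemma energy_discErr {G : ℕ → ℝ} (hG : IsGaussPoints r G) (hr : 1 ≤ r) : ∃ K : ℝ, 0 ≤ K ∧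
    ∀ (a b c d : ℝ) (P : RectPartition a b c d) (α : ℝ × ℝ → ℝ) (α₀ α₁ : ℝ),
    0 < α₀ → PiecewiseConstant P α → (∀ z ∈ P.dom, α₀ ≤ α z ∧ α z ≤ α₁) →
    ∀ u uP : PiecewiseFun P, (∀ z ∈ P.bdry, u.toFun z = 0) → CellSmooth P (r + 2) u →
    FluxContinuous P α u → IsFVSolution r G P α u uP →
    α₀ * cellSum P (fun i j z => pdx (discErr r P u uP i j) z ^ 2) ≤
      α₁ * (K * P.meshSize ^ (2 * r + 2) * brokenNorm P u (r + 2) ^ 2) := by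
  obtain ⟨K, hK, hle⟩ := cellForm_le hG hr
  refine ⟨8 * K, by positivity, fun a b c d P α α₀ α₁ hα₀ hpc hα u uP hu0 hu hflux hP => ?_⟩
  have hv := conf_discErr hr hu0 hP.1
  set v := discErr r P u uP with hvdef
  set H := P.meshSize
  have hH : 0 ≤ H := meshSize_nonneg
  have hαα : α₀ ≤ α₁ := by
    have h1m : 1 ∈ Finset.Icc 1 P.m := Finset.mem_Icc.mpr ⟨le_rfl, P.hm⟩
    have h1n : 1 ∈ Finset.Icc 1 P.n := Finset.mem_Icc.mpr ⟨le_rfl, P.hn⟩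
    have hz := hα (P.x (1 - 1), P.y (1 - 1)) (cell_subset_dom h1m h1n
      ⟨Set.left_mem_Icc.mpr (pred_lt P.hxlt h1m).le, Set.left_mem_Icc.mpr (pred_lt P.hylt h1n).le⟩)
    exact hz.1.trans hz.2
  choose! A hA using hpc
  have hAb : ∀ i ∈ Finset.Icc 1 P.m, ∀ j ∈ Finset.Icc 1 P.n, α₀ ≤ A i j ∧ A i j ≤ α₁ := by
    intro i hi j hj
    obtain ⟨s, hs⟩ := exists_between (pred_lt P.hxlt hi)
    obtain ⟨t, ht⟩ := exists_between (pred_lt P.hylt hj)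
    rw [← hA i hi j hj (s, t) ⟨hs, ht⟩]
    exact hα _ (cell_subset_dom hi hj ⟨⟨hs.1.le, hs.2.le⟩, ⟨ht.1.le, ht.2.le⟩⟩)
  have h1 := cellSum_le_brokenNorm_sq hu (s := r + 2) (t := r + 2) le_rfl le_rfl
  have h2 := cellSum_le_brokenNorm_sq hu (s := r + 2) (t := 1) le_rfl (by omega)
  have h3 := cellSum_le_brokenNorm_sq hu (s := r + 2) (t := 0) le_rfl (by omega)
  have h4 := cellSum_le_brokenNorm_sq hu (s := r + 2) (t := r + 1) le_rfl (by omega)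
  rw [show r + 2 - 1 = r + 1 by omega] at h2
  rw [show r + 2 - (r + 1) = 1 by omega] at h4
  simp only [Nat.sub_self, Nat.sub_zero, Function.iterate_zero, id_eq, Function.iterate_one]
    at h1 h2 h3 h4
  have hsum : (0 : ℝ) ≤ -(1 / 2) * (α₀ * cellSum P (fun i j z => pdx (v i j) z ^ 2)) +
      α₁ * (K * H ^ (2 * r + 2) * (cellSum P (fun i j z => (pdx^[r + 2] (u.cellFun i j) z) ^ 2) +
        cellSum P (fun i j z => (pdx (pdy^[r + 1] (u.cellFun i j)) z) ^ 2) +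
        cellSum P (fun i j z => (pdy^[r + 2] (u.cellFun i j) z) ^ 2) +
        cellSum P (fun i j z => (pdx^[r + 1] (pdy (u.cellFun i j)) z) ^ 2))) := by
    rw [← error_equation_cells hG hr hA hu hflux hP hv]
    simp only [cellSum, Finset.mul_sum, ← Finset.sum_add_distrib]
    refine Finset.sum_le_sum fun i hi => Finset.sum_le_sum fun j hj => ?_
    have hx := pred_lt P.hxlt hi
    have hy := pred_lt P.hylt hj
    have key := hle _ _ _ _ hx hy H (hx_le_meshSize hi) (hy_le_meshSize hj) (v i j)
      (hv.mem i hi j hj) _ (hu i hi j hj)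
    have he : (fun z => u.cellFun i j z - interp r (P.x (i - 1)) (P.x i) (P.y (j - 1)) (P.y j)
        (u.cellFun i j) z - v i j z) = fun z => u.cellFun i j z - uP.cellFun i j z := by
      funext z
      simp only [hvdef, discErr]
      ring
    rw [he] at key
    obtain ⟨hA0, hA1⟩ := hAb i hi j hj
    have n (F : ℝ × ℝ → ℝ) : 0 ≤ rectInt (fun z => F z ^ 2)
        (P.x (i - 1)) (P.x i) (P.y (j - 1)) (P.y j) :=
      rectInt_nonneg hx.le hy.le fun _ => sq_nonneg _
    have nx := n (pdx (v i j))
    have ny := n (pdy (v i j))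
    have m1 := n (pdx^[r + 2] (u.cellFun i j))
    have m2 := n (pdx (pdy^[r + 1] (u.cellFun i j)))
    have m3 := n (pdy^[r + 2] (u.cellFun i j))
    have m4 := n (pdx^[r + 1] (pdy (u.cellFun i j)))
    refine (mul_le_mul_of_nonneg_left key (hα₀.le.trans hA0)).trans ?_
    rw [mul_add]
    refine add_le_add ?_ (mul_le_mul_of_nonneg_right hA1 (by positivity))
    have := mul_le_mul_of_nonneg_right hA0 nx
    have := mul_nonneg (hα₀.le.trans hA0) ny
    linarith
  have hfin : α₁ * (K * H ^ (2 * r + 2) *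
      (cellSum P (fun i j z => (pdx^[r + 2] (u.cellFun i j) z) ^ 2) +
        cellSum P (fun i j z => (pdx (pdy^[r + 1] (u.cellFun i j)) z) ^ 2) +
        cellSum P (fun i j z => (pdy^[r + 2] (u.cellFun i j) z) ^ 2) +
        cellSum P (fun i j z => (pdx^[r + 1] (pdy (u.cellFun i j)) z) ^ 2))) ≤
      α₁ * (K * H ^ (2 * r + 2) * (4 * brokenNorm P u (r + 2) ^ 2)) :=
    mul_le_mul_of_nonneg_left (mul_le_mul_of_nonneg_left (by linarith) (by positivity))
      (hα₀.le.trans hαα)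
  linarith

lemma setIntegral_error_le (hr : 1 ≤ r) (hab : a ≤ b) (hcd : c ≤ d) {u uP : PiecewiseFun P}
    (hcu : ContinuousOn u.toFun P.dom) (hu : CellSmooth P (r + 2) u) (huP : IsTrialFun r P uP) :
    ∫ z in P.dom, (u.toFun z - uP.toFun z) ^ 2 ≤
      2 * cellSum P (fun i j z => (u.cellFun i j z - interp r (P.x (i - 1)) (P.x i) (P.y (j - 1))
        (P.y j) (u.cellFun i j) z) ^ 2) +
      2 * cellSum P (fun i j z => discErr r P u uP i j z ^ 2) := by
  rw [setIntegral_dom (F := fun z => (u.toFun z - uP.toFun z) ^ 2) hab hcd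
    ((hcu.sub huP.1).pow 2)]
  simp only [cellSum, Finset.mul_sum, ← Finset.sum_add_distrib]
  refine Finset.sum_le_sum fun i hi => Finset.sum_le_sum fun j hj => ?_
  have hx := (pred_lt P.hxlt hi).le
  have hy := (pred_lt P.hylt hj).le
  have c1 : Continuous (u.cellFun i j) := (hu i hi j hj).continuous
  have c2 : Continuous (uP.cellFun i j) :=
    (contDiff_one_of_mem (IsBiPoly.mem (huP.2.2 i hi j hj))).continuous
  have c3 : Continuous (interp r (P.x (i - 1)) (P.x i) (P.y (j - 1)) (P.y j) (u.cellFun i j)) :=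
    (contDiff_one_of_mem (interp_mem hr _ _ _ _ _)).continuous
  have c4 : Continuous (discErr r P u uP i j) := c2.sub c3
  rw [← rectInt_const_mul, ← rectInt_const_mul, ← rectInt_add (by fun_prop) (by fun_prop),
    rectInt_congr (H := fun z => (u.cellFun i j z - uP.cellFun i j z) ^ 2) hx hy fun s hs t ht => by
      rw [u.agree i hi j hj (s, t) ⟨hs, ht⟩, uP.agree i hi j hj (s, t) ⟨hs, ht⟩]]
  refine rectInt_mono hx hy (by fun_prop) (by fun_prop) fun s _ t _ => ?_
  simp only [discErr]
  nlinarith [sq_nonneg (u.cellFun i j (s, t) + uP.cellFun i j (s, t) - 2 * interp r (P.x (i - 1))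
    (P.x i) (P.y (j - 1)) (P.y j) (u.cellFun i j) (s, t))]

end

end FVM

/-- Optimal-order `L²` error estimate: there is a constant `C`, depending only
on `r`, `σ` and the diameter of `Ω`, such that under the hypotheses of the
superconvergence theorem,
`‖u − u_P‖_{L²(Ω)} ≤ C (1 + α₁/α₀) h^{r+1} ‖u‖_{r+2,P}`. -/
theorem fvm_L2_error (r : ℕ) (hr : 1 ≤ r) (G : ℕ → ℝ) (hG : IsGaussPoints r G)
    (σ : ℝ) (hσ : 1 ≤ σ) :
    ∃ C : ℝ → ℝ, (∀ s : ℝ, 0 < C s) ∧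
      ∀ (a b c d : ℝ), a < b → c < d →
      ∀ P : RectPartition a b c d, P.QuasiUniform σ →
      ∀ (α : ℝ × ℝ → ℝ) (α₀ α₁ : ℝ), 0 < α₀ → PiecewiseConstant P α →
        (∀ z ∈ P.dom, α₀ ≤ α z ∧ α z ≤ α₁) →
      ∀ u : PiecewiseFun P, ContinuousOn u.toFun P.dom →
        (∀ z ∈ P.bdry, u.toFun z = 0) → CellSmooth P (r + 2) u →
        FluxContinuous P α u →
      ∀ uP : PiecewiseFun P, IsFVSolution r G P α u uP →
        Real.sqrt (∫ z in P.dom, (u.toFun z - uP.toFun z) ^ 2) ≤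
          C (Real.sqrt ((b - a) ^ 2 + (d - c) ^ 2)) * (1 + α₁ / α₀) *
            P.meshSize ^ (r + 1) * brokenNorm P u (r + 2) := by
  obtain ⟨K₁, hK₁, hI⟩ := FVM.cellSum_interp_error hr
  obtain ⟨K₂, hK₂, hE⟩ := FVM.energy_discErr hG hr
  refine ⟨fun D => Real.sqrt (1 + 2 * K₁ * (2 + D ^ 2) + 2 * K₂ * D ^ 2),
    fun D => Real.sqrt_pos.mpr (by positivity), ?_⟩
  intro a b c d hab hcd P _ α α₀ α₁ hα₀ hpc hα u hcu hu0 hu hflux uP hP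
  have hD : Real.sqrt ((b - a) ^ 2 + (d - c) ^ 2) ^ 2 = (b - a) ^ 2 + (d - c) ^ 2 :=
    Real.sq_sqrt (by positivity)
  simp only [hD]
  have hca := (Set.left_mem_Icc.mpr hab.le : a ∈ Set.Icc a b)
  have hcc := (Set.left_mem_Icc.mpr hcd.le : c ∈ Set.Icc c d)
  have hα₁ : 0 < α₁ := hα₀.trans_le ((hα (a, c) ⟨hca, hcc⟩).1.trans (hα (a, c) ⟨hca, hcc⟩).2)
  have hρ : 0 < α₁ / α₀ := div_pos hα₁ hα₀
  have hH : 0 ≤ P.meshSize := FVM.meshSize_nonneg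
  have hB : 0 ≤ brokenNorm P u (r + 2) := Real.sqrt_nonneg _
  refine Real.sqrt_le_iff.mpr ⟨by positivity, ?_⟩
  rw [mul_pow, mul_pow, mul_pow, Real.sq_sqrt (by positivity), ← pow_mul,
    show (r + 1) * 2 = 2 * r + 2 by ring]
  set ρ := α₁ / α₀ with hρdef
  set M := P.meshSize ^ (2 * r + 2) * brokenNorm P u (r + 2) ^ 2 with hM
  have hM0 : 0 ≤ M := by positivity
  have hI' := hI a b c d P u hu
  have hE' : FVM.cellSum P (fun i j z => pdx (FVM.discErr r P u uP i j) z ^ 2) ≤ ρ * (K₂ * M) := by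
    have := hE a b c d P α α₀ α₁ hα₀ hpc hα u uP hu0 hu hflux hP
    rw [hρdef, div_mul_eq_mul_div, le_div_iff₀ hα₀, hM]
    linarith
  have hV := (FVM.conf_discErr hr hu0 hP.1).cellSum_sq_le
  have hV' := hV.trans (mul_le_mul_of_nonneg_left hE' (sq_nonneg (b - a)))
  refine (FVM.setIntegral_error_le hr hab.le hcd.le hcu hu hP.1).trans ?_
  have hρ1 : 1 ≤ (1 + ρ) ^ 2 := by nlinarith
  have hρ2 : ρ ≤ (1 + ρ) ^ 2 := by nlinarith
  have hX : (b - a) ^ 2 ≤ (b - a) ^ 2 + (d - c) ^ 2 := le_add_of_nonneg_right (sq_nonneg _)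
  set X := (b - a) ^ 2
  set D := X + (d - c) ^ 2
  have hX0 : 0 ≤ X := sq_nonneg _
  calc _ ≤ 2 * (K₁ * (2 + X) * P.meshSize ^ (2 * r + 2) * brokenNorm P u (r + 2) ^ 2) +
        2 * (X * (ρ * (K₂ * M))) := by linarith
    _ = 2 * K₁ * (2 + X) * 1 * M + 2 * K₂ * X * ρ * M := by rw [hM]; ring
    _ ≤ 2 * K₁ * (2 + D) * (1 + ρ) ^ 2 * M + 2 * K₂ * D * (1 + ρ) ^ 2 * M := by gcongr
    _ ≤ (1 + 2 * K₁ * (2 + D) + 2 * K₂ * D) * (1 + ρ) ^ 2 * M := by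
        have : 0 ≤ (1 + ρ) ^ 2 * M := by positivity
        linarith
    _ = _ := by rw [hM]; ring
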